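/- There exists ε₀ > 0 with the following property. Let 0 < ε ≤ ε₀ and let Q : ℝ_{≥0} → ℕ be a monotonic admissible function satisfying Q(x) ≤ ε · (log log x)^{1/2}/(log log log x)^{1/2} for all sufficiently large x. Then there exist a constant c > 0 and a sequence of real numbers x_i → ∞ such that (1/Q(x_i)) · ∑_{Q(x_i) < q ≤ 2Q(x_i)} G(x_i; q) ≥ c · x_i · (log log log x_i)² for every i. The same statement holds with V_Λ(x_i;q) in place of G(x_i;q). -/

import Mathlib

open Filter Real Complex
open scoped Classical

/-- `θ(x;q,a) = ∑_{p ≤ x, p ≡ a (mod q)} log p`. -/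
noncomputable def thetaQA (x : ℝ) (q a : ℕ) : ℝ :=
  ∑ p ∈ (Finset.range (Nat.floor x + 1)).filter (fun p => p.Prime ∧ p % q = a), Real.log p

/-- The variance `G(x;q)` of primes in arithmetic progressions mod `q`, weighted by `log p`. -/
noncomputable def Gvar (x : ℝ) (q : ℕ) : ℝ :=
  ∑ a ∈ (Finset.range q).filter (fun a => Nat.Coprime a q),
    (thetaQA x q a - x / (Nat.totient q)) ^ 2

/-- The variance `V_Λ(x;q)`. -/
noncomputable def Vvar (x : ℝ) (q : ℕ) : ℝ :=
  ∑ a ∈ (Finset.range q).filter (fun a => Nat.Coprime a q),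
    ((∑ n ∈ (Finset.range (Nat.floor x + 1)).filter (fun n => n % q = a),
        ArithmeticFunction.vonMangoldt n)
      - (1 / (Nat.totient q : ℝ)) *
        ∑ n ∈ (Finset.range (Nat.floor x + 1)).filter (fun n => Nat.Coprime n q),
          ArithmeticFunction.vonMangoldt n) ^ 2

/-! ### A local Hadamard formula -/

lemma exists_entire_factor_single {f : ℂ → ℂ} (hf : Differentiable ℂ f) (hne : ∃ z, f z ≠ 0)
    (ρ : ℂ) : ∃ g : ℂ → ℂ, Differentiable ℂ g ∧
      (∀ z, f z = (z - ρ) ^ (analyticOrderNatAt f ρ) * g z) ∧ g ρ ≠ 0 := by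
  have hA : AnalyticOnNhd ℂ f Set.univ := fun z _ => hf.analyticAt z
  obtain ⟨z₁, hz₁⟩ := hne
  have hz₁' : analyticOrderAt f z₁ ≠ ⊤ := by
    rw [(hf.analyticAt z₁).analyticOrderAt_eq_zero.mpr hz₁]; simp
  have htop : analyticOrderAt f ρ ≠ ⊤ :=
    hA.analyticOrderAt_ne_top_of_isPreconnected isPreconnected_univ (Set.mem_univ _)
      (Set.mem_univ _) hz₁'
  obtain ⟨g₀, hg₀, hg₀ρ, heq⟩ := (hf.analyticAt ρ).analyticOrderAt_ne_top.mp htop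
  set n := analyticOrderNatAt f ρ
  refine ⟨fun z => if z = ρ then g₀ ρ else f z / (z - ρ) ^ n, ?_, ?_, by simpa using hg₀ρ⟩
  · intro z
    by_cases hz : z = ρ
    · subst hz
      refine hg₀.differentiableAt.congr_of_eventuallyEq ?_
      filter_upwards [heq] with w hw
      by_cases hwz : w = z
      · simp [hwz]
      · have : (w - z) ^ n ≠ 0 := pow_ne_zero _ (sub_ne_zero.mpr hwz)
        simp only [hwz, if_false]
        rw [hw]; simp only [smul_eq_mul]; field_simp
    · have hd : DifferentiableAt ℂ (fun z => f z / (z - ρ) ^ n) z := by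
        refine (hf z).div (by fun_prop) (pow_ne_zero _ (sub_ne_zero.mpr hz))
      refine hd.congr_of_eventuallyEq ?_
      filter_upwards [isOpen_ne.mem_nhds hz] with w hw
      simp [show w ≠ ρ from hw]
  · intro z
    by_cases hz : z = ρ
    · subst hz
      have := heq.self_of_nhds
      simpa using this
    · have : (z - ρ) ^ n ≠ 0 := pow_ne_zero _ (sub_ne_zero.mpr hz)
      simp only [hz, if_false]; field_simp

lemma exists_entire_factor {f : ℂ → ℂ} (hf : Differentiable ℂ f) (hne : ∃ z, f z ≠ 0)
    (Z : Finset ℂ) : ∃ g : ℂ → ℂ, Differentiable ℂ g ∧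
      (∀ z, f z = (∏ ρ ∈ Z, (z - ρ) ^ (analyticOrderNatAt f ρ)) * g z) ∧ ∀ ρ ∈ Z, g ρ ≠ 0 := by
  induction Z using Finset.induction_on with
  | empty => exact ⟨f, hf, by simp, by simp⟩
  | insert ρ₀ Z hρ₀ ih =>
    obtain ⟨g, hg, hfg, hgZ⟩ := ih
    have hgne : ∃ z, g z ≠ 0 := by
      obtain ⟨z, hz⟩ := hne
      exact ⟨z, fun h => hz (by rw [hfg z, h, mul_zero])⟩
    obtain ⟨g', hg', hgg', hg'0⟩ := exists_entire_factor_single hg hgne ρ₀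
    have hord : analyticOrderNatAt f ρ₀ = analyticOrderNatAt g ρ₀ := by
      have hP : Differentiable ℂ (fun z => ∏ ρ ∈ Z, (z - ρ) ^ (analyticOrderNatAt f ρ)) := by
        fun_prop
      have hP0 : analyticOrderAt (fun z => ∏ ρ ∈ Z, (z - ρ) ^ (analyticOrderNatAt f ρ)) ρ₀ = 0 := by
        rw [(hP.analyticAt ρ₀).analyticOrderAt_eq_zero, Finset.prod_ne_zero_iff]
        intro a ha
        exact pow_ne_zero _ (sub_ne_zero.mpr (fun h => hρ₀ (h ▸ ha)))
      have : f = (fun z => ∏ ρ ∈ Z, (z - ρ) ^ (analyticOrderNatAt f ρ)) * g := by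
        ext z; exact hfg z
      unfold analyticOrderNatAt
      conv_lhs => rw [this]
      rw [analyticOrderAt_mul (hP.analyticAt _) (hg.analyticAt _)]
      rw [hP0, zero_add]
    refine ⟨g', hg', fun z => ?_, fun ρ hρ => ?_⟩
    · rw [Finset.prod_insert hρ₀, hord, hfg z, hgg' z]; ring
    · rcases Finset.mem_insert.mp hρ with rfl | h
      · exact hg'0
      · intro h0
        exact hgZ ρ h (by rw [hgg' ρ, h0, mul_zero])

lemma logDeriv_sub_le_of_nonvanishing {g : ℂ → ℂ} (hg : Differentiable ℂ g) {R M : ℝ} (hR : 0 < R)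
    (hM : 0 < M) (hnz : ∀ z ∈ Metric.ball (0 : ℂ) R, g z ≠ 0)
    (hb : ∀ z ∈ Metric.ball (0 : ℂ) R, ‖g z‖ ≤ ‖g 0‖ * Real.exp M) {s s' : ℂ}
    (hs : ‖s‖ < R / 8) (hs' : ‖s'‖ < R / 8) :
    ‖logDeriv g s - logDeriv g s'‖ ≤ 64 * M / R ^ 2 * ‖s - s'‖ := by
  have h0 : (0 : ℂ) ∈ Metric.ball (0 : ℂ) R := by simpa using hR
  have hGd : DifferentiableOn ℂ (logDeriv g) (Metric.ball 0 R) := by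
    intro z hz
    have : DifferentiableAt ℂ (fun z => deriv g z / g z) z :=
      ((hg.contDiff (n := 2)).differentiable_deriv_two z).div (hg z) (hnz z hz)
    exact this.differentiableWithinAt
  obtain ⟨h, hh0, hh⟩ := hGd.isExactOn_ball.with_val_at 0 0
  have hexp : ∀ z ∈ Metric.ball (0 : ℂ) R, g z * Complex.exp (-h z) = g 0 := by
    intro z hz
    have hconv : Convex ℝ (Metric.ball (0 : ℂ) R) := convex_ball _ _
    have hd : ∀ w ∈ Metric.ball (0 : ℂ) R,
        HasDerivWithinAt (fun z => g z * Complex.exp (-h z)) 0 (Metric.ball 0 R) w := by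
      intro w hw
      have h1 := ((hg w).hasDerivAt).mul ((hh w hw).neg.cexp)
      have h2 : deriv g w * Complex.exp (-h w) + g w * (Complex.exp (-h w) * -logDeriv g w) = 0 := by
        rw [logDeriv_apply]; field_simp [hnz w hw]; ring
      rw [← h2]
      exact h1.hasDerivWithinAt
    have := hconv.norm_image_sub_le_of_norm_hasDerivWithin_le (C := 0) hd (by simp) h0 hz
    have h3 : g z * Complex.exp (-h z) - g 0 * Complex.exp (-h 0) = 0 := by simpa using this
    rw [hh0] at h3; simpa [sub_eq_zero] using h3
  have hre : Set.MapsTo h (Metric.ball 0 R) {z | z.re ≤ M} := by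
    intro z hz
    have h1 := hexp z hz
    have h2 : g z = g 0 * Complex.exp (h z) := by
      rw [← h1, mul_assoc, ← Complex.exp_add]; simp
    have h3 := hb z hz
    rw [h2, norm_mul, Complex.norm_exp] at h3
    have h4 := le_of_mul_le_mul_left h3 (norm_pos_iff.mpr (hnz 0 h0))
    exact Real.exp_le_exp.mp h4
  have hhd : DifferentiableOn ℂ h (Metric.ball 0 R) :=
    fun z hz => (hh z hz).differentiableAt.differentiableWithinAt
  have hbound : ∀ z : ℂ, ‖z‖ ≤ R / 2 → ‖h z‖ ≤ 2 * M := by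
    intro z hz
    have h1 := Complex.borelCaratheodory_zero hM hhd hre hR (z := z)
      (by rw [mem_ball_zero_iff]; linarith) hh0
    refine h1.trans ?_
    rw [div_le_iff₀ (by linarith)]
    nlinarith
  have hG : ∀ z : ℂ, ‖z‖ ≤ R / 4 → ‖logDeriv g z‖ ≤ 8 * M / R := by
    intro z hz
    have hzb : z ∈ Metric.ball (0 : ℂ) R := by rw [mem_ball_zero_iff]; linarith
    have hsub : Metric.closedBall z (R / 4) ⊆ Metric.ball 0 R := by
      intro w hw
      rw [mem_ball_zero_iff]; rw [Metric.mem_closedBall, dist_eq_norm] at hw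
      have := norm_le_norm_add_norm_sub' w z
      linarith
    have h1 := Complex.norm_deriv_le_of_forall_mem_sphere_norm_le (c := z) (R := R / 4)
      (C := 2 * M) (f := h) (by positivity)
      ((hhd.mono hsub).diffContOnCl_ball subset_rfl) (by
        intro w hw
        apply hbound
        rw [mem_sphere_iff_norm] at hw
        have := norm_le_norm_add_norm_sub' w z
        linarith)
    rw [(hh z hzb).deriv] at h1
    refine h1.trans (le_of_eq ?_)
    field_simp; norm_num
  have hG' : ∀ z ∈ Metric.ball (0 : ℂ) (R / 8), ‖deriv (logDeriv g) z‖ ≤ 64 * M / R ^ 2 := by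
    intro z hz
    rw [mem_ball_zero_iff] at hz
    have hsub : Metric.closedBall z (R / 8) ⊆ Metric.ball 0 R := by
      intro w hw
      rw [mem_ball_zero_iff]; rw [Metric.mem_closedBall, dist_eq_norm] at hw
      have := norm_le_norm_add_norm_sub' w z
      linarith
    have h1 := Complex.norm_deriv_le_of_forall_mem_sphere_norm_le (c := z) (R := R / 8)
      (C := 8 * M / R) (f := logDeriv g) (by positivity)
      ((hGd.mono hsub).diffContOnCl_ball subset_rfl) (by
        intro w hw
        apply hG
        rw [mem_sphere_iff_norm] at hw
        have := norm_le_norm_add_norm_sub' w z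
        linarith)
    refine h1.trans (le_of_eq ?_)
    field_simp; norm_num
  refine (convex_ball (0 : ℂ) (R / 8)).norm_image_sub_le_of_norm_deriv_le (f := logDeriv g)
    (fun z hz => ?_) hG' (by rwa [mem_ball_zero_iff]) (by rwa [mem_ball_zero_iff])
  rw [mem_ball_zero_iff] at hz
  exact (hGd z (by rw [mem_ball_zero_iff]; linarith)).differentiableAt
    (Metric.isOpen_ball.mem_nhds (by rw [mem_ball_zero_iff]; linarith))

lemma finite_zeros_closedBall {f : ℂ → ℂ} (hf : Differentiable ℂ f) (hne : ∃ z, f z ≠ 0)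
    (R : ℝ) : {z : ℂ | f z = 0 ∧ ‖z‖ ≤ R}.Finite := by
  by_contra hinf
  have hA : AnalyticOnNhd ℂ f Set.univ := fun z _ => hf.analyticAt z
  obtain ⟨x, -, hx⟩ := Set.Infinite.exists_accPt_of_subset_isCompact hinf
    (isCompact_closedBall (0 : ℂ) R) (fun z hz => by simpa using hz.2)
  obtain ⟨z, hz⟩ := hne
  refine hz (hA.eqOn_zero_of_preconnected_of_frequently_eq_zero isPreconnected_univ
    (Set.mem_univ x) ?_ (Set.mem_univ z))
  exact (accPt_iff_frequently_nhdsNE.mp hx).mono fun w hw => hw.1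

lemma logDeriv_factor {f g : ℂ → ℂ} (hg : Differentiable ℂ g) (Z : Finset ℂ) (m : ℂ → ℕ)
    (hfg : ∀ z, f z = (∏ ρ ∈ Z, (z - ρ) ^ (m ρ)) * g z) {s : ℂ} (hs : f s ≠ 0)
    (hsZ : ∀ ρ ∈ Z, s ≠ ρ) :
    logDeriv f s = (∑ ρ ∈ Z, (m ρ : ℂ) * (1 / (s - ρ))) + logDeriv g s := by
  have hf : f = fun z => (∏ ρ ∈ Z, (z - ρ) ^ (m ρ)) * g z := funext hfg
  have h1 : ∀ ρ ∈ Z, (s - ρ) ^ (m ρ) ≠ 0 := fun ρ hρ => pow_ne_zero _ (sub_ne_zero.mpr (hsZ ρ hρ))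
  have hgs : g s ≠ 0 := fun h => hs (by rw [hfg, h, mul_zero])
  rw [hf, logDeriv_mul s (Finset.prod_ne_zero_iff.mpr h1) hgs (by fun_prop) (hg s)]
  congr 1
  have := logDeriv_prod (s := Z) (f := fun ρ z => (z - ρ) ^ (m ρ)) (x := s) h1
    (fun ρ _ => by fun_prop)
  rw [this]
  refine Finset.sum_congr rfl fun ρ _ => ?_
  rw [logDeriv_fun_pow (f := fun z => z - ρ) (by fun_prop), logDeriv_apply]
  simp

theorem tendsto_sum_zeros_logDeriv {f : ℂ → ℂ} (hf : Differentiable ℂ f) (h0 : f 0 ≠ 0) {C : ℝ}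
    (hC : 0 < C) (hgr : ∀ z, ‖f z‖ ≤ Real.exp (C * (1 + ‖z‖) ^ (3 / 2 : ℝ))) {s s' : ℂ}
    (hs : f s ≠ 0) (hs' : f s' ≠ 0) :
    Tendsto (fun R : ℝ => ∑ ρ ∈ (finite_zeros_closedBall hf ⟨0, h0⟩ R).toFinset,
      (analyticOrderNatAt f ρ : ℂ) * (1 / (s - ρ) - 1 / (s' - ρ))) atTop
      (nhds (logDeriv f s - logDeriv f s')) := by
  rw [tendsto_iff_norm_sub_tendsto_zero]
  set M : ℝ → ℝ := fun R => C * (1 + 3 * R) ^ (3 / 2 : ℝ) + |Real.log ‖f 0‖| + 1 with hM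
  have hlim : Tendsto (fun R : ℝ => 64 * M R / R ^ 2 * ‖s - s'‖) atTop (nhds 0) := by
    have h1 : Tendsto (fun R : ℝ => 64 * (C * 8 * R ^ (-(1 / 2) : ℝ) +
        (|Real.log ‖f 0‖| + 1) * R ^ (-2 : ℝ)) * ‖s - s'‖) atTop
        (nhds (64 * (C * 8 * 0 + (|Real.log ‖f 0‖| + 1) * 0) * ‖s - s'‖)) :=
      ((((tendsto_rpow_neg_atTop (by norm_num)).const_mul _).add
        ((tendsto_rpow_neg_atTop (by norm_num)).const_mul _)).const_mul _).mul_const _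
    simp only [mul_zero, add_zero, zero_mul] at h1
    refine squeeze_zero' ?_ ?_ h1
    · filter_upwards [eventually_gt_atTop 0] with R hR
      have : 0 < M R := by positivity
      positivity
    · filter_upwards [eventually_ge_atTop 1] with R hR
      refine mul_le_mul_of_nonneg_right ?_ (norm_nonneg _)
      have hR0 : 0 < R := by linarith
      have e1 : (1 + 3 * R) ^ (3 / 2 : ℝ) ≤ 8 * R ^ (3 / 2 : ℝ) := by
        calc (1 + 3 * R) ^ (3 / 2 : ℝ) ≤ (4 * R) ^ (3 / 2 : ℝ) :=
              Real.rpow_le_rpow (by positivity) (by linarith) (by norm_num)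
          _ = 8 * R ^ (3 / 2 : ℝ) := by
              rw [Real.mul_rpow (by norm_num) hR0.le]
              congr 1
              rw [show (4 : ℝ) = 2 ^ (2 : ℝ) by norm_num, ← Real.rpow_mul (by norm_num)]
              norm_num
      have e2 : R ^ (-(1 / 2) : ℝ) = R ^ (3 / 2 : ℝ) / R ^ 2 := by
        rw [← Real.rpow_natCast R 2, ← Real.rpow_sub hR0]; norm_num
      have e3 : R ^ (-2 : ℝ) = 1 / R ^ 2 := by
        rw [Real.rpow_neg hR0.le, one_div]; norm_num
      rw [e2, e3, mul_div_assoc]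
      refine mul_le_mul_of_nonneg_left ?_ (by norm_num)
      rw [hM]
      rw [show C * 8 * (R ^ (3 / 2 : ℝ) / R ^ 2) + (|Real.log ‖f 0‖| + 1) * (1 / R ^ 2) =
        (C * (8 * R ^ (3 / 2 : ℝ)) + |Real.log ‖f 0‖| + 1) / R ^ 2 by ring]
      simp only
      gcongr
  refine squeeze_zero' (Eventually.of_forall fun _ => norm_nonneg _) ?_ hlim
  filter_upwards [eventually_gt_atTop (8 * ‖s‖), eventually_gt_atTop (8 * ‖s'‖),
    eventually_gt_atTop 0] with R hRs hRs' hR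
  set Z := (finite_zeros_closedBall hf ⟨0, h0⟩ R).toFinset with hZ
  have hmem : ∀ ρ, ρ ∈ Z ↔ f ρ = 0 ∧ ‖ρ‖ ≤ R := by intro ρ; simp [hZ]
  obtain ⟨g, hg, hfg, hgZ⟩ := exists_entire_factor hf ⟨0, h0⟩ Z
  have hsZ : ∀ t, f t ≠ 0 → ∀ ρ ∈ Z, t ≠ ρ := by
    rintro t ht ρ hρ rfl; exact ht ((hmem t).mp hρ).1
  rw [logDeriv_factor hg Z _ hfg hs (hsZ s hs), logDeriv_factor hg Z _ hfg hs' (hsZ s' hs')]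
  have hg0 : g 0 ≠ 0 := fun h => h0 (by rw [hfg, h, mul_zero])
  have hnz : ∀ z ∈ Metric.ball (0 : ℂ) R, g z ≠ 0 := by
    intro z hz h
    have : z ∈ Z := (hmem z).mpr ⟨by rw [hfg, h, mul_zero], by
      rw [mem_ball_zero_iff] at hz; exact hz.le⟩
    exact hgZ z this h
  have hMpos : 0 < M R := by positivity
  have hbig : ∀ z ∈ Metric.closedBall (0 : ℂ) (3 * R), ‖g z‖ ≤ ‖g 0‖ * Real.exp (M R) := by
    intro z hz
    rw [← closure_ball (0 : ℂ) (by positivity)] at hz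
    refine Complex.norm_le_of_forall_mem_frontier_norm_le Metric.isBounded_ball
      (hg.diffContOnCl) ?_ hz
    intro w hw
    rw [frontier_ball (0 : ℂ) (by positivity), mem_sphere_zero_iff_norm] at hw
    have hP : ‖∏ ρ ∈ Z, ((0 : ℂ) - ρ) ^ (analyticOrderNatAt f ρ)‖ ≤
        ‖∏ ρ ∈ Z, (w - ρ) ^ (analyticOrderNatAt f ρ)‖ := by
      rw [norm_prod, norm_prod]
      refine Finset.prod_le_prod (fun _ _ => norm_nonneg _) fun ρ hρ => ?_
      rw [norm_pow, norm_pow]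
      have h1 := ((hmem ρ).mp hρ).2
      have h2 := norm_sub_norm_le w ρ
      refine pow_le_pow_left₀ (norm_nonneg _) ?_ _
      rw [zero_sub, norm_neg]; linarith
    have hPpos : 0 < ‖∏ ρ ∈ Z, ((0 : ℂ) - ρ) ^ (analyticOrderNatAt f ρ)‖ := by
      rw [norm_pos_iff]; intro h; exact h0 (by rw [hfg, h, zero_mul])
    have hfw : ‖f w‖ ≤ ‖f 0‖ * Real.exp (M R) := by
      refine (hgr w).trans ?_
      rw [hw, ← Real.exp_log (norm_pos_iff.mpr h0), ← Real.exp_add]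
      refine Real.exp_le_exp.mpr ?_
      have := neg_abs_le (Real.log ‖f 0‖)
      simp only [hM]; linarith
    rw [hfg w, hfg 0, norm_mul, norm_mul] at hfw
    have h3 : ‖∏ ρ ∈ Z, ((0 : ℂ) - ρ) ^ (analyticOrderNatAt f ρ)‖ * ‖g w‖ ≤
        ‖∏ ρ ∈ Z, ((0 : ℂ) - ρ) ^ (analyticOrderNatAt f ρ)‖ * (‖g 0‖ * Real.exp (M R)) :=
      (mul_le_mul_of_nonneg_right hP (norm_nonneg _)).trans (by rw [← mul_assoc]; exact hfw)
    exact le_of_mul_le_mul_left h3 hPpos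
  have key := logDeriv_sub_le_of_nonvanishing hg hR hMpos hnz (fun z hz => hbig z (by
    rw [mem_ball_zero_iff] at hz; rw [mem_closedBall_zero_iff]; linarith))
    (s := s) (s' := s') (by linarith) (by linarith)
  refine le_trans (le_of_eq ?_) key
  rw [← norm_neg]; congr 1
  simp only [mul_sub, Finset.sum_sub_distrib]; ring

/-! ### Analytic continuation of Dirichlet series by partial summation -/

lemma differentiableAt_integral_partialSum (a : ℕ → ℂ) {C r : ℝ} (hr : 0 ≤ r)
    (hb : ∀ n : ℕ, ‖∑ k ∈ Finset.Icc 1 n, a k‖ ≤ C * (n : ℝ) ^ r) {s : ℂ} (hs : r < s.re) :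
    DifferentiableAt ℂ (fun s : ℂ => ∫ t in Set.Ioi (1 : ℝ),
      (∑ k ∈ Finset.Icc 1 ⌊t⌋₊, a k) * (t : ℂ) ^ (-(s + 1))) s := by
  have hC : 0 ≤ C := by simpa using (norm_nonneg _).trans (hb 1)
  set A : ℝ → ℂ := fun t => ∑ k ∈ Finset.Icc 1 ⌊t⌋₊, a k with hA
  have hAb : ∀ t : ℝ, 0 ≤ t → ‖A t‖ ≤ C * t ^ r := fun t ht => (hb _).trans
    (mul_le_mul_of_nonneg_left (Real.rpow_le_rpow (by positivity) (Nat.floor_le ht) hr) hC)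
  have hA0 : ∀ t : ℝ, t < 1 → A t = 0 := by
    intro t ht
    have : ⌊t⌋₊ = 0 := Nat.floor_eq_zero.mpr ht
    simp [hA, this]
  have hInt : (fun s : ℂ => ∫ t in Set.Ioi (1 : ℝ), A t * (t : ℂ) ^ (-(s + 1))) =
      fun s => mellin A (-s) := by
    ext s
    rw [mellin, ← MeasureTheory.integral_indicator measurableSet_Ioi,
      ← MeasureTheory.integral_indicator measurableSet_Ioi]
    refine MeasureTheory.integral_congr_ae ?_
    have : ∀ᵐ t : ℝ, t ≠ 1 := by
      simp [MeasureTheory.ae_iff]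
    filter_upwards [this] with t ht
    rcases lt_or_gt_of_ne ht with h | h
    · rw [Set.indicator_of_notMem (by simp [h.le])]
      by_cases h0 : 0 < t
      · rw [Set.indicator_of_mem (by simpa using h0), hA0 t h, smul_zero]
      · rw [Set.indicator_of_notMem (by simpa using h0)]
    · rw [Set.indicator_of_mem (by simpa using h),
        Set.indicator_of_mem (by simp; linarith), smul_eq_mul, mul_comm]
      congr 2; ring
  rw [hInt]
  have hmd : DifferentiableAt ℂ (mellin A) (-s) := by
    refine mellin_differentiableAt_of_isBigO_rpow (a := -r) (b := (-s).re - 1) ?_ ?_ (by simpa)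
      ?_ (by linarith)
    · have := locallyIntegrableOn_mul_sum_Icc a (m := 1) (a := 0) le_rfl (g := fun _ => 1)
        (MeasureTheory.locallyIntegrableOn_const _)
      simp only [one_mul] at this
      exact this.mono_set Set.Ioi_subset_Ici_self
    · refine Asymptotics.IsBigO.of_bound C ?_
      filter_upwards [eventually_ge_atTop 0] with t ht
      rw [neg_neg, Real.norm_of_nonneg (Real.rpow_nonneg ht _)]
      exact hAb t ht
    · refine Asymptotics.IsBigO.of_bound 1 ?_
      have : Set.Iio (1 : ℝ) ∈ nhdsWithin 0 (Set.Ioi 0) :=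
        mem_nhdsWithin_of_mem_nhds (Iio_mem_nhds one_pos)
      filter_upwards [this] with t ht
      rw [hA0 t ht, norm_zero]; positivity
  exact hmd.comp s differentiableAt_id.neg

lemma norm_integral_partialSum_le (a : ℕ → ℂ) {C r : ℝ} (hr : 0 ≤ r)
    (hb : ∀ n : ℕ, ‖∑ k ∈ Finset.Icc 1 n, a k‖ ≤ C * (n : ℝ) ^ r) {s : ℂ} (hs : r < s.re) :
    ‖∫ t in Set.Ioi (1 : ℝ),
      (∑ k ∈ Finset.Icc 1 ⌊t⌋₊, a k) * (t : ℂ) ^ (-(s + 1))‖ ≤ C / (s.re - r) := by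
  have hC : 0 ≤ C := by simpa using (norm_nonneg _).trans (hb 1)
  have hi : MeasureTheory.IntegrableOn (fun t : ℝ => C * t ^ (r - s.re - 1)) (Set.Ioi 1) :=
    (integrableOn_Ioi_rpow_of_lt (by linarith) one_pos).const_mul C
  refine (MeasureTheory.norm_integral_le_of_norm_le hi ?_).trans (le_of_eq ?_)
  · refine (MeasureTheory.ae_restrict_mem measurableSet_Ioi).mono fun t ht => ?_
    have ht1 : (1 : ℝ) < t := ht
    have ht0 : 0 < t := by linarith
    rw [norm_mul, Complex.norm_cpow_eq_rpow_re_of_pos ht0]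
    have e : t ^ (r - s.re - 1) = t ^ r * t ^ (-(s + 1)).re := by
      rw [← Real.rpow_add ht0]; congr 1; simp; ring
    rw [e, ← mul_assoc]
    refine mul_le_mul_of_nonneg_right ?_ (Real.rpow_nonneg ht0.le _)
    exact (hb _).trans (mul_le_mul_of_nonneg_left
      (Real.rpow_le_rpow (by positivity) (Nat.floor_le ht0.le) hr) hC)
  · rw [MeasureTheory.integral_const_mul, integral_Ioi_rpow_of_lt (by linarith) one_pos]
    rw [Real.one_rpow, show r - s.re - 1 + 1 = -(s.re - r) by ring]
    have : s.re - r ≠ 0 := by linarith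
    field_simp

lemma norm_sum_dirichletCharacter_le {N : ℕ} [NeZero N] {χ : DirichletCharacter ℂ N} (hχ : χ ≠ 1)
    (n : ℕ) : ‖∑ k ∈ Finset.Icc 1 n, χ k‖ ≤ N := by
  have hper : ∀ m : ℕ, ∑ k ∈ Finset.range N, χ ((k + m : ℕ) : ZMod N) = 0 := by
    intro m
    have h1 : ∑ k ∈ Finset.range N, χ ((k + m : ℕ) : ZMod N) = ∑ x : ZMod N, χ x := by
      refine Finset.sum_bij' (fun k _ => ((k + m : ℕ) : ZMod N)) (fun x _ => (x - m).val)
        (fun _ _ => Finset.mem_univ _) (fun x _ => Finset.mem_range.mpr (ZMod.val_lt _))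
        (fun k hk => ?_) (fun x _ => ?_) (fun _ _ => rfl)
      · simp only [Nat.cast_add, add_sub_cancel_right]
        exact ZMod.val_cast_of_lt (Finset.mem_range.mp hk)
      · simp
    rw [h1]
    exact MulChar.sum_eq_zero_of_ne_one hχ
  have hmul : ∀ j : ℕ, ∑ k ∈ Finset.range (j * N), χ ((k + 1 : ℕ) : ZMod N) = 0 := by
    intro j
    induction j with
    | zero => simp
    | succ j ih =>
      rw [Nat.succ_mul, Finset.sum_range_add, ih, zero_add, ← hper (j * N + 1)]
      refine Finset.sum_congr rfl fun k _ => ?_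
      congr 2; ring
  have e : ∑ k ∈ Finset.Icc 1 n, χ k = ∑ k ∈ Finset.range n, χ ((k + 1 : ℕ) : ZMod N) := by
    rw [Finset.range_eq_Ico, Finset.sum_Ico_add' (fun k : ℕ => χ (k : ZMod N)) 0 n 1]
    rfl
  rw [e, show n = n / N * N + n % N by rw [Nat.div_add_mod'], Finset.sum_range_add, hmul, zero_add]
  refine (norm_sum_le _ _).trans ?_
  refine (Finset.sum_le_card_nsmul _ _ 1 fun k _ => DirichletCharacter.norm_le_one χ _).trans ?_
  simp only [Finset.card_range, nsmul_eq_mul, mul_one]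
  exact_mod_cast (Nat.mod_lt _ (NeZero.pos N)).le

lemma isPreconnected_re_gt (r : ℝ) : IsPreconnected {s : ℂ | r < s.re} :=
  (convex_halfSpace_re_gt r).isPreconnected

lemma norm_LFunction_le {N : ℕ} [NeZero N] {χ : DirichletCharacter ℂ N} (hχ : χ ≠ 1)
    {s : ℂ} (hs : 1 / 2 ≤ s.re) : ‖DirichletCharacter.LFunction χ s‖ ≤ 2 * N * ‖s‖ := by
  have hb : ∀ n : ℕ, ‖∑ k ∈ Finset.Icc 1 n, χ k‖ ≤ (N : ℝ) * (n : ℝ) ^ (0 : ℝ) := by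
    intro n; simpa using norm_sum_dirichletCharacter_le hχ n
  set G : ℂ → ℂ := fun s => s * ∫ t in Set.Ioi (1 : ℝ),
      (∑ k ∈ Finset.Icc 1 ⌊t⌋₊, χ k) * (t : ℂ) ^ (-(s + 1)) with hG
  have hGd : DifferentiableOn ℂ G {s : ℂ | 0 < s.re} := fun s hs =>
    (differentiableAt_id.mul
      (differentiableAt_integral_partialSum (fun k => χ k) le_rfl hb hs)).differentiableWithinAt
  have hop : IsOpen {s : ℂ | 0 < s.re} := isOpen_lt continuous_const Complex.continuous_re
  have heq : Set.EqOn (DirichletCharacter.LFunction χ) G {s : ℂ | 0 < s.re} := by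
    refine AnalyticOnNhd.eqOn_of_preconnected_of_eventuallyEq (z₀ := 2) ?_
      (hGd.analyticOnNhd hop) (isPreconnected_re_gt 0) (by simp) ?_
    · exact fun z _ => (DirichletCharacter.differentiable_LFunction hχ).analyticAt z
    · have : {s : ℂ | 1 < s.re} ∈ nhds (2 : ℂ) :=
        (isOpen_lt continuous_const Complex.continuous_re).mem_nhds (by simp)
      filter_upwards [this] with z hz
      rw [DirichletCharacter.LFunction_eq_LSeries χ hz, hG]
      refine LSeries_eq_mul_integral (fun k => χ k) le_rfl (lt_trans zero_lt_one hz) ?_ ?_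
      · exact DirichletCharacter.LSeriesSummable_of_one_lt_re χ hz
      · refine Asymptotics.IsBigO.of_bound N (Eventually.of_forall fun n => ?_)
        simpa using norm_sum_dirichletCharacter_le hχ n
  have hs0 : 0 < s.re := by linarith
  rw [heq hs0, hG, norm_mul, mul_comm]
  refine mul_le_mul_of_nonneg_right ?_ (norm_nonneg _)
  refine (norm_integral_partialSum_le (fun k => χ k) le_rfl hb hs0).trans ?_
  rw [sub_zero, div_le_iff₀ hs0]
  have : (0 : ℝ) ≤ N := by positivity
  nlinarith

/-! ### Growth of completed Dirichlet L-functions -/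

lemma norm_Gamma_le_Gamma_re {s : ℂ} (hs : 0 < s.re) : ‖Complex.Gamma s‖ ≤ Real.Gamma s.re := by
  rw [Complex.Gamma_eq_integral hs, Real.Gamma_eq_integral hs, Complex.GammaIntegral]
  refine MeasureTheory.norm_integral_le_of_norm_le (Real.GammaIntegral_convergent hs) ?_
  refine (MeasureTheory.ae_restrict_mem measurableSet_Ioi).mono fun t ht => ?_
  rw [norm_mul, Complex.norm_cpow_eq_rpow_re_of_pos ht, Complex.norm_of_nonneg (Real.exp_pos _).le]
  simp

lemma Gamma_le_exp_rpow : ∃ C : ℝ, 0 < C ∧ ∀ x : ℝ, 1 / 4 ≤ x →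
    Real.Gamma x ≤ Real.exp (C * (1 + x) ^ (3 / 2 : ℝ)) := by
  refine ⟨2 + |Real.log (Real.Gamma (1 / 4))|, by positivity, fun x hx => ?_⟩
  have hx0 : 0 < x := by linarith
  have h1 : (1 : ℝ) ≤ (1 + x) ^ (3 / 2 : ℝ) := Real.one_le_rpow (by linarith) (by norm_num)
  set n := ⌈x⌉₊ with hn
  have hn1 : 1 ≤ n := Nat.one_le_ceil_iff.mpr hx0
  have hnx : (n : ℝ) ≤ 1 + x := by rw [add_comm]; exact (Nat.ceil_lt_add_one hx0.le).le
  have hxn : x ≤ n := Nat.le_ceil x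
  have hmax := Real.convexOn_Gamma.le_max_of_mem_Icc (x := (1 / 4 : ℝ)) (y := (n : ℝ) + 1) (z := x)
    (by simp) (by simp; positivity) ⟨hx, by linarith⟩
  refine hmax.trans (max_le ?_ ?_)
  · rw [← Real.exp_log (Real.Gamma_pos_of_pos (by norm_num : (0 : ℝ) < 1 / 4)), Real.log_exp]
    refine Real.exp_le_exp.mpr ?_
    have := le_abs_self (Real.log (Real.Gamma (1 / 4)))
    have := abs_nonneg (Real.log (Real.Gamma (1 / 4)))
    nlinarith
  · rw [Real.Gamma_nat_eq_factorial]
    have hn0 : (0 : ℝ) < n := by exact_mod_cast hn1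
    calc (n.factorial : ℝ) ≤ (n : ℝ) ^ n := by exact_mod_cast Nat.factorial_le_pow n
      _ = Real.exp (n * Real.log n) := by
          rw [← Real.rpow_natCast, Real.rpow_def_of_pos hn0, mul_comm]
      _ ≤ _ := by
          refine Real.exp_le_exp.mpr ?_
          have h2 := Real.log_le_rpow_div hn0.le (ε := 1 / 2) (by norm_num)
          have h3 : (n : ℝ) * Real.log n ≤ 2 * (n : ℝ) ^ (3 / 2 : ℝ) := by
            calc (n : ℝ) * Real.log n ≤ n * ((n : ℝ) ^ (1 / 2 : ℝ) / (1 / 2)) :=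
                  mul_le_mul_of_nonneg_left h2 hn0.le
              _ = 2 * ((n : ℝ) ^ (1 : ℝ) * (n : ℝ) ^ (1 / 2 : ℝ)) := by rw [Real.rpow_one]; ring
              _ = _ := by rw [← Real.rpow_add hn0]; norm_num
          have h4 : (n : ℝ) ^ (3 / 2 : ℝ) ≤ (1 + x) ^ (3 / 2 : ℝ) :=
            Real.rpow_le_rpow hn0.le hnx (by norm_num)
          have := abs_nonneg (Real.log (Real.Gamma (1 / 4)))
          nlinarith

lemma norm_Gammaℝ_le {w : ℂ} (hw : 0 < w.re) : ‖Complex.Gammaℝ w‖ ≤ Real.Gamma (w.re / 2) := by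
  rw [Complex.Gammaℝ_def, norm_mul, Complex.norm_cpow_eq_rpow_re_of_pos Real.pi_pos]
  have h1 : Real.pi ^ (-w / 2).re ≤ 1 :=
    Real.rpow_le_one_of_one_le_of_nonpos (by linarith [Real.pi_gt_three]) (by simp; linarith)
  have h2 := norm_Gamma_le_Gamma_re (s := w / 2) (by simpa using hw)
  have h3 : (w / 2).re = w.re / 2 := by simp
  rw [h3] at h2
  calc _ ≤ 1 * ‖Complex.Gamma (w / 2)‖ := mul_le_mul_of_nonneg_right h1 (norm_nonneg _)
    _ ≤ _ := by rw [one_mul]; exact h2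

/-- The parity of a Dirichlet character, as a real number. -/
noncomputable def parity {N : ℕ} (χ : DirichletCharacter ℂ N) : ℝ := if χ.Even then 0 else 1

lemma parity_nonneg {N : ℕ} (χ : DirichletCharacter ℂ N) : 0 ≤ parity χ := by
  unfold parity; split_ifs <;> norm_num

lemma parity_le_one {N : ℕ} (χ : DirichletCharacter ℂ N) : parity χ ≤ 1 := by
  unfold parity; split_ifs <;> norm_num

lemma gammaFactor_eq_Gammaℝ {N : ℕ} (χ : DirichletCharacter ℂ N) (s : ℂ) :
    χ.gammaFactor s = Complex.Gammaℝ (s + parity χ) := by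
  unfold DirichletCharacter.gammaFactor parity
  split_ifs <;> simp

lemma gammaFactor_ne_zero {N : ℕ} (χ : DirichletCharacter ℂ N) {s : ℂ} (hs : 0 < s.re) :
    χ.gammaFactor s ≠ 0 := by
  rw [gammaFactor_eq_Gammaℝ]
  exact Complex.Gammaℝ_ne_zero_of_re_pos (by simp; linarith [parity_nonneg χ])

lemma completedLFunction_eq_mul {N : ℕ} [NeZero N] (χ : DirichletCharacter ℂ N) {s : ℂ}
    (hs : 0 < s.re) :
    χ.completedLFunction s = χ.gammaFactor s * χ.LFunction s := by
  rw [DirichletCharacter.LFunction_eq_completed_div_gammaFactor χ s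
    (Or.inl (by rintro rfl; simp at hs))]
  field_simp [gammaFactor_ne_zero χ hs]

lemma norm_completedLFunction_le_of_half_le {N : ℕ} [NeZero N] {χ : DirichletCharacter ℂ N}
    (hχ : χ ≠ 1) : ∃ C : ℝ, 0 < C ∧ ∀ s : ℂ, 1 / 2 ≤ s.re →
      ‖χ.completedLFunction s‖ ≤ Real.exp (C * (1 + ‖s‖) ^ (3 / 2 : ℝ)) := by
  obtain ⟨C, hC, hG⟩ := Gamma_le_exp_rpow
  refine ⟨C * 8 + 2 * N + 1, by positivity, fun s hs => ?_⟩
  have hs0 : 0 < s.re := by linarith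
  have hre : s.re ≤ ‖s‖ := Complex.re_le_norm s
  have hp0 := parity_nonneg χ
  have hp1 := parity_le_one χ
  have hwre : (s + parity χ).re = s.re + parity χ := by simp
  rw [completedLFunction_eq_mul χ hs0, norm_mul, gammaFactor_eq_Gammaℝ]
  have h1 := (norm_Gammaℝ_le (w := s + parity χ) (by rw [hwre]; linarith)).trans
    (hG _ (by rw [hwre]; linarith))
  have h2 := norm_LFunction_le hχ hs
  have hs1 : (1 : ℝ) ≤ 1 + ‖s‖ := by linarith [norm_nonneg s]
  have hE : 1 + ‖s‖ ≤ (1 + ‖s‖) ^ (3 / 2 : ℝ) := by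
    conv_lhs => rw [← Real.rpow_one (1 + ‖s‖)]
    exact Real.rpow_le_rpow_of_exponent_le hs1 (by norm_num)
  have h3 : (1 + (s + parity χ).re / 2) ^ (3 / 2 : ℝ) ≤ 8 * (1 + ‖s‖) ^ (3 / 2 : ℝ) := by
    calc (1 + (s + parity χ).re / 2) ^ (3 / 2 : ℝ) ≤ (4 * (1 + ‖s‖)) ^ (3 / 2 : ℝ) := by
          refine Real.rpow_le_rpow (by rw [hwre]; linarith) (by rw [hwre]; linarith) (by norm_num)
      _ = 8 * (1 + ‖s‖) ^ (3 / 2 : ℝ) := by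
          rw [Real.mul_rpow (by norm_num) (by linarith)]
          congr 1
          rw [show (4 : ℝ) = 2 ^ (2 : ℝ) by norm_num, ← Real.rpow_mul (by norm_num)]
          norm_num
  have h4 : 2 * N * ‖s‖ ≤ Real.exp ((2 * N + 1) * (1 + ‖s‖) ^ (3 / 2 : ℝ)) := by
    have e1 : (2 * N : ℝ) ≤ Real.exp (2 * N) := by linarith [Real.add_one_le_exp (2 * N : ℝ)]
    have e2 : ‖s‖ ≤ Real.exp ‖s‖ := by linarith [Real.add_one_le_exp ‖s‖]
    calc 2 * N * ‖s‖ ≤ Real.exp (2 * N) * Real.exp ‖s‖ :=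
          mul_le_mul e1 e2 (norm_nonneg _) (Real.exp_pos _).le
      _ = Real.exp (2 * N + ‖s‖) := (Real.exp_add _ _).symm
      _ ≤ _ := by
          refine Real.exp_le_exp.mpr ?_
          have : (0 : ℝ) ≤ N := by positivity
          have := norm_nonneg s
          nlinarith
  calc _ ≤ Real.exp (C * (1 + (s + parity χ).re / 2) ^ (3 / 2 : ℝ)) *
        Real.exp ((2 * N + 1) * (1 + ‖s‖) ^ (3 / 2 : ℝ)) := by
        refine mul_le_mul ?_ (h2.trans h4) (norm_nonneg _) (Real.exp_pos _).le
        exact h1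
    _ = _ := (Real.exp_add _ _).symm
    _ ≤ _ := by
        refine Real.exp_le_exp.mpr ?_
        nlinarith

theorem norm_completedLFunction_le {N : ℕ} [NeZero N] {χ : DirichletCharacter ℂ N}
    (hχ : χ ≠ 1) (hp : χ.IsPrimitive) : ∃ C : ℝ, 0 < C ∧ ∀ s : ℂ,
      ‖χ.completedLFunction s‖ ≤ Real.exp (C * (1 + ‖s‖) ^ (3 / 2 : ℝ)) := by
  obtain ⟨C, hC, h⟩ := norm_completedLFunction_le_of_half_le hχ
  obtain ⟨C', hC', h'⟩ := norm_completedLFunction_le_of_half_le (χ := χ⁻¹) (inv_ne_one.mpr hχ)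
  refine ⟨C + 4 * C' + Real.log N + ‖χ.rootNumber‖, by
    have : 0 ≤ Real.log N := Real.log_natCast_nonneg N
    positivity, fun s => ?_⟩
  have hN1 : (1 : ℝ) ≤ N := by exact_mod_cast NeZero.one_le
  have hl : 0 ≤ Real.log N := Real.log_natCast_nonneg N
  have hs1 : (1 : ℝ) ≤ 1 + ‖s‖ := by linarith [norm_nonneg s]
  set E := (1 + ‖s‖) ^ (3 / 2 : ℝ) with hEdef
  have hE : 1 + ‖s‖ ≤ E := by
    conv_lhs => rw [← Real.rpow_one (1 + ‖s‖)]
    exact Real.rpow_le_rpow_of_exponent_le hs1 (by norm_num)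
  have hE1 : 1 ≤ E := hs1.trans hE
  have hr := norm_nonneg χ.rootNumber
  rcases le_or_gt (1 / 2) s.re with hs | hs
  · refine (h s hs).trans (Real.exp_le_exp.mpr ?_)
    nlinarith [mul_nonneg hl (zero_le_one.trans hE1), mul_nonneg hr (zero_le_one.trans hE1),
      mul_nonneg hC'.le (zero_le_one.trans hE1)]
  · have hfe := hp.completedLFunction_one_sub (1 - s)
    rw [sub_sub_cancel] at hfe
    rw [hfe, norm_mul, norm_mul]
    have e1 : ‖(N : ℂ) ^ (1 - s - 1 / 2)‖ ≤ Real.exp (Real.log N * E) := by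
      rw [Complex.norm_natCast_cpow_of_pos (NeZero.pos N), Real.rpow_def_of_pos (by linarith)]
      refine Real.exp_le_exp.mpr (mul_le_mul_of_nonneg_left ?_ hl)
      have := Complex.abs_re_le_norm s
      have := neg_abs_le s.re
      simp; linarith
    have e2 : ‖χ.rootNumber‖ ≤ Real.exp (‖χ.rootNumber‖ * E) := by
      have := Real.add_one_le_exp (‖χ.rootNumber‖ * E)
      nlinarith
    have e3 := h' (1 - s) (by simp; linarith)
    have e4 : (1 + ‖1 - s‖) ^ (3 / 2 : ℝ) ≤ 4 * E := by
      calc (1 + ‖1 - s‖) ^ (3 / 2 : ℝ) ≤ (2 * (1 + ‖s‖)) ^ (3 / 2 : ℝ) := by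
            refine Real.rpow_le_rpow (by positivity) ?_ (by norm_num)
            have := norm_sub_le (1 : ℂ) s
            rw [norm_one] at this; linarith
        _ = 2 ^ (3 / 2 : ℝ) * E := by rw [Real.mul_rpow (by norm_num) (by linarith)]
        _ ≤ 4 * E := by
            refine mul_le_mul_of_nonneg_right ?_ (by linarith)
            calc (2 : ℝ) ^ (3 / 2 : ℝ) ≤ 2 ^ (2 : ℝ) :=
                  Real.rpow_le_rpow_of_exponent_le (by norm_num) (by norm_num)
              _ = 4 := by norm_num
    calc _ ≤ Real.exp (Real.log N * E) * Real.exp (‖χ.rootNumber‖ * E) *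
          Real.exp (C' * (1 + ‖1 - s‖) ^ (3 / 2 : ℝ)) := by gcongr
      _ = Real.exp (Real.log N * E + ‖χ.rootNumber‖ * E + C' * (1 + ‖1 - s‖) ^ (3 / 2 : ℝ)) := by
          rw [Real.exp_add, Real.exp_add]
      _ ≤ _ := by
          refine Real.exp_le_exp.mpr ?_
          nlinarith [mul_le_mul_of_nonneg_left e4 hC'.le]

/-! ### Symmetries and zeros of completed Dirichlet L-functions -/

lemma parity_inv {N : ℕ} (χ : DirichletCharacter ℂ N) : parity χ⁻¹ = parity χ := by
  have : (χ⁻¹).Even ↔ χ.Even := by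
    unfold DirichletCharacter.Even
    rw [← MulChar.star_apply' χ (-1), star_eq_iff_star_eq, star_one, eq_comm]
  unfold parity
  simp only [this]

lemma isPrimitive_inv {N : ℕ} {χ : DirichletCharacter ℂ N} (h : χ.IsPrimitive) :
    (χ⁻¹).IsPrimitive := by
  have key : ∀ ψ : DirichletCharacter ℂ N, ∀ d, ψ.FactorsThrough d → (ψ⁻¹).FactorsThrough d := by
    rintro ψ d ⟨hd, χ₀, hχ₀⟩
    exact ⟨hd, χ₀⁻¹, by rw [hχ₀, map_inv]⟩
  have hset : (χ⁻¹).conductorSet = χ.conductorSet := by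
    ext d
    exact ⟨fun hd => inv_inv χ ▸ key _ _ hd, fun hd => key _ _ hd⟩
  unfold DirichletCharacter.IsPrimitive DirichletCharacter.conductor at *
  rw [hset, h]

lemma completedLFunction_inv {N : ℕ} [NeZero N] {χ : DirichletCharacter ℂ N} (hχ : χ ≠ 1) (s : ℂ) :
    (χ⁻¹).completedLFunction s = starRingEnd ℂ (χ.completedLFunction (starRingEnd ℂ s)) := by
  have hd1 := DirichletCharacter.differentiable_completedLFunction (inv_ne_one.mpr hχ)
  have hd2 := DirichletCharacter.differentiable_completedLFunction hχ
  have hd3 : Differentiable ℂ (fun s => starRingEnd ℂ (χ.completedLFunction (starRingEnd ℂ s))) := by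
    intro z
    have := (hd2 (starRingEnd ℂ z)).conj_conj
    rwa [Complex.conj_conj] at this
  refine congr_fun (AnalyticOnNhd.eq_of_eventuallyEq (z₀ := 2) (fun z _ => hd1.analyticAt z)
    (fun z _ => hd3.analyticAt z) ?_) s
  have : {s : ℂ | 1 < s.re} ∈ nhds (2 : ℂ) :=
    (isOpen_lt continuous_const Complex.continuous_re).mem_nhds (by simp)
  filter_upwards [this] with z hz
  have hz1 : 1 < z.re := hz
  have hz' : 1 < (starRingEnd ℂ z).re := by simpa using hz1
  rw [completedLFunction_eq_mul _ (by linarith), completedLFunction_eq_mul _ (by linarith), map_mul,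
    gammaFactor_eq_Gammaℝ, gammaFactor_eq_Gammaℝ, parity_inv]
  congr 1
  · have hpi : starRingEnd ℂ (Real.pi : ℂ) = Real.pi := Complex.conj_ofReal _
    rw [Complex.Gammaℝ_def, Complex.Gammaℝ_def, map_mul, ← Complex.Gamma_conj]
    have e : starRingEnd ℂ ((starRingEnd ℂ z + parity χ) / 2) = (z + parity χ) / 2 := by
      simp [Complex.conj_ofReal, map_ofNat]
    rw [e]
    congr 1
    have := Complex.cpow_conj (Real.pi : ℂ) (-(starRingEnd ℂ z + parity χ) / 2)
      (by rw [Complex.arg_ofReal_of_nonneg Real.pi_pos.le]; exact Real.pi_pos.ne)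
    rw [hpi] at this
    rw [← this]
    congr 1
    simp [Complex.conj_ofReal, map_ofNat]
  · rw [DirichletCharacter.LFunction_eq_LSeries _ hz1, DirichletCharacter.LFunction_eq_LSeries _ hz',
      LSeries, LSeries, Complex.conj_tsum]
    refine tsum_congr fun n => ?_
    rcases eq_or_ne n 0 with rfl | hn
    · simp
    · rw [LSeries.term_of_ne_zero hn, LSeries.term_of_ne_zero hn, map_div₀]
      congr 1
      · rw [← MulChar.star_apply']; simp
      · have := Complex.cpow_conj (n : ℂ) (starRingEnd ℂ z)
          (by rw [Complex.natCast_arg]; exact Real.pi_pos.ne)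
        rw [Complex.conj_conj, Complex.conj_natCast] at this
        exact this

lemma logDeriv_conj_conj (f : ℂ → ℂ) (s : ℂ) :
    logDeriv (fun z => starRingEnd ℂ (f (starRingEnd ℂ z))) s =
      starRingEnd ℂ (logDeriv f (starRingEnd ℂ s)) := by
  rw [logDeriv_apply, logDeriv_apply, map_div₀]
  congr 1
  have := congr_fun (deriv_conj_conj (𝕜 := ℂ) (f := f)) s
  simpa [Function.comp_def] using this

lemma logDeriv_completedLFunction_reflect {N : ℕ} [NeZero N] {χ : DirichletCharacter ℂ N}
    (hχ : χ ≠ 1) (hp : χ.IsPrimitive) {z : ℂ}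
    (hz : χ.completedLFunction (1 - starRingEnd ℂ z) ≠ 0) :
    logDeriv χ.completedLFunction (1 - starRingEnd ℂ z) =
      -Real.log N - starRingEnd ℂ (logDeriv χ.completedLFunction z) := by
  have hd := DirichletCharacter.differentiable_completedLFunction hχ
  set F := χ.completedLFunction with hF
  set s := starRingEnd ℂ z with hs
  have hfe : (fun s => F (1 - s)) = fun s : ℂ => ((N : ℂ) ^ (s - 1 / 2) * χ.rootNumber) *
      starRingEnd ℂ (F (starRingEnd ℂ s)) := by
    ext s
    rw [hF, hp.completedLFunction_one_sub s, completedLFunction_inv hχ]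
  have hN0 : (N : ℂ) ≠ 0 := NeZero.ne _
  have h1 : logDeriv (fun s => F (1 - s)) s = -logDeriv F (1 - s) := by
    rw [logDeriv_apply, logDeriv_apply, deriv_comp_const_sub, neg_div]
  have hne : ((N : ℂ) ^ (s - 1 / 2) * χ.rootNumber) * starRingEnd ℂ (F (starRingEnd ℂ s)) ≠ 0 := by
    rw [← congr_fun hfe s]; exact hz
  have hcc : DifferentiableAt ℂ (fun s => starRingEnd ℂ (F (starRingEnd ℂ s))) s := by
    have := (hd (starRingEnd ℂ s)).conj_conj
    rwa [Complex.conj_conj] at this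
  have hr : χ.rootNumber ≠ 0 := fun h => hne (by rw [h]; simp)
  have hpow : HasDerivAt (fun s : ℂ => (N : ℂ) ^ (s - 1 / 2))
      ((N : ℂ) ^ (s - 1 / 2) * Complex.log N * 1) s :=
    ((hasDerivAt_id s).sub_const _).const_cpow (Or.inl hN0)
  rw [hfe, logDeriv_mul s (left_ne_zero_of_mul hne) (right_ne_zero_of_mul hne)
    (hpow.differentiableAt.mul_const _) hcc, logDeriv_mul_const _ _ hr, logDeriv_apply,
    hpow.deriv, logDeriv_conj_conj, hs, Complex.conj_conj] at h1
  have hpne : (N : ℂ) ^ (starRingEnd ℂ z - 1 / 2) ≠ 0 := by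
    rw [Complex.cpow_ne_zero_iff]; exact Or.inl hN0
  rw [mul_one, mul_div_cancel_left₀ _ hpne, ← Complex.natCast_log] at h1
  linear_combination h1

lemma hasSum_of_nonneg_of_tendsto {ι : Type*} {b : ι → ℝ} (hb : ∀ i, 0 ≤ b i) {T : ℝ → Finset ι}
    {L : ℝ} (hL : Tendsto (fun R => ∑ i ∈ T R, b i) atTop (nhds L))
    (hT : ∀ i, b i ≠ 0 → ∀ᶠ R in atTop, i ∈ T R) : HasSum b L := by
  have hle : ∀ S : Finset ι, ∑ i ∈ S, b i ≤ L := by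
    intro S
    have h1 : ∀ᶠ R in atTop, ∀ i ∈ S, b i ≠ 0 → i ∈ T R := by
      rw [Filter.eventually_all_finset]
      intro i _
      by_cases h : b i = 0
      · exact Eventually.of_forall fun _ h' => absurd h h'
      · filter_upwards [hT i h] with R hR _ using hR
    refine ge_of_tendsto hL ?_
    filter_upwards [h1] with R hR
    rw [← Finset.sum_filter_ne_zero S]
    exact Finset.sum_le_sum_of_subset_of_nonneg (fun i hi => by
      rw [Finset.mem_filter] at hi; exact hR i hi.1 hi.2) (fun i _ _ => hb i)
  have hsum : Summable b := summable_of_sum_le hb hle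
  have h2 : L ≤ ∑' i, b i := le_of_tendsto hL (Eventually.of_forall fun R =>
    hsum.sum_le_tsum _ fun i _ => hb i)
  have h3 : ∑' i, b i ≤ L := hsum.tsum_le_of_sum_le hle
  rw [le_antisymm h2 h3]
  exact hsum.hasSum

/-- The multiplicity of `1/2 + iγ` as a zero of the completed L-function of `χ`. -/
noncomputable def zeroMult {N : ℕ} [NeZero N] (χ : DirichletCharacter ℂ N) (γ : ℝ) : ℕ :=
  analyticOrderNatAt χ.completedLFunction (1 / 2 + γ * I)

/-- The generalized Riemann hypothesis for all nontrivial Dirichlet characters. -/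
def GRH : Prop := ∀ (q : ℕ) [NeZero q] (χ : DirichletCharacter ℂ q), χ ≠ 1 →
  ∀ s : ℂ, 1 / 2 < s.re → χ.LFunction s ≠ 0

lemma GRH.completedLFunction_ne_zero (h : GRH) {N : ℕ} [NeZero N] {χ : DirichletCharacter ℂ N}
    (hχ : χ ≠ 1) (hp : χ.IsPrimitive) {s : ℂ} (hs : s.re ≠ 1 / 2) :
    χ.completedLFunction s ≠ 0 := by
  have key : ∀ ψ : DirichletCharacter ℂ N, ψ ≠ 1 → ∀ s : ℂ, 1 / 2 < s.re →
      ψ.completedLFunction s ≠ 0 := by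
    intro ψ hψ s hs
    rw [completedLFunction_eq_mul ψ (by linarith)]
    exact mul_ne_zero (gammaFactor_ne_zero ψ (by linarith)) (h N ψ hψ s hs)
  rcases lt_or_gt_of_ne hs with h1 | h1
  · intro h0
    refine key χ⁻¹ (inv_ne_one.mpr hχ) (1 - s) (by simp; linarith) ?_
    rw [(isPrimitive_inv hp).completedLFunction_one_sub, inv_inv, h0, mul_zero]
  · exact key χ hχ s h1

/-- Under GRH, the real part of the logarithmic derivative of a completed L-function is a sum of
Poisson kernels over the zeros. -/
theorem GRH.hasSum_zeroMult (h : GRH) {N : ℕ} [NeZero N] {χ : DirichletCharacter ℂ N}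
    (hχ : χ ≠ 1) (hp : χ.IsPrimitive) {κ : ℝ} (hκ : 0 < κ) (t : ℝ) :
    HasSum (fun γ : ℝ => (zeroMult χ γ : ℝ) * (κ / (κ ^ 2 + (t - γ) ^ 2)))
      ((logDeriv χ.completedLFunction (1 / 2 + κ + t * I)).re + Real.log N / 2) := by
  have hd := DirichletCharacter.differentiable_completedLFunction hχ
  obtain ⟨C, hC, hgr⟩ := norm_completedLFunction_le hχ hp
  set F := χ.completedLFunction with hF
  set f : ℂ → ℂ := fun z => F (2 + z) with hf
  have hfd : Differentiable ℂ f := hd.comp (differentiable_id.const_add 2)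
  have hf0 : f 0 ≠ 0 := by
    simp only [hf]
    exact h.completedLFunction_ne_zero hχ hp (by simp; norm_num)
  have hfgr : ∀ z, ‖f z‖ ≤ Real.exp ((C * 9) * (1 + ‖z‖) ^ (3 / 2 : ℝ)) := by
    intro z
    refine (hgr _).trans (Real.exp_le_exp.mpr ?_)
    rw [mul_assoc]
    refine mul_le_mul_of_nonneg_left ?_ hC.le
    calc (1 + ‖2 + z‖) ^ (3 / 2 : ℝ) ≤ (3 * (1 + ‖z‖)) ^ (3 / 2 : ℝ) := by
          refine Real.rpow_le_rpow (by positivity) ?_ (by norm_num)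
          have := norm_add_le (2 : ℂ) z
          rw [Complex.norm_ofNat] at this
          linarith [norm_nonneg z]
      _ = 3 ^ (3 / 2 : ℝ) * (1 + ‖z‖) ^ (3 / 2 : ℝ) := Real.mul_rpow (by norm_num) (by positivity)
      _ ≤ 9 * (1 + ‖z‖) ^ (3 / 2 : ℝ) := by
          refine mul_le_mul_of_nonneg_right ?_ (by positivity)
          calc (3 : ℝ) ^ (3 / 2 : ℝ) ≤ 3 ^ (2 : ℝ) :=
                Real.rpow_le_rpow_of_exponent_le (by norm_num) (by norm_num)
            _ = 9 := by norm_num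
  set z₀ : ℂ := 1 / 2 + κ + t * I with hz₀
  have hz₀re : z₀.re = 1 / 2 + κ := by simp [hz₀]
  have hz₁re : (1 - starRingEnd ℂ z₀).re = 1 / 2 - κ := by
    simp only [Complex.sub_re, Complex.one_re, Complex.conj_re, hz₀re]; ring
  have hFz₀ : F z₀ ≠ 0 := h.completedLFunction_ne_zero hχ hp (by rw [hz₀re]; linarith)
  have hFz₁ : F (1 - starRingEnd ℂ z₀) ≠ 0 :=
    h.completedLFunction_ne_zero hχ hp (by rw [hz₁re]; linarith)
  have hlim := tendsto_sum_zeros_logDeriv hfd hf0 (by positivity : 0 < C * 9) hfgr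
    (s := z₀ - 2) (s' := 1 - starRingEnd ℂ z₀ - 2) (by simpa [hf] using hFz₀)
    (by simpa [hf] using hFz₁)
  have hld : ∀ s, logDeriv f (s - 2) = logDeriv F s := by
    intro s
    rw [logDeriv_apply, logDeriv_apply]
    simp only [hf]
    rw [deriv_comp_const_add, add_sub_cancel]
  rw [hld, hld, logDeriv_completedLFunction_reflect hχ hp hFz₁] at hlim
  have hlim2 : Tendsto (fun R : ℝ => ∑ ρ ∈ (finite_zeros_closedBall hfd ⟨0, hf0⟩ R).toFinset,
      ((analyticOrderNatAt f ρ : ℂ) * (1 / (z₀ - 2 - ρ) - 1 / (1 - starRingEnd ℂ z₀ - 2 - ρ))).re / 2)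
      atTop (nhds ((logDeriv F z₀).re + Real.log N / 2)) := by
    have h1 := ((Complex.continuous_re.tendsto _).comp hlim).div_const 2
    convert h1 using 2
    · simp only [Function.comp, Complex.re_sum, Finset.sum_div]
    · simp only [Complex.sub_re, Complex.neg_re, Complex.conj_re, Complex.ofReal_re]; ring
  have hzero : ∀ R : ℝ, ∀ ρ ∈ (finite_zeros_closedBall hfd ⟨0, hf0⟩ R).toFinset,
      ρ = -(3 / 2) + ρ.im * I := by
    intro R ρ hρ
    simp only [Set.Finite.mem_toFinset, Set.mem_ofPred_eq] at hρ
    have : (2 + ρ).re = 1 / 2 := by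
      by_contra hne
      exact h.completedLFunction_ne_zero hχ hp hne hρ.1
    apply Complex.ext
    · simp at this ⊢; linarith
    · simp
  refine hasSum_of_nonneg_of_tendsto (T := fun R =>
    (finite_zeros_closedBall hfd ⟨0, hf0⟩ R).toFinset.image Complex.im)
    (fun γ => by positivity) ?_ ?_
  · refine hlim2.congr fun R => ?_
    rw [Finset.sum_image]
    · refine Finset.sum_congr rfl fun ρ hρ => ?_
      have hρ' := hzero R ρ hρ
      set γ := ρ.im
      have hm : analyticOrderNatAt f ρ = zeroMult χ γ := by
        unfold analyticOrderNatAt zeroMult analyticOrderNatAt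
        have hg : AnalyticAt ℂ (fun z : ℂ => 2 + z) ρ := by fun_prop
        have := analyticOrderAt_comp_of_deriv_ne_zero (f := F) hg (by
          rw [deriv_const_add, deriv_id'']; exact one_ne_zero)
        have e : (2 + ρ : ℂ) = 1 / 2 + γ * I := by
          rw [hρ']; ring
        rw [e] at this
        rw [← this]
        rfl
      rw [hm]
      have hden : κ ^ 2 + (t - γ) ^ 2 ≠ 0 := by positivity
      have e1 : z₀ - 2 - ρ = κ + (t - γ) * I := by rw [hρ', hz₀]; ring
      have e2 : 1 - starRingEnd ℂ z₀ - 2 - ρ = -κ + (t - γ) * I := by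
        rw [hρ', hz₀]; simp [Complex.conj_ofReal, map_ofNat]; ring
      rw [e1, e2]
      have e3 : (1 : ℂ) / (κ + (t - γ) * I) - 1 / (-κ + (t - γ) * I) =
          ((2 * (κ / (κ ^ 2 + (t - γ) ^ 2)) : ℝ) : ℂ) := by
        have n1 : (κ + (t - γ) * I : ℂ) ≠ 0 := by
          intro h0
          have := congr_arg Complex.re h0
          simp at this; linarith
        have n2 : (-κ + (t - γ) * I : ℂ) ≠ 0 := by
          intro h0
          have := congr_arg Complex.re h0
          simp at this; linarith
        have n3 : (κ ^ 2 + (t - γ) ^ 2 : ℂ) ≠ 0 := by exact_mod_cast hden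
        push_cast
        field_simp
        ring_nf
        simp only [Complex.I_sq]
        ring
      rw [e3, ← Complex.ofReal_natCast, ← Complex.ofReal_mul, Complex.ofReal_re]
      ring
    · intro a ha b hb hab
      rw [hzero R a ha, hzero R b hb, hab]
  · intro γ hγ
    have hm : zeroMult χ γ ≠ 0 := by
      intro h0; rw [h0] at hγ; simp at hγ
    have hF0 : F (1 / 2 + γ * I) = 0 := by
      by_contra hne
      refine hm ?_
      unfold zeroMult analyticOrderNatAt
      rw [((hd.analyticAt _).analyticOrderAt_eq_zero).mpr hne]; rfl
    filter_upwards [eventually_ge_atTop ‖(-(3 / 2) + γ * I : ℂ)‖] with R hR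
    rw [Finset.mem_image]
    refine ⟨-(3 / 2) + γ * I, ?_, by simp⟩
    simp only [Set.Finite.mem_toFinset, Set.mem_ofPred_eq]
    refine ⟨?_, hR⟩
    simp only [hf]
    rw [← hF0]; congr 1; ring

lemma ne_neg_nat_of_re_pos {z : ℂ} (hz : 0 < z.re) (m : ℕ) : z ≠ -(m : ℂ) := by
  rintro rfl
  simp at hz
  linarith [(Nat.cast_nonneg m : (0 : ℝ) ≤ m)]

lemma differentiableAt_logGamma {x : ℝ} (hx : 0 < x) :
    DifferentiableAt ℝ (Real.log ∘ Real.Gamma) x :=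
  (Real.differentiableAt_Gamma fun m => (by
    have := (Nat.cast_nonneg m : (0 : ℝ) ≤ m)
    linarith : x ≠ -(m : ℝ))).log (Real.Gamma_pos_of_pos hx).ne'

lemma digamma_ofReal {x : ℝ} (hx : 0 < x) :
    digamma (x : ℂ) = (deriv (Real.log ∘ Real.Gamma) x : ℝ) := by
  have hm : ∀ m : ℕ, x ≠ -(m : ℝ) := fun m => by
    have := (Nat.cast_nonneg m : (0 : ℝ) ≤ m)
    linarith
  have h1 : HasDerivAt (fun y : ℝ => ((Real.Gamma y : ℝ) : ℂ)) ((deriv Real.Gamma x : ℝ) : ℂ) x :=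
    (Real.differentiableAt_Gamma hm).hasDerivAt.ofReal_comp
  have h2 : HasDerivAt (fun y : ℝ => Complex.Gamma (y : ℂ)) (deriv Complex.Gamma x) x :=
    (Complex.differentiableAt_Gamma (x : ℂ)
      (ne_neg_nat_of_re_pos (by simpa using hx))).hasDerivAt.comp_ofReal
  have h3 : deriv Complex.Gamma x = ((deriv Real.Gamma x : ℝ) : ℂ) := by
    refine h2.unique ?_
    simpa only [Complex.Gamma_ofReal] using h1
  rw [digamma_def, logDeriv_apply, h3, Complex.Gamma_ofReal, Function.comp_def,
    deriv.log (Real.differentiableAt_Gamma hm) (Real.Gamma_pos_of_pos hx).ne']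
  push_cast; rfl

lemma logGamma_add_one {x : ℝ} (hx : 0 < x) :
    (Real.log ∘ Real.Gamma) (x + 1) = (Real.log ∘ Real.Gamma) x + Real.log x := by
  simp only [Function.comp_apply, Real.Gamma_add_one hx.ne',
    Real.log_mul hx.ne' (Real.Gamma_pos_of_pos hx).ne', add_comm]

lemma digamma_re_le_log {x : ℝ} (hx : 0 < x) : (digamma (x : ℂ)).re ≤ Real.log x := by
  rw [digamma_ofReal hx, Complex.ofReal_re]
  refine (Real.convexOn_log_Gamma.deriv_le_slope (Set.mem_Ioi.mpr hx)
    (Set.mem_Ioi.mpr (by linarith : (0 : ℝ) < x + 1)) (by linarith)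
    (differentiableAt_logGamma hx)).trans (le_of_eq ?_)
  rw [slope_def_field, logGamma_add_one hx]
  ring

lemma log_le_digamma_re_add_one {x : ℝ} (hx : 0 < x) :
    Real.log x ≤ (digamma ((x + 1 : ℝ) : ℂ)).re := by
  have hx1 : 0 < x + 1 := by linarith
  rw [digamma_ofReal hx1, Complex.ofReal_re]
  refine (le_of_eq ?_).trans (Real.convexOn_log_Gamma.slope_le_deriv (Set.mem_Ioi.mpr hx)
    (Set.mem_Ioi.mpr hx1) (by linarith) (differentiableAt_logGamma hx1))
  rw [slope_def_field, logGamma_add_one hx]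
  ring

lemma digamma_add_nat {z : ℂ} (hz : 0 < z.re) (n : ℕ) :
    digamma (z + n) = digamma z + ∑ k ∈ Finset.range n, 1 / (z + k) := by
  induction n with
  | zero => simp
  | succ n ih =>
    rw [Finset.sum_range_succ, ← add_assoc, ← ih]
    have h := digamma_apply_add_one (z + n) (ne_neg_nat_of_re_pos (by
      simp; linarith [(Nat.cast_nonneg n : (0 : ℝ) ≤ n)]))
    push_cast
    rw [← add_assoc, h, one_div]

lemma tendsto_log_add_nat_sub_log {x : ℝ} :
    Tendsto (fun n : ℕ => Real.log (x + n) - Real.log n) atTop (nhds 0) := by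
  have h1 : Tendsto (fun n : ℕ => x / (n : ℝ) + 1) atTop (nhds (0 + 1)) :=
    (tendsto_const_div_atTop_nhds_zero_nat x).add_const 1
  rw [zero_add] at h1
  have h2 := (Real.continuousAt_log one_ne_zero).tendsto.comp h1
  rw [Real.log_one] at h2
  refine h2.congr' ?_
  filter_upwards [eventually_gt_atTop (Nat.ceil |x|), eventually_gt_atTop 0] with n hn hn0
  have hn' : |x| < n := Nat.lt_of_ceil_lt hn
  have h3 : 0 < x + n := by linarith [neg_abs_le x]
  have h4 : (0 : ℝ) < n := by exact_mod_cast hn0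
  rw [← Real.log_div h3.ne' h4.ne']
  simp only [Function.comp]
  congr 1
  field_simp

lemma tendsto_digamma_re_sub_log {x : ℝ} (hx : 0 < x) :
    Tendsto (fun n : ℕ => (digamma ((x + n : ℝ) : ℂ)).re - Real.log n) atTop (nhds 0) := by
  refine tendsto_of_tendsto_of_tendsto_of_le_of_le' (tendsto_log_add_nat_sub_log (x := x - 1))
    (tendsto_log_add_nat_sub_log (x := x)) ?_ ?_
  · filter_upwards [eventually_gt_atTop 0] with n hn
    have hn1 : (1 : ℝ) ≤ n := by exact_mod_cast hn
    have := log_le_digamma_re_add_one (x := x - 1 + n) (by linarith)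
    rw [show x - 1 + (n : ℝ) + 1 = x + n by ring] at this
    linarith
  · refine Eventually.of_forall fun n => ?_
    have := digamma_re_le_log (x := x + n) (by positivity)
    linarith

lemma norm_digammaTerm_le {z : ℂ} {δ R : ℝ} (hδ : 0 < δ) (hδ1 : δ ≤ 1) (hz : δ ≤ z.re)
    (hR : ‖z‖ ≤ R) (k : ℕ) :
    ‖1 / ((k : ℂ) + 1) - 1 / (z + k)‖ ≤ (R + 1) / δ * (1 / ((k : ℝ) + 1) ^ 2) := by
  have hk := (Nat.cast_nonneg k : (0 : ℝ) ≤ k)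
  have h1 : δ * (k + 1) ≤ ‖z + k‖ := by
    have := Complex.re_le_norm (z + k)
    simp at this
    nlinarith
  have h2 : ‖(k : ℂ) + 1‖ = k + 1 := by
    rw [← Nat.cast_one (R := ℂ), ← Nat.cast_add, Complex.norm_natCast]; push_cast; rfl
  have h0 : z + k ≠ 0 := by
    rw [← norm_pos_iff]; exact lt_of_lt_of_le (by positivity) h1
  have h0' : (k : ℂ) + 1 ≠ 0 := by
    rw [← norm_pos_iff, h2]; positivity
  have e : 1 / ((k : ℂ) + 1) - 1 / (z + k) = (z - 1) / (((k : ℂ) + 1) * (z + k)) := by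
    field_simp; ring
  rw [e, norm_div, norm_mul, h2]
  have h3 : ‖z - 1‖ ≤ R + 1 := (norm_sub_le _ _).trans (by rw [norm_one]; linarith)
  calc ‖z - 1‖ / ((k + 1) * ‖z + k‖) ≤ (R + 1) / ((k + 1) * (δ * (k + 1))) := by
        gcongr
        exact (norm_nonneg _).trans h3
    _ = _ := by field_simp

lemma summable_one_div_nat_add_one_sq : Summable fun k : ℕ => 1 / ((k : ℝ) + 1) ^ 2 := by
  have := (summable_nat_add_iff 1).mpr (Real.summable_one_div_nat_pow.mpr one_lt_two)
  simpa using this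

lemma summable_digammaTerm {z : ℂ} (hz : 0 < z.re) :
    Summable fun k : ℕ => 1 / ((k : ℂ) + 1) - 1 / (z + k) :=
  Summable.of_norm_bounded (summable_one_div_nat_add_one_sq.mul_left _)
    (norm_digammaTerm_le (lt_min hz one_pos) (min_le_right _ _) (min_le_left _ _) le_rfl)

lemma digamma_series_ofReal {x : ℝ} (hx : 0 < x) :
    ∑' k : ℕ, (1 / ((k : ℂ) + 1) - 1 / ((x : ℂ) + k)) = digamma x - digamma 1 := by
  have hxc : 0 < (x : ℂ).re := by simpa using hx
  have h1 : ∀ n : ℕ, ∑ k ∈ Finset.range n, (1 / ((k : ℂ) + 1) - 1 / ((x : ℂ) + k)) =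
      digamma x - digamma 1 + ((((digamma ((1 + n : ℝ) : ℂ)).re - Real.log n) -
        ((digamma ((x + n : ℝ) : ℂ)).re - Real.log n) : ℝ) : ℂ) := by
    intro n
    have ha := digamma_add_nat hxc n
    have hb := digamma_add_nat (z := 1) (by simp) n
    have hc : digamma ((1 + n : ℝ) : ℂ) = ((digamma ((1 + n : ℝ) : ℂ)).re : ℂ) := by
      rw [digamma_ofReal (by positivity), Complex.ofReal_re]
    have hd : digamma ((x + n : ℝ) : ℂ) = ((digamma ((x + n : ℝ) : ℂ)).re : ℂ) := by
      rw [digamma_ofReal (by positivity), Complex.ofReal_re]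
    rw [Finset.sum_sub_distrib]
    simp only [Complex.ofReal_sub]
    rw [← hc, ← hd]
    push_cast
    rw [ha, hb]
    have : ∑ k ∈ Finset.range n, 1 / ((k : ℂ) + 1) = ∑ k ∈ Finset.range n, 1 / (1 + (k : ℂ)) :=
      Finset.sum_congr rfl fun k _ => by rw [add_comm]
    rw [this]
    ring
  have h2 := (summable_digammaTerm hxc).hasSum.tendsto_sum_nat
  have h3 : Tendsto (fun n : ℕ => digamma x - digamma 1 +
      ((((digamma ((1 + n : ℝ) : ℂ)).re - Real.log n) -
        ((digamma ((x + n : ℝ) : ℂ)).re - Real.log n) : ℝ) : ℂ)) atTop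
      (nhds (digamma x - digamma 1 + ((0 - 0 : ℝ) : ℂ))) :=
    ((Complex.continuous_ofReal.tendsto _).comp
      ((tendsto_digamma_re_sub_log one_pos).sub (tendsto_digamma_re_sub_log hx))).const_add _
  have h4 := tendsto_nhds_unique h2 (h3.congr fun n => (h1 n).symm)
  rw [h4]; simp

theorem hasSum_digamma {z : ℂ} (hz : 0 < z.re) :
    HasSum (fun k : ℕ => 1 / ((k : ℂ) + 1) - 1 / (z + k)) (digamma z - digamma 1) := by
  set U : Set ℂ := {s : ℂ | 0 < s.re} with hU
  have hUo : IsOpen U := isOpen_lt continuous_const Complex.continuous_re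
  have hd1 : DifferentiableOn ℂ (fun z => digamma z - digamma 1) U := by
    intro s hs
    refine DifferentiableAt.differentiableWithinAt (DifferentiableAt.sub_const ?_ _)
    have hΓ : AnalyticAt ℂ Complex.Gamma s := by
      refine DifferentiableOn.analyticAt (s := U) (fun w hw =>
        (Complex.differentiableAt_Gamma w (ne_neg_nat_of_re_pos hw)).differentiableWithinAt)
        (hUo.mem_nhds hs)
    exact (hΓ.deriv.div hΓ (Complex.Gamma_ne_zero (ne_neg_nat_of_re_pos hs))).differentiableAt
  have hd2 : DifferentiableOn ℂ (fun z => ∑' k : ℕ, (1 / ((k : ℂ) + 1) - 1 / (z + k))) U := by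
    intro s hs
    have hs' : 0 < s.re := hs
    set V : Set ℂ := {w : ℂ | s.re / 2 < w.re} ∩ Metric.ball 0 (‖s‖ + 1) with hV
    have hVo : IsOpen V :=
      (isOpen_lt continuous_const Complex.continuous_re).inter Metric.isOpen_ball
    have hsV : s ∈ V := ⟨by simp; linarith, by simp⟩
    have hδ : 0 < min (s.re / 2) 1 := lt_min (by linarith) one_pos
    have := Complex.differentiableOn_tsum_of_summable_norm (U := V)
      (F := fun (k : ℕ) (z : ℂ) => 1 / ((k : ℂ) + 1) - 1 / (z + k))
      (summable_one_div_nat_add_one_sq.mul_left ((‖s‖ + 1 + 1) / min (s.re / 2) 1)) ?_ hVo ?_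
    · exact (this.differentiableAt (hVo.mem_nhds hsV)).differentiableWithinAt
    · intro k w hw
      refine (DifferentiableAt.differentiableWithinAt ?_)
      have : w + k ≠ 0 := by
        have hw1 : s.re / 2 < w.re := hw.1
        intro h0
        have := congr_arg Complex.re h0
        simp at this
        linarith [(Nat.cast_nonneg k : (0 : ℝ) ≤ k)]
      fun_prop (disch := assumption)
    · intro k w hw
      have hw1 : s.re / 2 < w.re := hw.1
      have hw2 : ‖w‖ < ‖s‖ + 1 := by simpa using hw.2
      exact norm_digammaTerm_le hδ (min_le_right _ _) ((min_le_left _ _).trans hw1.le) hw2.le k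
  have heq := (hd2.analyticOnNhd hUo).eqOn_of_preconnected_of_frequently_eq
    (hd1.analyticOnNhd hUo) (isPreconnected_re_gt 0) (z₀ := 1) (by simp [hU]) (by
      have ht : Tendsto (fun n : ℕ => ((1 + 1 / ((n : ℝ) + 1) : ℝ) : ℂ)) atTop
          (nhdsWithin 1 {1}ᶜ) := by
        refine tendsto_nhdsWithin_iff.mpr ⟨?_, Eventually.of_forall fun n => ?_⟩
        · have := (tendsto_one_div_add_atTop_nhds_zero_nat (𝕜 := ℝ)).const_add 1
          rw [add_zero] at this
          have h2 := (Complex.continuous_ofReal.tendsto _).comp this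
          simpa [Function.comp_def] using h2
        · have : (0 : ℝ) < 1 / ((n : ℝ) + 1) := by positivity
          rw [Set.mem_compl_singleton_iff, ← Complex.ofReal_one, Ne, Complex.ofReal_inj]
          linarith
      refine ht.frequently (Frequently.of_forall fun n => ?_)
      exact digamma_series_ofReal (by positivity))
  have := (summable_digammaTerm hz).hasSum
  have h := heq hz
  simp only at h
  rwa [h] at this

/-- The real part of the digamma function off the real axis as a sum of Poisson kernels. -/
theorem hasSum_digamma_re_sub {x : ℝ} (hx : 0 < x) (y : ℝ) :
    HasSum (fun k : ℕ => 1 / (k + x) - (k + x) / ((k + x) ^ 2 + y ^ 2))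
      ((digamma (x + y * I)).re - (digamma (x : ℂ)).re) := by
  have h1 := hasSum_digamma (z := x) (by simpa using hx)
  have h2 := hasSum_digamma (z := x + y * I) (by simpa using hx)
  have h3 := Complex.hasSum_re (h2.sub h1)
  convert h3 using 1
  · funext k
    have hk : 0 < (k : ℝ) + x := by positivity
    simp only [Complex.sub_re, one_div]
    have e1 : ((x : ℂ) + k)⁻¹.re = 1 / (k + x) := by
      rw [← Complex.ofReal_natCast, ← Complex.ofReal_add, ← Complex.ofReal_inv, Complex.ofReal_re,
        one_div, add_comm]
    have e2 : ((x : ℂ) + y * I + k)⁻¹.re = (k + x) / ((k + x) ^ 2 + y ^ 2) := by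
      rw [Complex.inv_re, Complex.normSq_apply]
      simp
      ring
    rw [e1, e2]
    ring
  · simp

lemma summable_vonMangoldt_div_rpow :
    Summable fun n : ℕ => ArithmeticFunction.vonMangoldt n / (n : ℝ) ^ (3 / 2 : ℝ) := by
  have h := (ArithmeticFunction.LSeriesSummable_vonMangoldt (s := (3 / 2 : ℝ))
    (by simp; norm_num)).norm
  refine h.congr fun n => ?_
  rw [LSeries.norm_term_eq]
  split_ifs with h0
  · simp [h0]
  · rw [Complex.norm_of_nonneg ArithmeticFunction.vonMangoldt_nonneg, Complex.ofReal_re]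

lemma logDeriv_LFunction_eq {N : ℕ} [NeZero N] (χ : DirichletCharacter ℂ N) {s : ℂ}
    (hs : 1 < s.re) : logDeriv χ.LFunction s =
      -LSeries ((fun n : ℕ => χ n) * fun n => (ArithmeticFunction.vonMangoldt n : ℂ)) s := by
  rw [DirichletCharacter.LSeries_twist_vonMangoldt_eq χ hs, logDeriv_apply,
    DirichletCharacter.LFunction_eq_LSeries χ hs,
    DirichletCharacter.deriv_LFunction_eq_deriv_LSeries χ hs, neg_div, neg_neg]

lemma norm_logDeriv_LFunction_le {N : ℕ} [NeZero N] (χ : DirichletCharacter ℂ N) {s : ℂ}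
    (hs : 3 / 2 ≤ s.re) : ‖logDeriv χ.LFunction s‖ ≤
      ∑' n : ℕ, ArithmeticFunction.vonMangoldt n / (n : ℝ) ^ (3 / 2 : ℝ) := by
  rw [logDeriv_LFunction_eq χ (by linarith), norm_neg]
  refine tsum_of_norm_bounded summable_vonMangoldt_div_rpow.hasSum fun n => ?_
  rw [LSeries.norm_term_eq]
  split_ifs with h0
  · simp [h0]
  · have h1 : (1 : ℝ) ≤ n := by exact_mod_cast Nat.one_le_iff_ne_zero.mpr h0
    simp only [Pi.mul_apply, norm_mul]
    rw [Complex.norm_of_nonneg ArithmeticFunction.vonMangoldt_nonneg]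
    refine div_le_div₀ ArithmeticFunction.vonMangoldt_nonneg ?_ (by positivity)
      (Real.rpow_le_rpow_of_exponent_le h1 hs)
    calc ‖χ n‖ * ArithmeticFunction.vonMangoldt n ≤ 1 * ArithmeticFunction.vonMangoldt n :=
          mul_le_mul_of_nonneg_right (χ.norm_le_one _) ArithmeticFunction.vonMangoldt_nonneg
      _ = _ := one_mul _

lemma logDeriv_Gammaℝ {s : ℂ} (hs : 0 < s.re) :
    logDeriv Complex.Gammaℝ s = -(Real.log Real.pi / 2 : ℝ) + digamma (s / 2) / 2 := by
  have hs2 : 0 < (s / 2).re := by simpa using hs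
  have hπ : (Real.pi : ℂ) ≠ 0 := by exact_mod_cast Real.pi_ne_zero
  have hΓ : DifferentiableAt ℂ Complex.Gamma (s / 2) :=
    Complex.differentiableAt_Gamma _ (ne_neg_nat_of_re_pos hs2)
  have h2 : DifferentiableAt ℂ (fun z : ℂ => z / 2) s := by fun_prop
  have h3 : HasDerivAt (fun z : ℂ => (Real.pi : ℂ) ^ (-z / 2))
      ((Real.pi : ℂ) ^ (-s / 2) * Complex.log Real.pi * (-1 / 2)) s :=
    (((hasDerivAt_id s).neg).div_const 2).const_cpow (Or.inl hπ)
  have h4 : (Real.pi : ℂ) ^ (-s / 2) ≠ 0 := by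
    rw [Ne, Complex.cpow_eq_zero_iff]; tauto
  have h5 : logDeriv (fun z : ℂ => Complex.Gamma (z / 2)) s = digamma (s / 2) / 2 := by
    have := logDeriv_comp (x := s) (f := Complex.Gamma) (g := fun z : ℂ => z / 2) hΓ h2
    rw [Function.comp_def] at this
    rw [this, digamma_def, deriv_div_const, deriv_id'']
    ring
  have h6 : Complex.Gammaℝ = fun z => (Real.pi : ℂ) ^ (-z / 2) * Complex.Gamma (z / 2) := by
    funext z; rw [Complex.Gammaℝ_def]
  rw [h6, logDeriv_mul (f := fun z => (Real.pi : ℂ) ^ (-z / 2))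
    (g := fun z => Complex.Gamma (z / 2)) s h4 (Complex.Gamma_ne_zero (ne_neg_nat_of_re_pos hs2))
    h3.differentiableAt (hΓ.comp s h2), h5, logDeriv_apply, h3.deriv, ← Complex.ofReal_log
    Real.pi_pos.le]
  congr 1
  field_simp
  push_cast
  ring

lemma logDeriv_completedLFunction_eq {N : ℕ} [NeZero N] {χ : DirichletCharacter ℂ N}
    (hχ : χ ≠ 1) {s : ℂ} (hs : 1 < s.re) : logDeriv χ.completedLFunction s =
      -(Real.log Real.pi / 2 : ℝ) + digamma ((s + parity χ) / 2) / 2 + logDeriv χ.LFunction s := by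
  have hs0 : 0 < s.re := by linarith
  have hsp : 0 < (s + parity χ).re := by simp; linarith [parity_nonneg χ]
  have he : χ.completedLFunction =ᶠ[nhds s] fun z => χ.gammaFactor z * χ.LFunction z := by
    filter_upwards [(isOpen_lt continuous_const Complex.continuous_re).mem_nhds
      (show (0 : ℝ) < s.re from hs0)] with z hz
    exact completedLFunction_eq_mul χ hz
  have hd : DifferentiableAt ℂ Complex.Gammaℝ (s + parity χ) := by
    have hi := (Complex.differentiable_Gammaℝ_inv (s + parity χ)).inv
      (inv_ne_zero (Complex.Gammaℝ_ne_zero_of_re_pos hsp))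
    have e : (fun z => (Complex.Gammaℝ z)⁻¹)⁻¹ = Complex.Gammaℝ := by funext z; simp
    rwa [e] at hi
  have hg : χ.gammaFactor = Complex.Gammaℝ ∘ fun z => z + parity χ := by
    funext z; rw [gammaFactor_eq_Gammaℝ]; rfl
  have hadd : DifferentiableAt ℂ (fun z : ℂ => z + parity χ) s := by fun_prop
  have h1 : logDeriv χ.completedLFunction s =
      logDeriv (fun z => χ.gammaFactor z * χ.LFunction z) s := by
    rw [logDeriv_apply, logDeriv_apply, he.deriv_eq, he.eq_of_nhds]
  rw [h1, logDeriv_mul _ (gammaFactor_ne_zero χ hs0)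
    (DirichletCharacter.LFunction_ne_zero_of_one_le_re χ (Or.inl hχ) hs.le) (by
      rw [hg]; exact hd.comp s hadd)
    ((DirichletCharacter.differentiable_LFunction hχ) s)]
  congr 1
  rw [hg, logDeriv_comp (g := fun z : ℂ => z + parity χ) hd hadd, logDeriv_Gammaℝ hsp, deriv_add_const, deriv_id'', mul_one]

/-- Under GRH, the Poisson mass of the zeros of a primitive L-function at height `T` is
`log (N * T) / 2` up to an absolute constant. -/
theorem GRH.exists_hasSum_zeroMult_approx (h : GRH) : ∃ C : ℝ, 0 < C ∧
    ∀ (N : ℕ) [NeZero N] (χ : DirichletCharacter ℂ N), χ ≠ 1 → χ.IsPrimitive → ∀ T : ℝ, 1 ≤ T →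
      ∃ W : ℝ, HasSum (fun γ : ℝ => (zeroMult χ γ : ℝ) * (T / (T ^ 2 + γ ^ 2))) W ∧
        |W - Real.log (N * T) / 2| ≤ C := by
  set K : ℝ := ∑' n : ℕ, ArithmeticFunction.vonMangoldt n / (n : ℝ) ^ (3 / 2 : ℝ) with hK
  have hK0 : 0 ≤ K := tsum_nonneg fun n => by
    have := ArithmeticFunction.vonMangoldt_nonneg (n := n)
    positivity
  refine ⟨K + 3, by linarith, fun N _ χ hχ hp T hT => ?_⟩
  have hT0 : 0 < T := by linarith
  have hs := h.hasSum_zeroMult hχ hp hT0 0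
  simp only [zero_sub, neg_sq, Complex.ofReal_zero, zero_mul, add_zero] at hs
  refine ⟨_, hs, ?_⟩
  have hN : (0 : ℝ) < N := by exact_mod_cast Nat.pos_of_ne_zero (NeZero.ne N)
  set x : ℝ := (1 / 2 + T + parity χ) / 2 with hx
  have ha0 := parity_nonneg χ
  have ha1 := parity_le_one χ
  have hx0 : 3 / 4 ≤ x := by rw [hx]; linarith
  have e1 : (1 / 2 + (T : ℂ)) = ((1 / 2 + T : ℝ) : ℂ) := by push_cast; ring
  have e2 : (1 / 2 + (T : ℂ) + parity χ) / 2 = (x : ℂ) := by rw [hx]; push_cast; ring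
  have e3 : logDeriv χ.completedLFunction (1 / 2 + T) =
      -(Real.log Real.pi / 2 : ℝ) + digamma x / 2 + logDeriv χ.LFunction (1 / 2 + T) := by
    rw [logDeriv_completedLFunction_eq hχ (by rw [e1, Complex.ofReal_re]; linarith), e2]
  have hL : |(logDeriv χ.LFunction (1 / 2 + T)).re| ≤ K :=
    (Complex.abs_re_le_norm _).trans (norm_logDeriv_LFunction_le χ (by
      rw [e1, Complex.ofReal_re]; linarith))
  have hup : (digamma (x : ℂ)).re ≤ Real.log T + 1 := by
    refine (digamma_re_le_log (by linarith)).trans ?_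
    calc Real.log x ≤ Real.log (T * 2) := Real.log_le_log (by linarith) (by rw [hx]; linarith)
      _ = Real.log T + Real.log 2 := Real.log_mul hT0.ne' two_ne_zero
      _ ≤ Real.log T + 1 := by linarith [Real.log_two_lt_d9]
  have hlo : Real.log T - 3 ≤ (digamma (x : ℂ)).re := by
    have h1 := log_le_digamma_re_add_one (x := x) (by linarith)
    have h2 := digamma_add_nat (z := x) (by simp; linarith) 1
    have h3 : (digamma ((x + 1 : ℝ) : ℂ)).re = (digamma (x : ℂ)).re + 1 / x := by
      push_cast at h2 ⊢
      rw [h2]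
      simp [← Complex.ofReal_inv]
    have h4 : 1 / x ≤ 4 / 3 := by
      rw [div_le_div_iff₀ (by linarith) (by norm_num)]; linarith
    have h5 : Real.log T - Real.log 2 ≤ Real.log x := by
      rw [← Real.log_div hT0.ne' two_ne_zero]
      exact Real.log_le_log (by positivity) (by rw [hx]; linarith)
    linarith [Real.log_two_lt_d9]
  have hπ0 : 0 ≤ Real.log Real.pi := Real.log_nonneg (by linarith [Real.pi_gt_three])
  have hπ1 : Real.log Real.pi ≤ 2 := by
    rw [Real.log_le_iff_le_exp Real.pi_pos]
    have := Real.add_one_le_exp (1 : ℝ)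
    have h2 : Real.exp 2 = Real.exp 1 * Real.exp 1 := by rw [← Real.exp_add]; norm_num
    nlinarith [Real.pi_lt_four]
  have e4 : (logDeriv χ.completedLFunction (1 / 2 + (T : ℂ))).re =
      -(Real.log Real.pi / 2) + (digamma (x : ℂ)).re / 2
        + (logDeriv χ.LFunction (1 / 2 + T)).re := by
    rw [e3]
    simp only [Complex.add_re, Complex.neg_re, Complex.ofReal_re]
    congr 2
    simp
  rw [e4, Real.log_mul hN.ne' hT0.ne', abs_le]
  rw [abs_le] at hL
  constructor <;> linarith [hL.1, hL.2]

/-- The tent function supported on `[-h, h]`. -/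
noncomputable def tent (h v : ℝ) : ℝ := max 0 (1 - |v| / h)

lemma tent_nonneg (h v : ℝ) : 0 ≤ tent h v := le_max_left _ _

lemma tent_le_one {h : ℝ} (hh : 0 < h) (v : ℝ) : tent h v ≤ 1 := by
  unfold tent
  exact max_le zero_le_one (by have : 0 ≤ |v| / h := by positivity
                               linarith)

lemma tent_eq_zero {h v : ℝ} (hh : 0 < h) (hv : h ≤ |v|) : tent h v = 0 := by
  unfold tent
  refine max_eq_left ?_
  have : 1 ≤ |v| / h := (one_le_div hh).mpr hv
  linarith

lemma tent_eq {h v : ℝ} (hh : 0 < h) (hv : |v| ≤ h) : tent h v = 1 - |v| / h := by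
  unfold tent
  refine max_eq_right ?_
  have : |v| / h ≤ 1 := (div_le_one hh).mpr hv
  linarith

lemma continuous_tent (h : ℝ) : Continuous (tent h) := by
  unfold tent; fun_prop

lemma hasCompactSupport_tent {h : ℝ} (hh : 0 < h) : HasCompactSupport (tent h) := by
  refine HasCompactSupport.of_support_subset_isCompact (isCompact_Icc (a := -h) (b := h)) ?_
  intro v hv
  rw [Function.mem_support] at hv
  have : |v| < h := not_le.mp fun h' => hv (tent_eq_zero hh h')
  exact ⟨(abs_lt.mp this).1.le, (abs_lt.mp this).2.le⟩

lemma integrable_tent_mul {h : ℝ} (hh : 0 < h) {f : ℝ → ℂ} (hf : Continuous f) :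
    MeasureTheory.Integrable fun v => (tent h v : ℂ) * f v := by
  refine Continuous.integrable_of_hasCompactSupport
    ((Complex.continuous_ofReal.comp (continuous_tent h)).mul hf) ?_
  exact ((hasCompactSupport_tent hh).comp_left (g := ((↑) : ℝ → ℂ)) rfl).mul_right

/-- The two-sided Laplace transform of the tent function. -/
noncomputable def tentTransform (h : ℝ) (z : ℂ) : ℂ :=
  ∫ v : ℝ, (tent h v : ℂ) * Complex.exp (-(z * v))

lemma integral_tent_mul_eq {h : ℝ} (hh : 0 < h) {f : ℝ → ℂ} (hf : Continuous f) :
    ∫ v : ℝ, (tent h v : ℂ) * f v =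
      (∫ v in (-h)..0, ((1 + v / h : ℝ) : ℂ) * f v) + ∫ v in (0 : ℝ)..h, ((1 - v / h : ℝ) : ℂ) * f v := by
  have h1 : ∫ v : ℝ, (tent h v : ℂ) * f v = ∫ v in (-h)..h, (tent h v : ℂ) * f v := by
    rw [intervalIntegral.integral_of_le (by linarith),
      ← MeasureTheory.setIntegral_eq_integral_of_forall_compl_eq_zero (s := Set.Ioc (-h) h)]
    intro v hv
    rw [tent_eq_zero hh]
    · simp
    · by_contra hlt
      rw [not_le, abs_lt] at hlt
      exact hv ⟨hlt.1, hlt.2.le⟩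
  have hi := integrable_tent_mul hh hf
  rw [h1, ← intervalIntegral.integral_add_adjacent_intervals (b := 0)
    hi.intervalIntegrable hi.intervalIntegrable]
  congr 1
  · refine intervalIntegral.integral_congr fun v hv => ?_
    rw [Set.uIcc_of_le (by linarith)] at hv
    rw [tent_eq hh (by rw [abs_of_nonpos hv.2]; linarith [hv.1]), abs_of_nonpos hv.2]
    congr 2
    ring
  · refine intervalIntegral.integral_congr fun v hv => ?_
    rw [Set.uIcc_of_le hh.le] at hv
    rw [tent_eq hh (by rw [abs_of_nonneg hv.1]; linarith [hv.2]), abs_of_nonneg hv.1]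

lemma tentTransform_eq {h : ℝ} (hh : 0 < h) {z : ℂ} (hz : z ≠ 0) :
    tentTransform h z = (Complex.exp (z * h) + Complex.exp (-(z * h)) - 2) / (h * z ^ 2) := by
  have hh' : (h : ℂ) ≠ 0 := by exact_mod_cast hh.ne'
  have hc : Continuous fun v : ℝ => Complex.exp (-(z * v)) := by fun_prop
  have key : ∀ c : ℂ, ∀ a b : ℝ, ∫ v in a..b, (1 + c * v) * Complex.exp (-(z * v)) =
      (-(1 + c * b) / z - c / z ^ 2) * Complex.exp (-(z * b)) -
        (-(1 + c * a) / z - c / z ^ 2) * Complex.exp (-(z * a)) := by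
    intro c a b
    refine intervalIntegral.integral_eq_sub_of_hasDerivAt
      (f := fun v : ℝ => (-(1 + c * v) / z - c / z ^ 2) * Complex.exp (-(z * v))) ?_
      (Continuous.intervalIntegrable (by fun_prop) _ _)
    intro v _
    have hv : HasDerivAt (fun w : ℂ => (-(1 + c * w) / z - c / z ^ 2) * Complex.exp (-(z * w)))
        ((-(c * 1) / z) * Complex.exp (-(z * v)) +
          (-(1 + c * v) / z - c / z ^ 2) * (Complex.exp (-(z * v)) * (-(z * 1)))) (v : ℂ) := by
      refine HasDerivAt.mul ?_ ?_
      · exact ((((hasDerivAt_id (v : ℂ)).const_mul c).const_add 1).neg.div_const z).sub_const _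
      · exact ((hasDerivAt_id (v : ℂ)).const_mul z).neg.cexp
    refine hv.comp_ofReal.congr_deriv ?_
    field_simp
    ring
  rw [tentTransform, integral_tent_mul_eq hh hc]
  have e1 := key (1 / h) (-h) 0
  have e2 := key (-1 / h) 0 h
  have e1' : (∫ v in (-h)..0, ((1 + v / h : ℝ) : ℂ) * Complex.exp (-(z * v))) =
      ∫ v in (-h)..0, (1 + 1 / h * v) * Complex.exp (-(z * v)) :=
    intervalIntegral.integral_congr fun v _ => by push_cast; ring
  have e2' : (∫ v in (0 : ℝ)..h, ((1 - v / h : ℝ) : ℂ) * Complex.exp (-(z * v))) =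
      ∫ v in (0 : ℝ)..h, (1 + -1 / h * v) * Complex.exp (-(z * v)) :=
    intervalIntegral.integral_congr fun v _ => by push_cast; ring
  rw [e1', e2', e1, e2]
  simp only [Complex.ofReal_zero, mul_zero, neg_zero, Complex.exp_zero, Complex.ofReal_neg, mul_neg,
    neg_neg]
  field_simp
  ring

lemma norm_tentTransform_le {h : ℝ} (hh : 0 < h) (t : ℝ) :
    ‖tentTransform h (1 + t * I)‖ ≤ (2 * Real.exp h + 2) / h * (1 + t ^ 2)⁻¹ := by
  have hz : (1 + t * I : ℂ) ≠ 0 := fun h0 => by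
    have := congr_arg Complex.re h0; simp at this
  have hn : ‖(1 + t * I : ℂ)‖ ^ 2 = 1 + t ^ 2 := by
    rw [← Complex.normSq_eq_norm_sq, Complex.normSq_apply]; simp; ring
  have hre : ∀ s : ℝ, ‖Complex.exp ((1 + t * I) * s)‖ = Real.exp s := fun s => by
    rw [Complex.norm_exp]; simp
  have h1 : ‖Complex.exp ((1 + t * I) * h) + Complex.exp (-((1 + t * I) * h)) - 2‖ ≤
      2 * Real.exp h + 2 := by
    refine (norm_sub_le _ _).trans ?_
    rw [Complex.norm_ofNat]
    refine add_le_add ((norm_add_le _ _).trans ?_) le_rfl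
    have e : -((1 + t * I) * h : ℂ) = (1 + t * I) * ((-h : ℝ) : ℂ) := by push_cast; ring
    rw [e, hre, hre]
    have := Real.exp_le_exp.mpr (by linarith : -h ≤ h)
    linarith
  rw [tentTransform_eq hh hz, norm_div, norm_mul, norm_pow, hn, Complex.norm_of_nonneg hh.le]
  calc _ ≤ (2 * Real.exp h + 2) / (h * (1 + t ^ 2)) := by gcongr
    _ = _ := by field_simp

lemma continuous_tentTransform {h : ℝ} (hh : 0 < h) :
    Continuous fun t : ℝ => tentTransform h (1 + t * I) := by
  have e : (fun t : ℝ => tentTransform h (1 + t * I)) = fun t : ℝ =>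
      (Complex.exp ((1 + t * I) * h) + Complex.exp (-((1 + t * I) * h)) - 2)
        / (h * (1 + t * I) ^ 2) := by
    funext t
    exact tentTransform_eq hh fun h0 => by
      have := congr_arg Complex.re h0; simp at this
  rw [e]
  refine Continuous.div (by fun_prop) (by fun_prop) fun t => ?_
  have hh' : (h : ℂ) ≠ 0 := by exact_mod_cast hh.ne'
  have : (1 + t * I : ℂ) ≠ 0 := fun h0 => by
    have := congr_arg Complex.re h0; simp at this
  positivity

lemma integrable_tentTransform {h : ℝ} (hh : 0 < h) :
    MeasureTheory.Integrable fun t : ℝ => tentTransform h (1 + t * I) :=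
  (integrable_inv_one_add_sq.const_mul _).mono' (continuous_tentTransform hh).aestronglyMeasurable
    (Eventually.of_forall (norm_tentTransform_le hh))

/-- Fourier inversion for the tent function. -/
lemma integral_tentTransform_mul_exp {h : ℝ} (hh : 0 < h) (x : ℝ) :
    ∫ t : ℝ, tentTransform h (1 + t * I) * Complex.exp (t * x * I) =
      2 * Real.pi * (tent h x * Real.exp (-x) : ℝ) := by
  set G : ℝ → ℂ := fun v => (tent h v : ℂ) * Complex.exp (-v) with hG
  have hGi : MeasureTheory.Integrable G := integrable_tent_mul hh (by fun_prop)
  have hGc : Continuous G :=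
    (Complex.continuous_ofReal.comp (continuous_tent h)).mul (by fun_prop)
  have hF : ∀ w : ℝ, FourierTransform.fourier G w =
      tentTransform h (1 + ((2 * Real.pi) * w : ℝ) * I) := by
    intro w
    rw [Real.fourier_eq', tentTransform]
    congr 1
    funext v
    simp only [hG, smul_eq_mul, RCLike.inner_apply, conj_trivial]
    rw [mul_left_comm, ← Complex.exp_add]
    congr 2
    push_cast
    ring
  have hFi : MeasureTheory.Integrable (FourierTransform.fourier G) := by
    have e : FourierTransform.fourier G =
        fun w => tentTransform h (1 + ((2 * Real.pi) * w : ℝ) * I) := funext hF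
    rw [e]
    exact (integrable_tentTransform hh).comp_mul_left' (R := 2 * Real.pi) (by positivity)
  have hinv := hGi.fourierInv_fourier_eq hFi hGc.continuousAt (v := x)
  rw [Real.fourierInv_eq'] at hinv
  have h1 := MeasureTheory.Measure.integral_comp_mul_left
    (fun t : ℝ => tentTransform h (1 + t * I) * Complex.exp (t * x * I)) (2 * Real.pi)
  have h2 : (∫ w : ℝ, tentTransform h (1 + ((2 * Real.pi * w : ℝ) : ℂ) * I) *
      Complex.exp (((2 * Real.pi * w : ℝ) : ℂ) * x * I)) = G x := by
    rw [← hinv]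
    congr 1
    funext w
    rw [hF, smul_eq_mul, mul_comm]
    simp only [RCLike.inner_apply, conj_trivial]
    congr 2
    push_cast
    ring
  rw [h2, abs_of_pos (by positivity), Complex.real_smul] at h1
  have hπ : (Real.pi : ℂ) ≠ 0 := by exact_mod_cast Real.pi_ne_zero
  rw [hG] at h1
  generalize (∫ t : ℝ, tentTransform h (1 + t * I) * Complex.exp (t * x * I)) = J at h1 ⊢
  push_cast at h1 ⊢
  field_simp at h1
  linear_combination -h1

lemma integrable_exp_neg_mul_abs_mul_exp {b : ℝ} (hb : 0 < b) (s : ℝ) :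
    MeasureTheory.Integrable fun y : ℝ =>
      Complex.exp (-(b * |y| : ℝ)) * Complex.exp (s * y * I) := by
  rw [← MeasureTheory.integrableOn_univ, ← Set.Iic_union_Ioi (a := (0 : ℝ))]
  refine MeasureTheory.IntegrableOn.union ?_ ?_
  · refine (integrableOn_exp_mul_complex_Iic (a := b + s * I) (by simpa using hb) 0).congr_fun
      (fun y hy => ?_) measurableSet_Iic
    simp only [abs_of_nonpos (Set.mem_Iic.mp hy), ← Complex.exp_add]
    congr 1
    push_cast
    ring
  · refine (integrableOn_exp_mul_complex_Ioi (a := -b + s * I) (by simpa using hb) 0).congr_fun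
      (fun y hy => ?_) measurableSet_Ioi
    simp only [abs_of_pos (Set.mem_Ioi.mp hy), ← Complex.exp_add]
    congr 1
    push_cast
    ring

/-- The Poisson kernel as a Fourier transform. -/
lemma integral_exp_neg_mul_abs_mul_exp {b : ℝ} (hb : 0 < b) (s : ℝ) :
    ∫ y : ℝ, Complex.exp (-(b * |y| : ℝ)) * Complex.exp (s * y * I) =
      2 * (b / (b ^ 2 + s ^ 2) : ℝ) := by
  have hi := integrable_exp_neg_mul_abs_mul_exp hb s
  have h1 : ∫ y in Set.Iic 0, Complex.exp (-(b * |y| : ℝ)) * Complex.exp (s * y * I) =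
      1 / (b + s * I) := by
    rw [MeasureTheory.setIntegral_congr_fun (g := fun y : ℝ => Complex.exp ((b + s * I) * y))
      measurableSet_Iic, integral_exp_mul_complex_Iic (by simpa using hb)]
    · simp
    · intro y hy
      simp only [abs_of_nonpos (Set.mem_Iic.mp hy), ← Complex.exp_add]
      congr 1
      push_cast
      ring
  have h2 : ∫ y in Set.Ioi 0, Complex.exp (-(b * |y| : ℝ)) * Complex.exp (s * y * I) =
      -1 / (-b + s * I) := by
    rw [MeasureTheory.setIntegral_congr_fun (g := fun y : ℝ => Complex.exp ((-b + s * I) * y))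
      measurableSet_Ioi, integral_exp_mul_complex_Ioi (by simpa using hb)]
    · simp
    · intro y hy
      simp only [abs_of_pos (Set.mem_Ioi.mp hy), ← Complex.exp_add]
      congr 1
      push_cast
      ring
  rw [← intervalIntegral.integral_Iic_add_Ioi hi.integrableOn hi.integrableOn, h1, h2]
  have n1 : (b + s * I : ℂ) ≠ 0 := fun h0 => by
    have := congr_arg Complex.re h0
    simp at this; linarith
  have n2 : (-b + s * I : ℂ) ≠ 0 := fun h0 => by
    have := congr_arg Complex.re h0
    simp at this; linarith
  have n3 : (b ^ 2 + s ^ 2 : ℂ) ≠ 0 := by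
    have : b ^ 2 + s ^ 2 ≠ 0 := by positivity
    exact_mod_cast this
  push_cast
  field_simp
  ring_nf
  simp only [Complex.I_sq]
  ring

/-- The pairing of the tent transform with a Poisson kernel. -/
theorem integral_tentTransform_mul_poisson {h b u : ℝ} (hh : 0 < h) (hb : 0 < b) (hu : h ≤ u)
    (γ : ℝ) :
    ∫ t : ℝ, tentTransform h (1 + t * I) * Complex.exp (t * u * I) *
      (b / (b ^ 2 + (t - γ) ^ 2) : ℝ) =
      Real.pi * Complex.exp (-((b - γ * I) * u)) * tentTransform h (1 - b + γ * I) := by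
  have hK := integrable_tentTransform hh
  set A : ℝ → ℂ := fun t => tentTransform h (1 + t * I) * Complex.exp (t * u * I) with hA
  set B : ℝ → ℂ := fun y => Complex.exp (-(b * |y| : ℝ)) * Complex.exp ((-γ : ℝ) * y * I) with hB
  have hAi : MeasureTheory.Integrable A := by
    refine hK.mono ((continuous_tentTransform hh).mul (by fun_prop)).aestronglyMeasurable
      (Eventually.of_forall fun t => ?_)
    rw [hA, norm_mul, ← Complex.ofReal_mul, Complex.norm_exp_ofReal_mul_I, mul_one]
  have hBi : MeasureTheory.Integrable B := integrable_exp_neg_mul_abs_mul_exp hb (-γ)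
  have hAB : MeasureTheory.Integrable (Function.uncurry fun t y : ℝ =>
      A t * B y * Complex.exp (t * y * I)) (MeasureTheory.volume.prod MeasureTheory.volume) := by
    have h0 := hAi.mul_prod hBi
    refine h0.mono (h0.aestronglyMeasurable.mul
      (Continuous.aestronglyMeasurable (by fun_prop))) (Eventually.of_forall fun p => ?_)
    simp only [Function.uncurry]
    rw [norm_mul, ← Complex.ofReal_mul, Complex.norm_exp_ofReal_mul_I, mul_one]
  have hswap := MeasureTheory.integral_integral_swap hAB
  have hL : ∀ t : ℝ, ∫ y : ℝ, A t * B y * Complex.exp (t * y * I) =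
      2 * (A t * (b / (b ^ 2 + (t - γ) ^ 2) : ℝ)) := by
    intro t
    have h1 := integral_exp_neg_mul_abs_mul_exp hb (t - γ)
    have h2 : ∀ y : ℝ, A t * B y * Complex.exp (t * y * I) =
        A t * (Complex.exp (-(b * |y| : ℝ)) * Complex.exp ((t - γ : ℝ) * y * I)) := by
      intro y
      have : Complex.exp ((t - γ : ℝ) * y * I) =
          Complex.exp ((-γ : ℝ) * y * I) * Complex.exp (t * y * I) := by
        rw [← Complex.exp_add]; congr 1; push_cast; ring
      rw [this]
      simp only [hB]
      ring
    simp_rw [h2]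
    rw [MeasureTheory.integral_const_mul, h1]
    ring
  have hR : ∀ y : ℝ, ∫ t : ℝ, A t * B y * Complex.exp (t * y * I) =
      2 * Real.pi * ((tent h (u + y) : ℂ) * Complex.exp (-(u + y)) * B y) := by
    intro y
    have h1 := integral_tentTransform_mul_exp hh (u + y)
    have h2 : ∀ t : ℝ, A t * B y * Complex.exp (t * y * I) =
        B y * (tentTransform h (1 + t * I) * Complex.exp (t * (u + y : ℝ) * I)) := by
      intro t
      have : Complex.exp (t * (u + y : ℝ) * I) =
          Complex.exp (t * u * I) * Complex.exp (t * y * I) := by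
        rw [← Complex.exp_add]; congr 1; push_cast; ring
      rw [hA, this]
      ring
    simp_rw [h2]
    rw [MeasureTheory.integral_const_mul, h1]
    push_cast
    ring
  simp_rw [hL, hR] at hswap
  rw [MeasureTheory.integral_const_mul, MeasureTheory.integral_const_mul] at hswap
  have hshift : ∫ y : ℝ, (tent h (u + y) : ℂ) * Complex.exp (-(u + y)) * B y =
      Complex.exp (-((b - γ * I) * u)) * tentTransform h (1 - b + γ * I) := by
    rw [← MeasureTheory.integral_add_left_eq_self (fun y : ℝ => _) (-u), tentTransform,
      ← MeasureTheory.integral_const_mul]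
    congr 1
    funext v
    simp only [add_neg_cancel_left]
    by_cases hv : h ≤ |v|
    · rw [tent_eq_zero hh hv]; simp
    · have hv' := abs_lt.mp (not_le.mp hv)
      have : |(-u + v)| = u - v := by
        rw [abs_of_nonpos (by linarith [hv'.2])]; ring
      rw [hB]
      simp only [this]
      rw [← Complex.exp_add, mul_assoc, ← Complex.exp_add, mul_left_comm, ← Complex.exp_add]
      congr 2
      push_cast
      ring
  rw [hshift] at hswap
  have h2 : (2 : ℂ) ≠ 0 := two_ne_zero
  apply mul_left_cancel₀ h2
  rw [hswap]
  ring

lemma norm_tentTransform_le_exp {h : ℝ} (hh : 0 < h) (z : ℂ) :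
    ‖tentTransform h z‖ ≤ 2 * h * Real.exp (|z.re| * h) := by
  have h1 : tentTransform h z = ∫ v in (-h)..h, (tent h v : ℂ) * Complex.exp (-(z * v)) := by
    rw [tentTransform, intervalIntegral.integral_of_le (by linarith),
      ← MeasureTheory.setIntegral_eq_integral_of_forall_compl_eq_zero (s := Set.Ioc (-h) h)]
    intro v hv
    rw [tent_eq_zero hh]
    · simp
    · by_contra hlt
      rw [not_le, abs_lt] at hlt
      exact hv ⟨hlt.1, hlt.2.le⟩
  rw [h1]
  refine (intervalIntegral.norm_integral_le_of_norm_le_const (C := Real.exp (|z.re| * h))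
    fun v hv => ?_).trans (le_of_eq ?_)
  · rw [Set.uIoc_of_le (by linarith)] at hv
    rw [norm_mul, Complex.norm_of_nonneg (tent_nonneg h v), Complex.norm_exp]
    have hv' : |v| ≤ h := abs_le.mpr ⟨hv.1.le, hv.2⟩
    have h2 : (-(z * v)).re ≤ |z.re| * h := by
      have : (-(z * v)).re = -(z.re * v) := by simp
      rw [this]
      calc -(z.re * v) ≤ |z.re * v| := neg_le_abs _
        _ = |z.re| * |v| := abs_mul _ _
        _ ≤ _ := by gcongr
    calc tent h v * Real.exp (-(z * v)).re ≤ 1 * Real.exp (|z.re| * h) :=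
          mul_le_mul (tent_le_one hh v) (Real.exp_le_exp.mpr h2) (Real.exp_pos _).le zero_le_one
      _ = _ := one_mul _
  · rw [show |h - -h| = 2 * h by rw [abs_of_pos (by linarith)]; ring]; ring

/-- If a countable family of functions sums pointwise to a constant, then its moments against a
function of integral zero sum to zero. -/
lemma hasSum_integral_mul_eq_zero {ι : Type*} [Countable ι] {A : ℝ → ℂ}
    (hA0 : ∫ t, A t = 0) {P : ι → ℝ → ℝ} {c : ℝ} (hP : ∀ t, HasSum (fun i => P i t) c)
    (hi : ∀ i, MeasureTheory.Integrable fun t => A t * P i t)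
    (hs : Summable fun i => ∫ t, ‖A t * P i t‖) :
    HasSum (fun i => ∫ t, A t * P i t) 0 := by
  have h1 := MeasureTheory.hasSum_integral_of_summable_integral_norm hi hs
  have h2 : ∫ t, ∑' i, A t * P i t = 0 := by
    have : ∀ t, ∑' i, A t * (P i t : ℂ) = A t * c := fun t => by
      rw [tsum_mul_left]
      congr 1
      exact (Complex.hasSum_ofReal.mpr (hP t)).tsum_eq
    simp_rw [this]
    rw [MeasureTheory.integral_mul_const, hA0, zero_mul]
  rwa [h2] at h1

lemma integral_inv_one_add_sq_mul_poisson_le (γ : ℝ) :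
    MeasureTheory.Integrable (fun t : ℝ => (1 + t ^ 2)⁻¹ * (1 / (1 ^ 2 + (t - γ) ^ 2))) ∧
    ∫ t : ℝ, (1 + t ^ 2)⁻¹ * (1 / (1 ^ 2 + (t - γ) ^ 2)) ≤
      4 * Real.pi * (1 / (1 ^ 2 + γ ^ 2)) := by
  have hi1 := integrable_inv_one_add_sq
  have hi2 : MeasureTheory.Integrable fun t : ℝ => (1 + (t - γ) ^ 2)⁻¹ := hi1.comp_sub_right γ
  have hb : ∀ t : ℝ, (1 + t ^ 2)⁻¹ * (1 / (1 ^ 2 + (t - γ) ^ 2)) ≤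
      1 / (1 ^ 2 + γ ^ 2) * (2 * (1 + (t - γ) ^ 2)⁻¹ + 2 * (1 + t ^ 2)⁻¹) := by
    intro t
    have e : 1 / (1 ^ 2 + γ ^ 2) * (2 * (1 + (t - γ) ^ 2)⁻¹ + 2 * (1 + t ^ 2)⁻¹) =
      (2 * (1 + t ^ 2) + 2 * (1 + (t - γ) ^ 2)) / ((1 + γ ^ 2) * ((1 + t ^ 2) * (1 + (t - γ) ^ 2))) := by
      field_simp
    rw [e, show (1 + t ^ 2)⁻¹ * (1 / (1 ^ 2 + (t - γ) ^ 2)) =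
      (1 + γ ^ 2) / ((1 + γ ^ 2) * ((1 + t ^ 2) * (1 + (t - γ) ^ 2))) by field_simp]
    exact div_le_div_of_nonneg_right (by nlinarith [sq_nonneg (2 * t - γ)]) (by positivity)
  have hi3 : MeasureTheory.Integrable fun t : ℝ =>
      1 / (1 ^ 2 + γ ^ 2) * (2 * (1 + (t - γ) ^ 2)⁻¹ + 2 * (1 + t ^ 2)⁻¹) :=
    ((hi2.const_mul 2).add (hi1.const_mul 2)).const_mul _
  have hi : MeasureTheory.Integrable
      (fun t : ℝ => (1 + t ^ 2)⁻¹ * (1 / (1 ^ 2 + (t - γ) ^ 2))) := by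
    refine hi3.mono' (Continuous.aestronglyMeasurable ?_) (Eventually.of_forall fun t => ?_)
    · refine Continuous.mul (Continuous.inv₀ (by fun_prop) fun t => by positivity)
        (Continuous.div (by fun_prop) (by fun_prop) fun t => by positivity)
    · rw [Real.norm_of_nonneg (by positivity)]
      exact hb t
  refine ⟨hi, (MeasureTheory.integral_mono hi hi3 hb).trans (le_of_eq ?_)⟩
  rw [MeasureTheory.integral_const_mul, MeasureTheory.integral_add (hi2.const_mul 2)
    (hi1.const_mul 2), MeasureTheory.integral_const_mul, MeasureTheory.integral_const_mul,
    integral_univ_inv_one_add_sq, MeasureTheory.integral_sub_right_eq_self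
      (fun t : ℝ => (1 + t ^ 2)⁻¹), integral_univ_inv_one_add_sq]
  ring

/-- The difference `1 / X - X / (X ^ 2 + y ^ 2)` at `X = b / 2`, `y = t / 2`. -/
noncomputable def digammaKernel (b t : ℝ) : ℝ := 2 / b - 2 * (b / (b ^ 2 + (t - 0) ^ 2))

lemma digammaKernel_eq {b : ℝ} (hb : 0 < b) (t : ℝ) :
    digammaKernel b t = 2 * t ^ 2 / (b * (b ^ 2 + t ^ 2)) := by
  unfold digammaKernel
  rw [sub_zero]
  field_simp
  ring

lemma integral_inv_one_add_sq_mul_digammaKernel_le {b : ℝ} (hb : 0 < b) :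
    MeasureTheory.Integrable (fun t : ℝ => (1 + t ^ 2)⁻¹ * digammaKernel b t) ∧
    ∫ t : ℝ, (1 + t ^ 2)⁻¹ * digammaKernel b t ≤ 2 * Real.pi / b ^ 2 := by
  have hbd : ∀ t : ℝ, (1 + t ^ 2)⁻¹ * digammaKernel b t ≤ 2 / b ^ 3 * (1 + (b⁻¹ * t) ^ 2)⁻¹ := by
    intro t
    rw [digammaKernel_eq hb]
    have e : 2 / b ^ 3 * (1 + (b⁻¹ * t) ^ 2)⁻¹ = 2 / (b * (b ^ 2 + t ^ 2)) := by
      field_simp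
    have e2 : (1 + t ^ 2)⁻¹ * (2 * t ^ 2 / (b * (b ^ 2 + t ^ 2))) =
      (t ^ 2 / (1 + t ^ 2)) * (2 / (b * (b ^ 2 + t ^ 2))) := by field_simp
    rw [e, e2]
    refine mul_le_of_le_one_left (by positivity) ?_
    rw [div_le_one (by positivity)]
    linarith
  have hi3 : MeasureTheory.Integrable fun t : ℝ => 2 / b ^ 3 * (1 + (b⁻¹ * t) ^ 2)⁻¹ :=
    (integrable_inv_one_add_sq.comp_mul_left' (inv_ne_zero hb.ne')).const_mul _
  have hi : MeasureTheory.Integrable (fun t : ℝ => (1 + t ^ 2)⁻¹ * digammaKernel b t) := by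
    refine hi3.mono' (Continuous.aestronglyMeasurable ?_) (Eventually.of_forall fun t => ?_)
    · unfold digammaKernel
      refine Continuous.mul (Continuous.inv₀ (by fun_prop) fun t => by positivity)
        (Continuous.sub (by fun_prop) (Continuous.mul (by fun_prop)
          (Continuous.div (by fun_prop) (by fun_prop) fun t => by positivity)))
    · rw [Real.norm_of_nonneg]
      · exact hbd t
      · rw [digammaKernel_eq hb]; positivity
  refine ⟨hi, (MeasureTheory.integral_mono hi hi3 hbd).trans (le_of_eq ?_)⟩
  rw [MeasureTheory.integral_const_mul, MeasureTheory.Measure.integral_comp_mul_left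
    (fun t : ℝ => (1 + t ^ 2)⁻¹), integral_univ_inv_one_add_sq, inv_inv, abs_of_pos hb, smul_eq_mul]
  field_simp

/-- Integrability and size of the test function `t ↦ ĝ(1 + i t) e^{i t u}` against a nonnegative
continuous kernel. -/
lemma integrable_tentTransform_mul {h u M : ℝ} (hh : 0 < h) {P : ℝ → ℝ} (hP : ∀ t, 0 ≤ P t)
    (hc : Continuous P)
    (hi : MeasureTheory.Integrable (fun t : ℝ => (1 + t ^ 2)⁻¹ * P t) ∧
      ∫ t : ℝ, (1 + t ^ 2)⁻¹ * P t ≤ M) :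
    MeasureTheory.Integrable (fun t : ℝ =>
      tentTransform h (1 + t * I) * Complex.exp (t * u * I) * (P t : ℂ)) ∧
    ∫ t : ℝ, ‖tentTransform h (1 + t * I) * Complex.exp (t * u * I) * (P t : ℂ)‖ ≤
      (2 * Real.exp h + 2) / h * M := by
  have hb : ∀ t : ℝ, ‖tentTransform h (1 + t * I) * Complex.exp (t * u * I) * (P t : ℂ)‖ ≤
      (2 * Real.exp h + 2) / h * ((1 + t ^ 2)⁻¹ * P t) := by
    intro t
    rw [norm_mul, norm_mul, Complex.norm_of_nonneg (hP t), ← mul_assoc,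
      show (t : ℂ) * u * I = ((t * u : ℝ) : ℂ) * I by push_cast; ring,
      Complex.norm_exp_ofReal_mul_I, mul_one]
    exact mul_le_mul_of_nonneg_right (norm_tentTransform_le hh t) (hP t)
  have hi2 := hi.1.const_mul ((2 * Real.exp h + 2) / h)
  have hInt : MeasureTheory.Integrable (fun t : ℝ =>
      tentTransform h (1 + t * I) * Complex.exp (t * u * I) * (P t : ℂ)) := by
    refine hi2.mono' (Continuous.aestronglyMeasurable ?_) (Eventually.of_forall hb)
    have := continuous_tentTransform hh
    fun_prop
  refine ⟨hInt, (MeasureTheory.integral_mono hInt.norm hi2 hb).trans ?_⟩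
  rw [MeasureTheory.integral_const_mul]
  exact mul_le_mul_of_nonneg_left hi.2 (by positivity)

lemma integral_tentTransform_mul_digammaKernel {h u b : ℝ} (hh : 0 < h) (hu : h ≤ u)
    (hb : 0 < b) :
    ∫ t : ℝ, tentTransform h (1 + t * I) * Complex.exp (t * u * I) * (digammaKernel b t : ℂ) =
      -(2 * Real.pi * Complex.exp (-(b * u)) * tentTransform h (1 - b)) := by
  have h0 : ∫ t : ℝ, tentTransform h (1 + t * I) * Complex.exp (t * u * I) = 0 := by
    rw [integral_tentTransform_mul_exp hh u, tent_eq_zero hh (hu.trans (le_abs_self u))]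
    simp
  have h1 := integral_tentTransform_mul_poisson hh hb hu 0
  have hiA : MeasureTheory.Integrable fun t : ℝ =>
      tentTransform h (1 + t * I) * Complex.exp (t * u * I) := by
    have := (integrable_tentTransform_mul (u := u) (P := fun _ => 1) hh (fun _ => zero_le_one)
      continuous_const ⟨by simpa using integrable_inv_one_add_sq, le_rfl⟩).1
    simpa using this
  have hiP : MeasureTheory.Integrable fun t : ℝ =>
      tentTransform h (1 + t * I) * Complex.exp (t * u * I) *
        ((b / (b ^ 2 + (t - 0) ^ 2) : ℝ) : ℂ) := by
    have hcont : Continuous fun t : ℝ => b / (b ^ 2 + (t - 0) ^ 2) :=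
      Continuous.div (by fun_prop) (by fun_prop) fun t => by positivity
    refine (hiA.bdd_mul (c := 1 / b) (f := fun t : ℝ => ((b / (b ^ 2 + (t - 0) ^ 2) : ℝ) : ℂ))
      (Complex.continuous_ofReal.comp hcont).aestronglyMeasurable
      (Eventually.of_forall fun t => ?_)).congr
      (Eventually.of_forall fun t => by simp only; ring)
    rw [Complex.norm_of_nonneg (by positivity), div_le_div_iff₀ (by positivity) hb]
    nlinarith [sq_nonneg (t - 0)]
  have e : ∀ t : ℝ, tentTransform h (1 + t * I) * Complex.exp (t * u * I) *
      (digammaKernel b t : ℂ) =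
      tentTransform h (1 + t * I) * Complex.exp (t * u * I) * (2 / b : ℂ) -
      (tentTransform h (1 + t * I) * Complex.exp (t * u * I) *
        ((b / (b ^ 2 + (t - 0) ^ 2) : ℝ) : ℂ)) * 2 := by
    intro t
    rw [digammaKernel]
    push_cast
    ring
  simp_rw [e]
  rw [MeasureTheory.integral_sub (hiA.mul_const _) (hiP.mul_const _),
    MeasureTheory.integral_mul_const, MeasureTheory.integral_mul_const, h0, h1]
  simp
  ring

lemma integral_tentTransform_mul_re {h u : ℝ} (hh : 0 < h) (hu : h ≤ u) (w : ℂ) {L : ℝ}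
    (hL : 0 ≤ L) :
    ∫ t : ℝ, tentTransform h (1 + t * I) * Complex.exp (t * u * I) *
      ((w * Complex.exp (-(t * L * I))).re : ℂ) =
    Real.pi * Complex.exp (-u) * (w * Complex.exp L * tent h (u - L)) := by
  have e : ∀ t : ℝ, tentTransform h (1 + t * I) * Complex.exp (t * u * I) *
      ((w * Complex.exp (-(t * L * I))).re : ℂ) =
      w / 2 * (tentTransform h (1 + t * I) * Complex.exp (t * (u - L : ℝ) * I)) +
      (starRingEnd ℂ w) / 2 *
        (tentTransform h (1 + t * I) * Complex.exp (t * (u + L : ℝ) * I)) := by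
    intro t
    rw [Complex.re_eq_add_conj, map_mul, ← Complex.exp_conj]
    have e1 : (starRingEnd ℂ) (-((t : ℂ) * L * I)) = t * L * I := by simp
    have e2 : Complex.exp (t * (u - L : ℝ) * I) =
        Complex.exp (t * u * I) * Complex.exp (-(t * L * I)) := by
      rw [← Complex.exp_add]; congr 1; push_cast; ring
    have e3 : Complex.exp (t * (u + L : ℝ) * I) =
        Complex.exp (t * u * I) * Complex.exp (t * L * I) := by
      rw [← Complex.exp_add]; congr 1; push_cast; ring
    rw [e1, e2, e3]
    ring
  have hi : ∀ v : ℝ, MeasureTheory.Integrable fun t : ℝ =>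
      tentTransform h (1 + t * I) * Complex.exp (t * v * I) := fun v => by
    have := (integrable_tentTransform_mul (u := v) (P := fun _ => 1) hh (fun _ => zero_le_one)
      continuous_const ⟨by simpa using integrable_inv_one_add_sq, le_rfl⟩).1
    simpa using this
  simp_rw [e]
  rw [MeasureTheory.integral_add ((hi _).const_mul _) ((hi _).const_mul _),
    MeasureTheory.integral_const_mul, MeasureTheory.integral_const_mul,
    integral_tentTransform_mul_exp hh, integral_tentTransform_mul_exp hh,
    tent_eq_zero (v := u + L) hh ((by linarith : h ≤ u + L).trans (le_abs_self _)), neg_sub]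
  push_cast
  rw [show Complex.exp ((L : ℂ) - u) = Complex.exp (-u) * Complex.exp L by
    rw [← Complex.exp_add]; ring_nf]
  ring

/-- The poles of the digamma terms are at least `2 k + 3 / 2`. -/
lemma norm_integral_tentTransform_mul_digammaKernel_le {h u b : ℝ} (hh : 0 < h) (hh2 : h ≤ 1 / 2)
    (hu : 1 ≤ u) {k : ℕ} (hb : 2 * k + 3 / 2 ≤ b) :
    ‖∫ t : ℝ, tentTransform h (1 + t * I) * Complex.exp (t * u * I) * (digammaKernel b t : ℂ)‖ ≤
      2 * Real.pi * Real.exp (-u) * Real.exp (-1) ^ k := by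
  have hk : (0 : ℝ) ≤ k := k.cast_nonneg
  have hb0 : 0 < b := by linarith
  rw [integral_tentTransform_mul_digammaKernel hh (by linarith) hb0, norm_neg, norm_mul, norm_mul,
    show (2 * Real.pi : ℂ) = ((2 * Real.pi : ℝ) : ℂ) by push_cast; ring,
    Complex.norm_of_nonneg (by positivity), Complex.norm_exp, ← Real.exp_nat_mul]
  have h1 := norm_tentTransform_le_exp hh (1 - b : ℂ)
  have h2 : |(1 - b : ℂ).re| = b - 1 := by
    rw [Complex.sub_re, Complex.one_re, Complex.ofReal_re, abs_of_neg (by linarith)]; ring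
  rw [h2] at h1
  have h3 : (-(b * u : ℂ)).re = -(b * u) := by simp
  rw [h3, mul_assoc (2 * Real.pi), mul_assoc (2 * Real.pi)]
  refine mul_le_mul_of_nonneg_left ?_ (mul_nonneg zero_le_two Real.pi_pos.le)
  calc Real.exp (-(b * u)) * ‖tentTransform h (1 - b)‖
      ≤ Real.exp (-(b * u)) * (1 * Real.exp ((b - 1) * h)) := by
        refine mul_le_mul_of_nonneg_left (h1.trans ?_) (Real.exp_pos _).le
        exact mul_le_mul_of_nonneg_right (by linarith) (Real.exp_pos _).le
    _ = Real.exp (-(b * u) + (b - 1) * h) := by rw [one_mul, Real.exp_add]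
    _ ≤ Real.exp (-u + k * -1) := Real.exp_le_exp.mpr (by nlinarith)
    _ = _ := Real.exp_add _ _

lemma LSeries_term_mul_vonMangoldt {N : ℕ} (χ : DirichletCharacter ℂ N) (t : ℝ) (n : ℕ) :
    LSeries.term ((fun n : ℕ => χ n) * fun n => (ArithmeticFunction.vonMangoldt n : ℂ))
      (3 / 2 + t * I) n =
    χ n * ArithmeticFunction.vonMangoldt n * ((n : ℝ) ^ (-(3 / 2) : ℝ) : ℝ) *
      Complex.exp (-(t * Real.log n * I)) := by
  rcases eq_or_ne n 0 with rfl | hn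
  · simp
  have hn' : (n : ℂ) ≠ 0 := by exact_mod_cast hn
  have hn0 : (0 : ℝ) < n := by exact_mod_cast Nat.pos_of_ne_zero hn
  rw [LSeries.term_of_ne_zero hn, Pi.mul_apply, div_eq_mul_inv, ← Complex.cpow_neg, mul_assoc _ _
    (Complex.exp _)]
  congr 1
  rw [Real.rpow_def_of_pos hn0, Complex.ofReal_exp, ← Complex.exp_add,
    Complex.cpow_def_of_ne_zero hn', ← Complex.natCast_log]
  congr 1
  push_cast
  ring

lemma GRH.countable_support_zeroMult (h : GRH) {N : ℕ} [NeZero N] {χ : DirichletCharacter ℂ N}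
    (hχ : χ ≠ 1) (hp : χ.IsPrimitive) : (Function.support (zeroMult χ)).Countable := by
  refine (h.hasSum_zeroMult hχ hp zero_lt_one 0).summable.countable_support.mono fun γ hγ => ?_
  rw [Function.mem_support] at hγ ⊢
  have : (0 : ℝ) < 1 / (1 ^ 2 + (0 - γ) ^ 2) := by positivity
  exact mul_ne_zero (by exact_mod_cast hγ) this.ne'

theorem GRH.explicit_formula (h : GRH) : ∃ C : ℝ, 0 < C ∧
    ∀ (N : ℕ) [NeZero N] (χ : DirichletCharacter ℂ N), χ ≠ 1 → χ.IsPrimitive →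
      ∀ η u : ℝ, 0 < η → η ≤ 1 / 2 → 1 ≤ u →
      ∃ S : ℂ, HasSum (fun γ : ℝ => (zeroMult χ γ : ℂ) *
        (Complex.exp (u * γ * I) * tentTransform η (γ * I))) S ∧
        ‖∑' n : ℕ, χ n * (ArithmeticFunction.vonMangoldt n * (n : ℝ) ^ (-(1 / 2) : ℝ) *
          tent η (u - Real.log n) : ℝ) + S‖ ≤ C := by
  have hgeo : Summable fun k : ℕ => Real.exp (-1) ^ k :=
    summable_geometric_of_lt_one (Real.exp_pos _).le (Real.exp_zero ▸ Real.exp_lt_exp.mpr (by norm_num))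
  refine ⟨(∑' k : ℕ, Real.exp (-1) ^ k), ?_, fun N _ χ hχ hp η u hη hη2 hu => ?_⟩
  · exact hgeo.tsum_pos (fun k => by positivity) 0 (by positivity)
  have hηu : η ≤ u := by linarith
  have ha0 := parity_nonneg χ
  set x : ℝ := (3 / 2 + parity χ) / 2 with hx
  have hx0 : 0 < x := by rw [hx]; linarith
  set b : ℕ → ℝ := fun k => 2 * (k + x) with hb
  have hbk : ∀ k : ℕ, 2 * (k : ℝ) + 3 / 2 ≤ b k := fun k => by
    simp only [hb, hx]; linarith
  have hb0 : ∀ k : ℕ, 0 < b k := fun k => by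
    have : (0 : ℝ) ≤ k := k.cast_nonneg
    linarith [hbk k]
  set w : ℕ → ℂ := fun n => χ n * ArithmeticFunction.vonMangoldt n *
    ((n : ℝ) ^ (-(3 / 2) : ℝ) : ℝ) with hw
  set Γ := Function.support (zeroMult χ) with hΓ
  have : Countable Γ := (h.countable_support_zeroMult hχ hp).to_subtype
  set A : ℝ → ℂ := fun t => tentTransform η (1 + t * I) * Complex.exp (t * u * I) with hA
  set P : Γ ⊕ (ℕ ⊕ ℕ) → ℝ → ℝ := Sum.elim
    (fun γ t => (zeroMult χ γ : ℝ) * (1 / (1 ^ 2 + (t - γ) ^ 2)))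
    (Sum.elim (fun k t => -(1 / 2) * digammaKernel (b k) t)
      (fun n t => (w n * Complex.exp (-(t * Real.log n * I))).re)) with hP
  have hA0 : ∫ t, A t = 0 := by
    simp only [hA]
    rw [integral_tentTransform_mul_exp hη u, tent_eq_zero hη (hηu.trans (le_abs_self u))]
    simp
  have hwn : ∀ (n : ℕ) (t : ℝ), ‖w n * Complex.exp (-(t * Real.log n * I))‖ ≤
      ArithmeticFunction.vonMangoldt n / (n : ℝ) ^ (3 / 2 : ℝ) := by
    intro n t
    have hΛ := ArithmeticFunction.vonMangoldt_nonneg (n := n)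
    rw [show (-(t * Real.log n * I) : ℂ) = ((-(t * Real.log n) : ℝ) : ℂ) * I by push_cast; ring,
      norm_mul, Complex.norm_exp_ofReal_mul_I, mul_one]
    simp only [hw]
    rw [norm_mul, norm_mul, Complex.norm_of_nonneg hΛ, Complex.norm_of_nonneg (by positivity),
      Real.rpow_neg n.cast_nonneg, mul_assoc, ← div_eq_mul_inv]
    exact mul_le_of_le_one_left (by positivity) (χ.norm_le_one _)
  have hPsum : ∀ t, HasSum (fun i => P i t) (-(Real.log Real.pi / 2) + (digamma (x : ℂ)).re / 2
      + Real.log N / 2) := by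
    intro t
    have h1 := h.hasSum_zeroMult hχ hp zero_lt_one t
    have h1' := (hasSum_subtype_iff_of_support_subset (s := Γ) (fun γ hγ => by
      rw [Function.mem_support] at hγ
      rw [hΓ, Function.mem_support]
      intro h0
      simp [h0] at hγ)).mpr h1
    have h2 := (hasSum_digamma_re_sub hx0 (t / 2)).mul_left (-(1 / 2))
    have hre : (1 : ℝ) < (3 / 2 + t * I : ℂ).re := by simp; norm_num
    have h3 : HasSum (fun n => (w n * Complex.exp (-(t * Real.log n * I))).re)
        (-(logDeriv χ.LFunction (3 / 2 + t * I)).re) := by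
      rw [logDeriv_LFunction_eq χ hre, Complex.neg_re, neg_neg]
      refine Complex.hasSum_re ?_
      have h4 : Summable (LSeries.term ((fun n : ℕ => χ n) *
          fun n => (ArithmeticFunction.vonMangoldt n : ℂ)) (3 / 2 + t * I)) := by
        refine Summable.of_norm_bounded summable_vonMangoldt_div_rpow fun n => ?_
        rw [LSeries_term_mul_vonMangoldt]
        exact hwn n t
      exact h4.hasSum.congr_fun fun n => (LSeries_term_mul_vonMangoldt χ t n).symm
    have e1 : (fun k : ℕ => -(1 / 2) * digammaKernel (b k) t) = fun k : ℕ => -(1 / 2) *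
        (1 / (k + x) - (k + x) / ((k + x) ^ 2 + (t / 2) ^ 2)) := by
      funext k
      have hk : (0 : ℝ) ≤ k := k.cast_nonneg
      rw [digammaKernel]
      simp only [hb]
      have : 0 < (k : ℝ) + x := by linarith
      field_simp
      ring
    have h5 := HasSum.sum (f := fun i => P i t) h1' (HasSum.sum (f := fun i => P (Sum.inr i) t) (e1 ▸ h2) h3)
    convert h5 using 1
    have e2 : (1 / 2 + (1 : ℝ) + t * I : ℂ) = 3 / 2 + t * I := by push_cast; ring
    have e3 : ((3 / 2 + t * I + parity χ) / 2 : ℂ) = x + (t / 2 : ℝ) * I := by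
      rw [hx]; push_cast; ring
    rw [e2, logDeriv_completedLFunction_eq hχ hre, e3]
    simp only [Complex.add_re, Complex.neg_re, Complex.ofReal_re]
    rw [show ∀ z : ℂ, (z / 2).re = z.re / 2 from fun z => by simp]
    ring
  have hzero : ∀ γ : ℝ, MeasureTheory.Integrable (fun t : ℝ =>
      A t * ((zeroMult χ γ * (1 / (1 ^ 2 + (t - γ) ^ 2)) : ℝ) : ℂ)) ∧
      ∫ t : ℝ, ‖A t * ((zeroMult χ γ * (1 / (1 ^ 2 + (t - γ) ^ 2)) : ℝ) : ℂ)‖ ≤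
      (2 * Real.exp η + 2) / η * (4 * Real.pi) * (zeroMult χ γ * (1 / (1 ^ 2 + (0 - γ) ^ 2))) := by
    intro γ
    obtain ⟨hi, hle⟩ := integral_inv_one_add_sq_mul_poisson_le γ
    have h1 := integrable_tentTransform_mul (u := u)
      (P := fun t => zeroMult χ γ * (1 / (1 ^ 2 + (t - γ) ^ 2)))
      (M := zeroMult χ γ * (4 * Real.pi * (1 / (1 ^ 2 + γ ^ 2)))) hη
      (fun t => by positivity)
      (continuous_const.mul (Continuous.div (by fun_prop) (by fun_prop) fun t => by positivity))
      ⟨(hi.const_mul (zeroMult χ γ : ℝ)).congr (Eventually.of_forall fun t => by simp only; ring),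
        by
          simp_rw [mul_left_comm _ (zeroMult χ γ : ℝ)]
          rw [MeasureTheory.integral_const_mul]
          exact mul_le_mul_of_nonneg_left hle (Nat.cast_nonneg _)⟩
    refine ⟨h1.1, h1.2.trans (le_of_eq ?_)⟩
    rw [zero_sub, neg_sq]
    ring
  have hdig : ∀ k : ℕ, MeasureTheory.Integrable (fun t : ℝ =>
      A t * ((-(1 / 2) * digammaKernel (b k) t : ℝ) : ℂ)) ∧
      ∫ t : ℝ, ‖A t * ((-(1 / 2) * digammaKernel (b k) t : ℝ) : ℂ)‖ ≤
      (2 * Real.exp η + 2) / η * Real.pi * (1 / ((k : ℝ) + 1) ^ 2) := by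
    intro k
    have h1 := integrable_tentTransform_mul (u := u) hη
      (fun t => by rw [digammaKernel_eq (hb0 k)]; have := hb0 k; positivity)
      (by
        have := hb0 k
        unfold digammaKernel
        exact Continuous.sub (by fun_prop) (Continuous.mul (by fun_prop)
          (Continuous.div (by fun_prop) (by fun_prop) fun t => by positivity)))
      (integral_inv_one_add_sq_mul_digammaKernel_le (hb0 k))
    have e : ∀ t : ℝ, A t * ((-(1 / 2) * digammaKernel (b k) t : ℝ) : ℂ) =
        (-(1 / 2) : ℂ) * (A t * (digammaKernel (b k) t : ℂ)) := fun t => by push_cast; ring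
    simp_rw [e]
    refine ⟨h1.1.const_mul _, ?_⟩
    simp_rw [norm_mul (-(1 / 2) : ℂ)]
    rw [MeasureTheory.integral_const_mul]
    have h2 : ‖(-(1 / 2) : ℂ)‖ = 1 / 2 := by simp
    rw [h2]
    have hk : (0 : ℝ) ≤ k := k.cast_nonneg
    have h3 : 1 / (b k) ^ 2 ≤ 1 / ((k : ℝ) + 1) ^ 2 := by
      have := hbk k
      gcongr
      linarith
    calc 1 / 2 * ∫ t : ℝ, ‖A t * (digammaKernel (b k) t : ℂ)‖
        ≤ 1 / 2 * ((2 * Real.exp η + 2) / η * (2 * Real.pi / b k ^ 2)) := by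
          exact mul_le_mul_of_nonneg_left h1.2 (by norm_num)
      _ = (2 * Real.exp η + 2) / η * Real.pi * (1 / (b k) ^ 2) := by ring
      _ ≤ _ := mul_le_mul_of_nonneg_left h3 (by have := Real.pi_pos; positivity)
  have hAi : MeasureTheory.Integrable A := by
    have := (integrable_tentTransform_mul (u := u) (P := fun _ => 1) hη (fun _ => zero_le_one)
      continuous_const ⟨by simpa using integrable_inv_one_add_sq, le_rfl⟩).1
    simpa using this
  have hprime : ∀ n : ℕ, MeasureTheory.Integrable (fun t : ℝ =>
      A t * ((w n * Complex.exp (-(t * Real.log n * I))).re : ℂ)) ∧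
      ∫ t : ℝ, ‖A t * ((w n * Complex.exp (-(t * Real.log n * I))).re : ℂ)‖ ≤
      (∫ t, ‖A t‖) * (ArithmeticFunction.vonMangoldt n / (n : ℝ) ^ (3 / 2 : ℝ)) := by
    intro n
    have hbd : ∀ t : ℝ, ‖((w n * Complex.exp (-(t * Real.log n * I))).re : ℂ)‖ ≤
        ArithmeticFunction.vonMangoldt n / (n : ℝ) ^ (3 / 2 : ℝ) := fun t => by
      rw [Complex.norm_real]
      exact (Complex.abs_re_le_norm _).trans (hwn n t)
    have hi : MeasureTheory.Integrable (fun t : ℝ =>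
        A t * ((w n * Complex.exp (-(t * Real.log n * I))).re : ℂ)) := by
      refine hAi.mul_bdd (Continuous.aestronglyMeasurable ?_) (Eventually.of_forall hbd)
      exact Complex.continuous_ofReal.comp (Complex.continuous_re.comp (by fun_prop))
    refine ⟨hi, ?_⟩
    rw [← MeasureTheory.integral_mul_const]
    refine MeasureTheory.integral_mono hi.norm (hAi.norm.mul_const _) fun t => ?_
    simp only [norm_mul (A t)]
    exact mul_le_mul_of_nonneg_left (hbd t) (norm_nonneg _)
  have hPA : ∀ i, MeasureTheory.Integrable fun t => A t * P i t := by
    rintro (γ | k | n)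
    exacts [(hzero γ).1, (hdig k).1, (hprime n).1]
  have hPs : Summable fun i => ∫ t, ‖A t * P i t‖ := by
    refine Summable.sum _ ?_ (Summable.sum _ ?_ ?_)
    · refine Summable.of_nonneg_of_le (fun γ => MeasureTheory.integral_nonneg fun t => norm_nonneg _)
        (fun γ => (hzero γ).2) ?_
      exact (((h.hasSum_zeroMult hχ hp zero_lt_one 0).summable.mul_left _).subtype Γ)
    · exact Summable.of_nonneg_of_le (fun γ => MeasureTheory.integral_nonneg fun t => norm_nonneg _)
        (fun k => (hdig k).2) (summable_one_div_nat_add_one_sq.mul_left _)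
    · exact Summable.of_nonneg_of_le (fun γ => MeasureTheory.integral_nonneg fun t => norm_nonneg _)
        (fun k => (hprime k).2) (summable_vonMangoldt_div_rpow.mul_left _)
  have hmain := hasSum_integral_mul_eq_zero hA0 hPsum hPA hPs
  have hm1 := hmain.summable.comp_injective (i := Sum.inl) Sum.inl_injective
  have hm2 := hmain.summable.comp_injective (i := Sum.inr) Sum.inr_injective
  have hm3 := hm2.comp_injective (i := Sum.inl) Sum.inl_injective
  have hm4 := hm2.comp_injective (i := Sum.inr) Sum.inr_injective
  have htot := hmain.unique (HasSum.sum hm1.hasSum (HasSum.sum hm3.hasSum hm4.hasSum))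
  set c : ℂ := Real.pi * Complex.exp (-u) with hc
  have hc0 : c ≠ 0 := mul_ne_zero (by exact_mod_cast Real.pi_ne_zero) (Complex.exp_ne_zero _)
  have v1 : ∀ γ : Γ, ∫ t, A t * P (Sum.inl γ) t = c * ((zeroMult χ γ : ℂ) *
      (Complex.exp (u * γ * I) * tentTransform η (γ * I))) := by
    intro γ
    have h1 := integral_tentTransform_mul_poisson hη zero_lt_one hηu γ
    have e : ∀ t : ℝ, A t * (P (Sum.inl γ) t : ℂ) = (zeroMult χ γ : ℂ) *
        (A t * ((1 / (1 ^ 2 + (t - γ) ^ 2) : ℝ) : ℂ)) := fun t => by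
      simp only [hP, Sum.elim_inl]
      push_cast
      ring
    simp_rw [e]
    rw [MeasureTheory.integral_const_mul, h1, hc, Complex.ofReal_one, sub_self, zero_add,
      show -((1 - (γ : ℝ) * I) * u : ℂ) = -u + u * γ * I by ring, Complex.exp_add]
    ring
  have v3 : ∀ n : ℕ, ∫ t, A t * P (Sum.inr (Sum.inr n)) t =
      c * (χ n * (ArithmeticFunction.vonMangoldt n * (n : ℝ) ^ (-(1 / 2) : ℝ) *
          tent η (u - Real.log n) : ℝ)) := by
    intro n
    have h1 := integral_tentTransform_mul_re hη hηu (w n) (Real.log_natCast_nonneg n)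
    refine h1.trans ?_
    rcases eq_or_ne n 0 with rfl | hn
    · simp [hw]
    have hn0 : (0 : ℝ) < n := by exact_mod_cast Nat.pos_of_ne_zero hn
    rw [← Complex.ofReal_exp, Real.exp_log hn0]
    simp only [hw]
    rw [show (-(1 / 2) : ℝ) = -(3 / 2) + 1 by norm_num, Real.rpow_add hn0, Real.rpow_one]
    push_cast
    ring
  have hS : HasSum (fun γ : ℝ => (zeroMult χ γ : ℂ) *
        (Complex.exp (u * γ * I) * tentTransform η (γ * I)))
        (c⁻¹ * ∑' γ : Γ, ∫ t, A t * P (Sum.inl γ) t) := by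
    refine (hasSum_subtype_iff_of_support_subset (s := Γ) (fun γ hγ => ?_)).mp ?_
    · rw [Function.mem_support] at hγ
      rw [hΓ, Function.mem_support]
      intro h0
      simp [h0] at hγ
    · refine (hm1.hasSum.mul_left c⁻¹).congr_fun fun γ => ?_
      simp only [Function.comp_apply, v1]
      field_simp
  refine ⟨_, hS, ?_⟩
  have e4 : ∑' n : ℕ, χ n * (ArithmeticFunction.vonMangoldt n * (n : ℝ) ^ (-(1 / 2) : ℝ) *
          tent η (u - Real.log n) : ℝ) =
      c⁻¹ * ∑' n, ∫ t, A t * P (Sum.inr (Sum.inr n)) t := by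
    rw [← tsum_mul_left]
    refine tsum_congr fun n => ?_
    rw [v3]
    field_simp
  have e5 : ∑' n : ℕ, χ n * (ArithmeticFunction.vonMangoldt n * (n : ℝ) ^ (-(1 / 2) : ℝ) *
          tent η (u - Real.log n) : ℝ) + c⁻¹ * ∑' γ : Γ, ∫ t, A t * P (Sum.inl γ) t =
      -(c⁻¹ * ∑' k, ∫ t, A t * P (Sum.inr (Sum.inl k)) t) := by
    rw [e4]
    simp only [Function.comp_def] at htot
    linear_combination -c⁻¹ * htot
  rw [e5, norm_neg, norm_mul, norm_inv]
  have hcn : ‖c‖ = Real.pi * Real.exp (-u) := by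
    rw [hc, norm_mul, Complex.norm_of_nonneg Real.pi_pos.le, Complex.norm_exp]
    simp
  have hcpos : 0 < ‖c‖ := norm_pos_iff.mpr hc0
  rw [inv_mul_le_iff₀ hcpos, ← tsum_mul_left]
  refine tsum_of_norm_bounded (hgeo.mul_left _).hasSum fun k => ?_
  have e6 : ∀ t : ℝ, A t * (P (Sum.inr (Sum.inl k)) t : ℂ) =
        (-(1 / 2) : ℂ) * (A t * (digammaKernel (b k) t : ℂ)) := fun t => by
    simp only [hP, Sum.elim_inl, Sum.elim_inr]
    push_cast
    ring
  simp_rw [e6]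
  have h7 := norm_integral_tentTransform_mul_digammaKernel_le hη hη2 hu (hbk k)
  rw [MeasureTheory.integral_const_mul, norm_mul, hcn, show ‖(-(1 / 2) : ℂ)‖ = 1 / 2 by simp]
  calc _ ≤ 1 / 2 * _ := mul_le_mul_of_nonneg_left h7 (by norm_num)
    _ = _ := by ring

/-- The Fourier transform of the tent function on the imaginary axis. -/
noncomputable def fejerKernel (h γ : ℝ) : ℝ :=
  if γ = 0 then h else 2 * (1 - Real.cos (γ * h)) / (h * γ ^ 2)

lemma tentTransform_mul_I {h : ℝ} (hh : 0 < h) (γ : ℝ) :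
    tentTransform h (γ * I) = (fejerKernel h γ : ℂ) := by
  unfold fejerKernel
  split_ifs with h0
  · subst h0
    have h1 := integral_tent_mul_eq hh (f := fun _ => (1 : ℂ)) continuous_const
    simp only [mul_one] at h1
    rw [tentTransform]
    simp only [Complex.ofReal_zero, zero_mul, neg_zero, Complex.exp_zero, mul_one]
    rw [h1, intervalIntegral.integral_ofReal, intervalIntegral.integral_ofReal,
      ← Complex.ofReal_add]
    congr 1
    rw [intervalIntegral.integral_add (by simp) (by simp), intervalIntegral.integral_sub (by simp) (by simp),
      intervalIntegral.integral_div, intervalIntegral.integral_div, integral_id, integral_id]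
    simp
    field_simp
    ring
  · rw [tentTransform_eq hh (mul_ne_zero (by exact_mod_cast h0) I_ne_zero)]
    push_cast
    rw [Complex.cos, mul_pow, I_sq]
    have e : (γ : ℂ) * I * h = γ * h * I := by ring
    rw [e, neg_mul]
    have hh' : (h : ℂ) ≠ 0 := by exact_mod_cast hh.ne'
    have h0' : (γ : ℂ) ≠ 0 := by exact_mod_cast h0
    field_simp
    ring

lemma fejerKernel_nonneg {h : ℝ} (hh : 0 < h) (γ : ℝ) : 0 ≤ fejerKernel h γ := by
  unfold fejerKernel
  split_ifs
  · exact hh.le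
  · have := Real.cos_le_one (γ * h)
    exact div_nonneg (by linarith) (by positivity)

lemma half_le_fejerKernel {h γ : ℝ} (hh : 0 < h) (hγ : |γ| * h ≤ 1) :
    h / 2 ≤ fejerKernel h γ := by
  unfold fejerKernel
  split_ifs with h0
  · linarith
  · have hx : |γ * h| ≤ 1 := by rwa [abs_mul, abs_of_pos hh]
    have h1 := (abs_le.mp (Real.cos_bound hx)).2
    have h2 : |γ * h| ^ 4 ≤ (γ * h) ^ 2 := by
      rw [← sq_abs (γ * h)]
      exact pow_le_pow_of_le_one (abs_nonneg _) hx (by norm_num)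
    rw [le_div_iff₀ (by positivity)]
    nlinarith [sq_nonneg (γ * h)]

lemma fejerKernel_le {h γ : ℝ} (hh : 0 < h) (hγ : γ ≠ 0) : fejerKernel h γ ≤ 4 / (h * γ ^ 2) := by
  rw [fejerKernel, if_neg hγ]
  have := Real.neg_one_le_cos (γ * h)
  exact div_le_div_of_nonneg_right (by linarith) (by positivity)

lemma cos_mul_fejerKernel_ge {H γ τ : ℝ} (hH : 4 ≤ H)
    (hc : |γ| ≤ 512 * H → 1 / 2 ≤ Real.cos (τ * γ)) :
    1 / 16 * ((H / 4) / ((H / 4) ^ 2 + γ ^ 2)) - 1 / 32 * (H / (H ^ 2 + γ ^ 2))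
      - 1 / 64 * ((512 * H) / ((512 * H) ^ 2 + γ ^ 2)) ≤
    Real.cos (τ * γ) * fejerKernel (1 / H) γ := by
  have hH0 : 0 < H := by linarith
  have hh : 0 < 1 / H := by positivity
  have hf0 := fejerKernel_nonneg hh γ
  have hB : 0 ≤ 1 / 64 * ((512 * H) / ((512 * H) ^ 2 + γ ^ 2)) := by positivity
  have hP : 0 ≤ 1 / 32 * (H / (H ^ 2 + γ ^ 2)) := by positivity
  rcases le_or_gt |γ| H with h1 | h1
  · have h2 := half_le_fejerKernel (γ := γ) hh (by
      rw [mul_one_div, div_le_one hH0]; exact h1)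
    have h3 := hc (by linarith)
    have h4 : 1 / 16 * ((H / 4) / ((H / 4) ^ 2 + γ ^ 2)) ≤ 1 / (4 * H) := by
      rw [one_div_mul_eq_div, div_div, div_le_div_iff₀ (by positivity) (by positivity)]
      nlinarith [sq_nonneg γ]
    have h5 : 1 / 2 * (1 / H / 2) ≤ Real.cos (τ * γ) * fejerKernel (1 / H) γ :=
      mul_le_mul h3 h2 (by positivity) (by linarith)
    have h6 : 1 / 2 * (1 / H / 2) = 1 / (4 * H) := by field_simp; norm_num
    linarith
  · have h2 : 1 / 16 * ((H / 4) / ((H / 4) ^ 2 + γ ^ 2)) ≤ 1 / 32 * (H / (H ^ 2 + γ ^ 2)) := by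
      have h3 : H ^ 2 ≤ γ ^ 2 := by
        rw [← sq_abs γ]
        gcongr
      have : (H / 4) / ((H / 4) ^ 2 + γ ^ 2) ≤ (H / 2) / (H ^ 2 + γ ^ 2) := by
        rw [div_le_div_iff₀ (by positivity) (by positivity)]
        nlinarith [mul_nonneg hH0.le (sub_nonneg.mpr h3), pow_pos hH0 3]
      have e : (H / 2) / (H ^ 2 + γ ^ 2) = 1 / 2 * (H / (H ^ 2 + γ ^ 2)) := by ring
      rw [e] at this
      linarith
    rcases le_or_gt |γ| (512 * H) with h4 | h4
    · have := mul_nonneg (by linarith [hc h4] : 0 ≤ Real.cos (τ * γ)) hf0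
      linarith
    · have hγ : γ ≠ 0 := abs_pos.mp (by linarith)
      have h5 := fejerKernel_le hh hγ
      have h6 := Real.neg_one_le_cos (τ * γ)
      have h7 : (512 * H) ^ 2 ≤ γ ^ 2 := by
        rw [← sq_abs γ]
        gcongr
      have hγ2 : 0 < γ ^ 2 := by positivity
      have h8 : 4 / (1 / H * γ ^ 2) ≤ 1 / 64 * ((512 * H) / ((512 * H) ^ 2 + γ ^ 2)) := by
        rw [one_div_mul_eq_div, div_div_eq_mul_div, one_div_mul_eq_div, div_div,
          div_le_div_iff₀ (by positivity) (by positivity)]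
        nlinarith [mul_nonneg hH0.le (sub_nonneg.mpr h7)]
      nlinarith

/-- A twisted sum weighted by the tent function, normalised on the critical line. -/
noncomputable def tentSum (w : ℕ → ℝ) {N : ℕ} (χ : DirichletCharacter ℂ N) (η u : ℝ) : ℂ :=
  ∑' n : ℕ, χ n * (w n * (n : ℝ) ^ (-(1 / 2) : ℝ) * tent η (u - Real.log n) : ℝ)

/-- If every low-lying zero `1/2 + i γ` has `γ τ` close to `2 π ℤ`, the tent-weighted prime sum is
as negative as the density of zeros permits. -/
theorem GRH.exists_le_neg_re_tentSum (h : GRH) : ∃ C : ℝ, 0 < C ∧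
    ∀ (N : ℕ) [NeZero N] (χ : DirichletCharacter ℂ N), χ ≠ 1 → χ.IsPrimitive →
      ∀ H τ : ℝ, 4 ≤ H → 1 ≤ τ →
      (∀ γ : ℝ, zeroMult χ γ ≠ 0 → |γ| ≤ 512 * H → 1 / 2 ≤ Real.cos (τ * γ)) →
      1 / 128 * Real.log (N * H) - C ≤ -(tentSum ArithmeticFunction.vonMangoldt χ (1 / H) τ).re := by
  obtain ⟨C₁, hC₁, hE⟩ := h.explicit_formula
  obtain ⟨C₂, hC₂, hW⟩ := h.exists_hasSum_zeroMult_approx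
  refine ⟨C₁ + C₂ + Real.log 4 + Real.log 512, by positivity, fun N _ χ hχ hp H τ hH hτ hc => ?_⟩
  have hH0 : 0 < H := by linarith
  have hh : 0 < 1 / H := by positivity
  obtain ⟨S, hS, hSC⟩ := hE N χ hχ hp (1 / H) τ hh
    (by rw [div_le_div_iff₀ hH0 (by norm_num)]; linarith) hτ
  obtain ⟨W₁, hW₁, hb₁⟩ := hW N χ hχ hp (H / 4) (by linarith)
  obtain ⟨W₂, hW₂, hb₂⟩ := hW N χ hχ hp H (by linarith)
  obtain ⟨W₃, hW₃, hb₃⟩ := hW N χ hχ hp (512 * H) (by linarith)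
  have hSre := Complex.hasSum_re hS
  have hle := hasSum_le (fun γ => ?_) (((hW₁.mul_left (1 / 16)).sub (hW₂.mul_left (1 / 32))).sub
    (hW₃.mul_left (1 / 64))) hSre
  · have h1 : |(tentSum ArithmeticFunction.vonMangoldt χ (1 / H) τ + S).re| ≤ C₁ := (Complex.abs_re_le_norm _).trans hSC
    rw [Complex.add_re] at h1
    have h2 := (abs_le.mp h1).2
    have hN : (0 : ℝ) < N := by exact_mod_cast Nat.pos_of_ne_zero (NeZero.ne N)
    have e1 : Real.log (N * (H / 4)) = Real.log (N * H) - Real.log 4 := by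
      rw [← mul_div_assoc, Real.log_div (by positivity) (by norm_num)]
    have e2 : Real.log (N * (512 * H)) = Real.log (N * H) + Real.log 512 := by
      rw [mul_left_comm, mul_comm, Real.log_mul (by positivity) (by norm_num)]
    rw [e1] at hb₁
    rw [e2] at hb₃
    have h4 : 0 ≤ Real.log 4 := Real.log_nonneg (by norm_num)
    have h512 : 0 ≤ Real.log 512 := Real.log_nonneg (by norm_num)
    linarith [(abs_le.mp hb₁).1, (abs_le.mp hb₂).2, (abs_le.mp hb₃).2]
  · have e : ((zeroMult χ γ : ℂ) * (Complex.exp (τ * γ * I) * tentTransform (1 / H) (γ * I))).re =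
        zeroMult χ γ * (Real.cos (τ * γ) * fejerKernel (1 / H) γ) := by
      rw [tentTransform_mul_I hh, ← Complex.ofReal_natCast, Complex.re_ofReal_mul,
        Complex.re_mul_ofReal, ← Complex.ofReal_mul, Complex.exp_ofReal_mul_I_re]
    simp only [e]
    rcases Nat.eq_zero_or_pos (zeroMult χ γ) with h0 | h0
    · simp [h0]
    · have h1 := cos_mul_fejerKernel_ge hH (hc γ h0.ne')
      have h2 := mul_le_mul_of_nonneg_left h1 (Nat.cast_nonneg (α := ℝ) (zeroMult χ γ))
      linarith

lemma GRH.exists_card_zeros_le (h : GRH) : ∃ C : ℝ, 0 < C ∧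
    ∀ (N : ℕ) [NeZero N] (χ : DirichletCharacter ℂ N), χ ≠ 1 → χ.IsPrimitive →
      ∀ B : ℝ, 1 ≤ B → ∃ Z : Finset ℝ, (∀ γ, zeroMult χ γ ≠ 0 → |γ| ≤ B → γ ∈ Z) ∧
        (Z.card : ℝ) ≤ B * (Real.log (N * B) + C) := by
  obtain ⟨C₂, hC₂, hW⟩ := h.exists_hasSum_zeroMult_approx
  refine ⟨2 * C₂, by positivity, fun N _ χ hχ hp B hB => ?_⟩
  obtain ⟨W, hWs, hb⟩ := hW N χ hχ hp B hB
  have hB0 : 0 < B := by linarith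
  set f : ℝ → ℝ := fun γ => (zeroMult χ γ : ℝ) * (B / (B ^ 2 + γ ^ 2)) with hf
  have hf0 : ∀ γ, 0 ≤ f γ := fun γ => by positivity
  have hge : ∀ γ, zeroMult χ γ ≠ 0 → |γ| ≤ B → 1 / (2 * B) ≤ f γ := by
    intro γ hγ hγB
    have h1 : (1 : ℝ) ≤ zeroMult χ γ := by exact_mod_cast Nat.one_le_iff_ne_zero.mpr hγ
    have h2 : γ ^ 2 ≤ B ^ 2 := sq_le_sq' (by linarith [neg_abs_le γ]) ((le_abs_self γ).trans hγB)
    have h3 : 1 / (2 * B) ≤ B / (B ^ 2 + γ ^ 2) := by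
      rw [div_le_div_iff₀ (by positivity) (by positivity)]
      nlinarith
    calc 1 / (2 * B) ≤ 1 * (B / (B ^ 2 + γ ^ 2)) := by rwa [one_mul]
      _ ≤ f γ := mul_le_mul_of_nonneg_right h1 (by positivity)
  have hfin : {γ : ℝ | zeroMult χ γ ≠ 0 ∧ |γ| ≤ B}.Finite := by
    have := (hWs.summable.tendsto_cofinite_zero).eventually (gt_mem_nhds (show 0 < 1 / (2 * B) by positivity))
    refine (Filter.eventually_cofinite.mp this).subset fun γ hγ => ?_
    exact not_lt.mpr (hge γ hγ.1 hγ.2)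
  refine ⟨hfin.toFinset, fun γ h1 h2 => hfin.mem_toFinset.mpr ⟨h1, h2⟩, ?_⟩
  have h1 : ∑ γ ∈ hfin.toFinset, f γ ≤ W := sum_le_hasSum _ (fun γ _ => hf0 γ) hWs
  have h2 : hfin.toFinset.card • (1 / (2 * B)) ≤ ∑ γ ∈ hfin.toFinset, f γ :=
    Finset.card_nsmul_le_sum _ _ _ fun γ hγ => by
      have := hfin.mem_toFinset.mp hγ
      exact hge γ this.1 this.2
  rw [nsmul_eq_mul] at h2
  have h3 := (abs_le.mp hb).2
  have h4 : (hfin.toFinset.card : ℝ) * (1 / (2 * B)) ≤ Real.log (N * B) / 2 + C₂ := by linarith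
  rw [mul_one_div, div_le_iff₀ (by positivity)] at h4
  linarith

/-- The sum `∑_{k ≤ n} χ(k) w(k)`. -/
noncomputable def charSum {q : ℕ} (w : ℕ → ℝ) (χ : DirichletCharacter ℂ q) (n : ℕ) : ℂ :=
  ∑ k ∈ Finset.range (n + 1), χ k * w k

lemma conj_dirichletCharacter {q : ℕ} [NeZero q] (χ : DirichletCharacter ℂ q) {a : ZMod q}
    (ha : IsUnit a) : starRingEnd ℂ (χ a) = χ a⁻¹ := by
  have h1 : χ a⁻¹ * χ a = 1 := by rw [← map_mul, ZMod.inv_mul_of_unit a ha, map_one]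
  rw [starRingEnd_apply, MulChar.star_apply', MulChar.inv_apply_eq_inv']
  exact (eq_inv_of_mul_eq_one_left h1).symm

/-- Parseval's identity for Dirichlet characters. -/
lemma sum_norm_sq_dirichletCharacter {q : ℕ} [NeZero q] (g : ℕ → ℝ) :
    ∑ χ : DirichletCharacter ℂ q,
      ‖∑ a ∈ (Finset.range q).filter (fun a => Nat.Coprime a q), χ a * g a‖ ^ 2 =
    q.totient * ∑ a ∈ (Finset.range q).filter (fun a => Nat.Coprime a q), g a ^ 2 := by
  set R := (Finset.range q).filter (fun a => Nat.Coprime a q) with hR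
  have key : ∀ χ : DirichletCharacter ℂ q, ((‖∑ a ∈ R, χ a * g a‖ ^ 2 : ℝ) : ℂ) =
      ∑ b ∈ R, ∑ a ∈ R, g a * g b * (χ ((b : ZMod q))⁻¹ * χ a) := by
    intro χ
    rw [Complex.ofReal_pow, ← Complex.mul_conj', map_sum, Finset.sum_mul_sum, Finset.sum_comm]
    refine Finset.sum_congr rfl fun b hb => Finset.sum_congr rfl fun a _ => ?_
    rw [map_mul, Complex.conj_ofReal, conj_dirichletCharacter χ
      ((ZMod.isUnit_iff_coprime b q).mpr (Finset.mem_filter.mp hb).2)]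
    ring
  apply Complex.ofReal_injective
  rw [Complex.ofReal_sum]
  simp_rw [key]
  rw [Finset.sum_comm]
  push_cast
  rw [Finset.mul_sum]
  refine Finset.sum_congr rfl fun b hb => ?_
  have hb' := Finset.mem_filter.mp hb
  rw [Finset.sum_comm]
  simp_rw [← Finset.mul_sum]
  have hu : IsUnit (b : ZMod q) := (ZMod.isUnit_iff_coprime b q).mpr hb'.2
  simp_rw [DirichletCharacter.sum_char_inv_mul_char_eq ℂ hu]
  rw [Finset.sum_eq_single_of_mem b hb]
  · simp; ring
  · intro a ha hab
    have ha' := Finset.mem_filter.mp ha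
    rw [if_neg, mul_zero]
    intro h
    rw [ZMod.natCast_eq_natCast_iff'] at h
    rw [Nat.mod_eq_of_lt (Finset.mem_range.mp ha'.1),
      Nat.mod_eq_of_lt (Finset.mem_range.mp hb'.1)] at h
    exact hab h.symm

lemma sum_coprime_dirichletCharacter {q : ℕ} [NeZero q] (χ : DirichletCharacter ℂ q)
    (f : ℕ → ℂ) (n : ℕ) :
    ∑ a ∈ (Finset.range q).filter (fun a => Nat.Coprime a q),
      χ a * ∑ k ∈ (Finset.range n).filter (fun k => k % q = a), f k =
    ∑ k ∈ Finset.range n, χ k * f k := by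
  have h1 : ∑ k ∈ Finset.range n, χ k * f k =
      ∑ a ∈ Finset.range q, ∑ k ∈ (Finset.range n).filter (fun k => k % q = a), χ k * f k := by
    refine (Finset.sum_fiberwise_of_maps_to (fun k _ => ?_) _).symm
    exact Finset.mem_range.mpr (Nat.mod_lt _ (Nat.pos_of_ne_zero (NeZero.ne q)))
  rw [h1]
  have h2 : ∀ a ∈ Finset.range q, ∑ k ∈ (Finset.range n).filter (fun k => k % q = a), χ k * f k =
      χ a * ∑ k ∈ (Finset.range n).filter (fun k => k % q = a), f k := by
    intro a _
    rw [Finset.mul_sum]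
    refine Finset.sum_congr rfl fun k hk => ?_
    rw [← (Finset.mem_filter.mp hk).2, ZMod.natCast_mod]
  rw [Finset.sum_congr rfl h2]
  refine Finset.sum_subset (Finset.filter_subset _ _) fun a ha hna => ?_
  rw [χ.map_nonunit, zero_mul]
  rw [ZMod.isUnit_iff_coprime]
  exact fun h => hna (Finset.mem_filter.mpr ⟨ha, h⟩)

lemma sum_coprime_dirichletCharacter_eq_zero {q : ℕ} [NeZero q] {χ : DirichletCharacter ℂ q}
    (hχ : χ ≠ 1) :
    ∑ a ∈ (Finset.range q).filter (fun a => Nat.Coprime a q), χ a = 0 := by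
  rw [← MulChar.sum_eq_zero_of_ne_one hχ]
  have h1 : ∑ a ∈ (Finset.range q).filter (fun a => Nat.Coprime a q), χ a =
      ∑ a ∈ Finset.range q, χ a := by
    refine Finset.sum_subset (Finset.filter_subset _ _) fun a ha hna => ?_
    refine χ.map_nonunit ?_
    rw [ZMod.isUnit_iff_coprime]
    exact fun h => hna (Finset.mem_filter.mpr ⟨ha, h⟩)
  rw [h1]
  refine Finset.sum_bij (fun a _ => (a : ZMod q)) (fun _ _ => Finset.mem_univ _) ?_ ?_ ?_
  · intro a ha b hb h
    rw [ZMod.natCast_eq_natCast_iff', Nat.mod_eq_of_lt (Finset.mem_range.mp ha),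
      Nat.mod_eq_of_lt (Finset.mem_range.mp hb)] at h
    exact h
  · intro b _
    exact ⟨b.val, Finset.mem_range.mpr b.val_lt, ZMod.natCast_zmod_val b⟩
  · intros; rfl

/-- The variance in residue classes dominates the mean square over nonprincipal characters. -/
lemma sum_norm_sq_charSum_le {q : ℕ} [NeZero q] (w : ℕ → ℝ) (c : ℝ) (n : ℕ)
    (T : Finset (DirichletCharacter ℂ q)) (hT : (1 : DirichletCharacter ℂ q) ∉ T) :
    1 / (q.totient : ℝ) * ∑ χ ∈ T, ‖charSum w χ n‖ ^ 2 ≤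
    ∑ a ∈ (Finset.range q).filter (fun a => Nat.Coprime a q),
      (∑ k ∈ (Finset.range (n + 1)).filter (fun k => k % q = a), w k - c) ^ 2 := by
  have hφ : (0 : ℝ) < q.totient := by
    exact_mod_cast Nat.totient_pos.mpr (Nat.pos_of_ne_zero (NeZero.ne q))
  rw [one_div, inv_mul_le_iff₀ hφ, ← sum_norm_sq_dirichletCharacter]
  calc ∑ χ ∈ T, ‖charSum w χ n‖ ^ 2
      = ∑ χ ∈ T, ‖∑ a ∈ (Finset.range q).filter (fun a => Nat.Coprime a q), χ a *
        ((∑ k ∈ (Finset.range (n + 1)).filter (fun k => k % q = a), w k - c : ℝ) : ℂ)‖ ^ 2 := by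
        refine Finset.sum_congr rfl fun χ hχ => ?_
        have h1 : χ ≠ 1 := fun h => hT (h ▸ hχ)
        congr 2
        simp_rw [Complex.ofReal_sub, mul_sub]
        rw [Finset.sum_sub_distrib, ← Finset.sum_mul, sum_coprime_dirichletCharacter_eq_zero h1,
          zero_mul, sub_zero, charSum, ← sum_coprime_dirichletCharacter]
        push_cast
        rfl
    _ ≤ _ := Finset.sum_le_univ_sum_of_nonneg fun χ => by positivity

/-- The weight `log p` on primes. -/
noncomputable def primeLog (n : ℕ) : ℝ := if n.Prime then Real.log n else 0

lemma sum_norm_sq_charSum_le_Gvar {q : ℕ} [NeZero q] (n : ℕ)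
    (T : Finset (DirichletCharacter ℂ q)) (hT : (1 : DirichletCharacter ℂ q) ∉ T) :
    1 / (q.totient : ℝ) * ∑ χ ∈ T, ‖charSum primeLog χ n‖ ^ 2 ≤ Gvar n q := by
  refine (sum_norm_sq_charSum_le primeLog (n / q.totient) n T hT).trans (le_of_eq ?_)
  rw [Gvar]
  refine Finset.sum_congr rfl fun a _ => ?_
  rw [thetaQA, Nat.floor_natCast]
  congr 2
  simp only [primeLog]
  rw [← Finset.sum_filter, Finset.filter_filter]
  exact Finset.sum_congr (Finset.filter_congr fun p _ => and_comm) fun _ _ => rfl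

lemma sum_norm_sq_charSum_le_Vvar {q : ℕ} [NeZero q] (n : ℕ)
    (T : Finset (DirichletCharacter ℂ q)) (hT : (1 : DirichletCharacter ℂ q) ∉ T) :
    1 / (q.totient : ℝ) * ∑ χ ∈ T, ‖charSum ArithmeticFunction.vonMangoldt χ n‖ ^ 2 ≤
      Vvar n q := by
  refine (sum_norm_sq_charSum_le _ (1 / (q.totient : ℝ) *
    ∑ n ∈ (Finset.range (n + 1)).filter (fun n => Nat.Coprime n q),
      ArithmeticFunction.vonMangoldt n) n T hT).trans (le_of_eq ?_)
  rw [Vvar, Nat.floor_natCast]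

/-- Summation by parts combined with the Cauchy-Schwarz inequality: a weighted mean square of
smoothed sums is controlled by the mean square of sharp partial sums at a single point. -/
lemma exists_sum_norm_sq_le {ι : Type*} (s : Finset ι) (v : ι → ℝ) (hv : ∀ i ∈ s, 0 ≤ v i)
    (a : ι → ℕ → ℂ) (f : ℕ → ℝ) (M : ℕ) (hM : f M = 0) (W : Finset ℕ) (hW : W.Nonempty)
    (hWf : ∀ n, f n - f (n + 1) ≠ 0 → n ∈ W) {V : ℝ}
    (hV : ∑ n ∈ W, |f n - f (n + 1)| ≤ V) :
    ∃ n ∈ W, ∑ i ∈ s, v i * ‖∑ k ∈ Finset.range (M + 1), a i k * f k‖ ^ 2 ≤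
      V ^ 2 * ∑ i ∈ s, v i * ‖∑ k ∈ Finset.range (n + 1), a i k‖ ^ 2 := by
  obtain ⟨n, hn, hmax⟩ := W.exists_max_image
    (fun n => ∑ i ∈ s, v i * ‖∑ k ∈ Finset.range (n + 1), a i k‖ ^ 2) hW
  refine ⟨n, hn, ?_⟩
  have hV0 : 0 ≤ V := (Finset.sum_nonneg fun n _ => abs_nonneg _).trans hV
  have habel : ∀ i, ∑ k ∈ Finset.range (M + 1), a i k * f k =
      ∑ m ∈ Finset.range M, ((f m - f (m + 1) : ℝ) : ℂ) * ∑ k ∈ Finset.range (m + 1), a i k := by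
    intro i
    have h1 := Finset.sum_range_by_parts (fun k => (f k : ℂ)) (a i) (M + 1)
    simp only [smul_eq_mul, Nat.add_sub_cancel, hM, Complex.ofReal_zero, zero_mul, zero_sub] at h1
    rw [Finset.sum_congr rfl fun k _ => mul_comm (a i k) (f k : ℂ), h1, ← Finset.sum_neg_distrib]
    refine Finset.sum_congr rfl fun m _ => ?_
    push_cast
    ring
  have hbound : ∀ i, ‖∑ k ∈ Finset.range (M + 1), a i k * f k‖ ^ 2 ≤
      V * ∑ m ∈ W, |f m - f (m + 1)| * ‖∑ k ∈ Finset.range (m + 1), a i k‖ ^ 2 := by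
    intro i
    have h1 : ‖∑ k ∈ Finset.range (M + 1), a i k * f k‖ ≤
        ∑ m ∈ W, |f m - f (m + 1)| * ‖∑ k ∈ Finset.range (m + 1), a i k‖ := by
      rw [habel]
      have h2 : ∑ m ∈ Finset.range M,
          ((f m - f (m + 1) : ℝ) : ℂ) * ∑ k ∈ Finset.range (m + 1), a i k =
          ∑ m ∈ (Finset.range M).filter (fun m => m ∈ W),
          ((f m - f (m + 1) : ℝ) : ℂ) * ∑ k ∈ Finset.range (m + 1), a i k := by
        refine (Finset.sum_filter_of_ne fun m _ hm => hWf m fun h0 => hm ?_).symm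
        rw [h0, Complex.ofReal_zero, zero_mul]
      rw [h2]
      refine (norm_sum_le _ _).trans ?_
      simp_rw [norm_mul, Complex.norm_real, Real.norm_eq_abs]
      exact Finset.sum_le_sum_of_subset_of_nonneg
        (fun m hm => (Finset.mem_filter.mp hm).2) fun m _ _ => by positivity
    refine (pow_le_pow_left₀ (norm_nonneg _) h1 2).trans ?_
    have h3 := Finset.sum_mul_sq_le_sq_mul_sq W (fun m => Real.sqrt |f m - f (m + 1)|)
      (fun m => Real.sqrt |f m - f (m + 1)| * ‖∑ k ∈ Finset.range (m + 1), a i k‖)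
    simp only [← mul_assoc, Real.mul_self_sqrt (abs_nonneg _), Real.sq_sqrt (abs_nonneg _),
      mul_pow] at h3
    exact h3.trans (mul_le_mul_of_nonneg_right hV (Finset.sum_nonneg fun m _ => by positivity))
  calc ∑ i ∈ s, v i * ‖∑ k ∈ Finset.range (M + 1), a i k * f k‖ ^ 2
      ≤ ∑ i ∈ s, v i * (V * ∑ m ∈ W, |f m - f (m + 1)| *
          ‖∑ k ∈ Finset.range (m + 1), a i k‖ ^ 2) :=
        Finset.sum_le_sum fun i hi => mul_le_mul_of_nonneg_left (hbound i) (hv i hi)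
    _ = V * ∑ m ∈ W, |f m - f (m + 1)| *
          ∑ i ∈ s, v i * ‖∑ k ∈ Finset.range (m + 1), a i k‖ ^ 2 := by
        simp_rw [Finset.mul_sum]
        rw [Finset.sum_comm]
        refine Finset.sum_congr rfl fun m _ => Finset.sum_congr rfl fun i _ => ?_
        ring
    _ ≤ V * ∑ m ∈ W, |f m - f (m + 1)| *
          ∑ i ∈ s, v i * ‖∑ k ∈ Finset.range (n + 1), a i k‖ ^ 2 :=
        mul_le_mul_of_nonneg_left (Finset.sum_le_sum fun m hm =>
          mul_le_mul_of_nonneg_left (hmax m hm) (abs_nonneg _)) hV0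
    _ ≤ V * (V * ∑ i ∈ s, v i * ‖∑ k ∈ Finset.range (n + 1), a i k‖ ^ 2) := by
        rw [← Finset.sum_mul]
        refine mul_le_mul_of_nonneg_left (mul_le_mul_of_nonneg_right hV ?_) hV0
        exact Finset.sum_nonneg fun i hi => mul_nonneg (hv i hi) (by positivity)
    _ = _ := by ring

/-- The tent weight `n^{-1/2} g(u - log n)`. -/
noncomputable def tentWeight (η u : ℝ) (n : ℕ) : ℝ :=
  (n : ℝ) ^ (-(1 / 2) : ℝ) * tent η (u - Real.log n)

lemma abs_tent_sub_tent_le {η : ℝ} (hη : 0 < η) (v w : ℝ) :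
    |tent η v - tent η w| ≤ |v - w| / η := by
  unfold tent
  refine (abs_max_sub_max_le_max _ _ _ _).trans ?_
  rw [sub_self, abs_zero, max_eq_right (abs_nonneg _)]
  rw [show 1 - |v| / η - (1 - |w| / η) = -((|v| - |w|) / η) by ring, abs_neg, abs_div,
    abs_of_pos hη]
  exact div_le_div_of_nonneg_right (abs_abs_sub_abs_le _ _) hη.le

lemma abs_tentWeight_sub_le {η u : ℝ} (hη : 0 < η) (hη2 : η ≤ 1 / 2) {n : ℕ} (hn : 0 < n) :
    |tentWeight η u n - tentWeight η u (n + 1)| ≤ 2 / η * (n : ℝ) ^ (-(3 / 2) : ℝ) := by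
  have hn0 : (0 : ℝ) < n := by exact_mod_cast hn
  have hn1 : (0 : ℝ) < (n : ℝ) + 1 := by linarith
  set r := (n : ℝ) ^ (-(1 / 2) : ℝ) with hr
  set r' := ((n : ℝ) + 1) ^ (-(1 / 2) : ℝ) with hr'
  have hr0 : 0 < r := Real.rpow_pos_of_pos hn0 _
  have hr0' : 0 < r' := Real.rpow_pos_of_pos hn1 _
  have hrn : (n : ℝ) ^ (-(3 / 2) : ℝ) = r * (n : ℝ)⁻¹ := by
    rw [hr, ← Real.rpow_neg_one (n : ℝ), ← Real.rpow_add hn0]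
    norm_num
  have hlog : |Real.log (n + 1) - Real.log n| ≤ (n : ℝ)⁻¹ := by
    rw [abs_of_nonneg (by linarith [Real.log_le_log hn0 (by linarith : (n : ℝ) ≤ n + 1)]),
      ← Real.log_div hn1.ne' hn0.ne']
    refine (Real.log_le_sub_one_of_pos (by positivity)).trans (le_of_eq ?_)
    field_simp
    ring
  have hmono : r' ≤ r := Real.rpow_le_rpow_of_nonpos hn0 (by linarith) (by norm_num)
  have hdiff : r - r' ≤ r * (n : ℝ)⁻¹ := by
    have h1 : r * (n / (n + 1) : ℝ) ≤ r' := by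
      have e : r' = r * (n / (n + 1) : ℝ) ^ (1 / 2 : ℝ) := by
        rw [hr, hr', Real.div_rpow hn0.le hn1.le, Real.rpow_neg hn0.le, Real.rpow_neg hn1.le]
        have := (Real.rpow_pos_of_pos hn0 (1 / 2)).ne'
        field_simp
      rw [e]
      refine mul_le_mul_of_nonneg_left ?_ hr0.le
      exact Real.self_le_rpow_of_le_one (by positivity) (by rw [div_le_one hn1]; linarith)
        (by norm_num)
    have h2 : r - r * (n / (n + 1) : ℝ) ≤ r * (n : ℝ)⁻¹ := by
      rw [← mul_one_sub]
      refine mul_le_mul_of_nonneg_left ?_ hr0.le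
      rw [show 1 - (n / (n + 1) : ℝ) = ((n : ℝ) + 1)⁻¹ by field_simp; ring]
      exact inv_anti₀ hn0 (by linarith)
    linarith
  have ht := abs_tent_sub_tent_le hη (u - Real.log n) (u - Real.log (n + 1))
  have ht1 := tent_le_one hη (u - Real.log (n + 1))
  have ht0 := tent_nonneg η (u - Real.log (n + 1))
  have e : tentWeight η u n - tentWeight η u (n + 1) =
      r * (tent η (u - Real.log n) - tent η (u - Real.log (n + 1))) +
        (r - r') * tent η (u - Real.log (n + 1)) := by
    simp only [tentWeight, Nat.cast_add, Nat.cast_one]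
    ring
  rw [e, hrn]
  refine (abs_add_le _ _).trans ?_
  rw [abs_mul, abs_mul, abs_of_pos hr0, abs_of_nonneg (sub_nonneg.mpr hmono), abs_of_nonneg ht0]
  have h3 : |tent η (u - Real.log n) - tent η (u - Real.log (n + 1))| ≤ (n : ℝ)⁻¹ / η := by
    refine ht.trans (div_le_div_of_nonneg_right ?_ hη.le)
    rw [show u - Real.log n - (u - Real.log (n + 1)) = Real.log (n + 1) - Real.log n by ring]
    exact hlog
  have h4 : 1 ≤ 1 / η := by rw [le_div_iff₀ hη]; linarith
  calc r * |tent η (u - Real.log n) - tent η (u - Real.log (n + 1))| +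
        (r - r') * tent η (u - Real.log (n + 1))
      ≤ r * ((n : ℝ)⁻¹ / η) + r * (n : ℝ)⁻¹ * 1 :=
        add_le_add (mul_le_mul_of_nonneg_left h3 hr0.le)
          (mul_le_mul hdiff ht1 ht0 (by positivity))
    _ ≤ r * ((n : ℝ)⁻¹ / η) + r * (n : ℝ)⁻¹ * (1 / η) := by gcongr
    _ = _ := by ring

lemma tentWeight_zero (η u : ℝ) : tentWeight η u 0 = 0 := by
  rw [tentWeight, Nat.cast_zero, Real.zero_rpow (by norm_num), zero_mul]

lemma exp_lt_of_tentWeight_ne_zero {η u : ℝ} (hη : 0 < η) {n : ℕ} (hn : tentWeight η u n ≠ 0) :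
    Real.exp (u - η) < n ∧ (n : ℝ) < Real.exp (u + η) := by
  have hn0 : (0 : ℝ) < n := by
    refine Nat.cast_pos.mpr (Nat.pos_of_ne_zero fun h => hn ?_)
    rw [h, tentWeight_zero]
  have h1 : |u - Real.log n| < η := by
    by_contra h
    exact hn (by rw [tentWeight, tent_eq_zero hη (not_lt.mp h), mul_zero])
  rw [abs_lt] at h1
  exact ⟨(Real.lt_log_iff_exp_lt hn0).mp (by linarith), (Real.log_lt_iff_lt_exp hn0).mp (by linarith)⟩

lemma exp_sub_exp_neg_le {η : ℝ} (hη : 0 < η) (hη2 : η ≤ 1 / 2) :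
    Real.exp η - Real.exp (-η) ≤ 3 * η := by
  have h1 := Real.abs_exp_sub_one_sub_id_le (x := η) (by rw [abs_of_pos hη]; linarith)
  have h2 := Real.add_one_le_exp (-η)
  have h3 := (abs_le.mp h1).2
  nlinarith

lemma exists_tentWeight_window {η u : ℝ} (hη : 0 < η) (hη2 : η ≤ 1 / 2) (hu : 2 ≤ u)
    (hηu : 1 ≤ η * Real.exp u) :
    ∃ W : Finset ℕ, W.Nonempty ∧
      (∀ n, tentWeight η u n - tentWeight η u (n + 1) ≠ 0 → n ∈ W) ∧
      (∀ n ∈ W, Real.exp (u - 1) ≤ n ∧ (n : ℝ) ≤ Real.exp (u + 1)) ∧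
      ∑ n ∈ W, |tentWeight η u n - tentWeight η u (n + 1)| ≤
        10 * Real.exp (3 / 2) * Real.exp (-u / 2) := by
  set a := Real.exp (u - η) - 1 with ha
  set b := Real.exp (u + η) with hb
  have hlow : Real.exp (u - 1) ≤ a := by
    have h1 : Real.exp (u - 1 / 2) ≤ Real.exp (u - η) := Real.exp_le_exp.mpr (by linarith)
    have h2 : Real.exp (u - 1 / 2) = Real.exp (u - 1) * Real.exp (1 / 2) := by
      rw [← Real.exp_add]; ring_nf
    have h3 := Real.add_one_le_exp (1 / 2 : ℝ)
    have h4 := Real.add_one_le_exp (u - 1)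
    nlinarith
  have hlow0 := Real.exp_pos (u - 1)
  have hab : a + 1 ≤ b := by
    rw [ha, hb, sub_add_cancel]
    exact Real.exp_le_exp.mpr (by linarith)
  have hb0 : 0 < b := Real.exp_pos _
  have hceil : ⌈a⌉₊ ≤ ⌊b⌋₊ :=
    Nat.le_floor ((Nat.ceil_lt_add_one (by linarith : 0 ≤ a)).le.trans hab)
  have hwin : ∀ n ∈ Finset.Icc ⌈a⌉₊ ⌊b⌋₊, Real.exp (u - 1) ≤ n ∧ (n : ℝ) ≤ Real.exp (u + 1) := by
    intro n hn
    obtain ⟨h1, h2⟩ := Finset.mem_Icc.mp hn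
    refine ⟨hlow.trans ((Nat.le_ceil a).trans (by exact_mod_cast h1)), ?_⟩
    have : (n : ℝ) ≤ b := (Nat.cast_le.mpr h2).trans (Nat.floor_le hb0.le)
    exact this.trans (Real.exp_le_exp.mpr (by linarith))
  refine ⟨Finset.Icc ⌈a⌉₊ ⌊b⌋₊, Finset.nonempty_Icc.mpr hceil, fun n hn => ?_, hwin, ?_⟩
  · rw [Finset.mem_Icc]
    by_cases h0 : tentWeight η u n = 0
    · have h1 : tentWeight η u (n + 1) ≠ 0 := fun h => hn (by rw [h0, h, sub_zero])
      obtain ⟨h2, h3⟩ := exp_lt_of_tentWeight_ne_zero hη h1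
      push_cast at h2 h3
      exact ⟨Nat.ceil_le.mpr (by linarith), Nat.le_floor (by linarith)⟩
    · obtain ⟨h2, h3⟩ := exp_lt_of_tentWeight_ne_zero hη h0
      exact ⟨Nat.ceil_le.mpr (by linarith), Nat.le_floor (by linarith)⟩
  · have hterm : ∀ n ∈ Finset.Icc ⌈a⌉₊ ⌊b⌋₊, |tentWeight η u n - tentWeight η u (n + 1)| ≤
        2 / η * Real.exp (-(3 / 2) * (u - 1)) := by
      intro n hn
      have h1 := (hwin n hn).1
      have hn0 : 0 < n := by exact_mod_cast hlow0.trans_le h1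
      refine (abs_tentWeight_sub_le hη hη2 hn0).trans ?_
      refine mul_le_mul_of_nonneg_left ?_ (by positivity)
      have h2 := Real.rpow_le_rpow_of_nonpos hlow0 h1 (by norm_num : (-(3 / 2) : ℝ) ≤ 0)
      rw [← Real.exp_mul] at h2
      exact h2.trans (Real.exp_le_exp.mpr (by linarith))
    have hcard : ((Finset.Icc ⌈a⌉₊ ⌊b⌋₊).card : ℝ) ≤ 5 * η * Real.exp u := by
      rw [Nat.card_Icc, Nat.cast_sub (by omega)]
      push_cast
      have h1 := Nat.floor_le hb0.le
      have h2 := Nat.le_ceil a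
      have h3 : b - Real.exp (u - η) ≤ Real.exp u * (3 * η) := by
        rw [hb, Real.exp_add, sub_eq_add_neg u, Real.exp_add, ← mul_sub]
        exact mul_le_mul_of_nonneg_left (exp_sub_exp_neg_le hη hη2) (Real.exp_pos _).le
      rw [ha] at h2
      linarith
    have h1 := Finset.sum_le_card_nsmul _ _ _ hterm
    rw [nsmul_eq_mul] at h1
    refine h1.trans ((mul_le_mul_of_nonneg_right hcard (by positivity)).trans (le_of_eq ?_))
    have e : Real.exp (-(3 / 2) * (u - 1)) =
        Real.exp (3 / 2) * Real.exp (-u / 2) * (Real.exp u)⁻¹ := by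
      rw [← Real.exp_neg, ← Real.exp_add, ← Real.exp_add]; ring_nf
    rw [e]
    have := Real.exp_pos u
    field_simp
    norm_num

lemma tentSum_eq_sum (w : ℕ → ℝ) {N : ℕ} (χ : DirichletCharacter ℂ N) {η u : ℝ} (hη : 0 < η)
    {M : ℕ} (hM : Real.exp (u + η) ≤ M) :
    tentSum w χ η u = ∑ k ∈ Finset.range (M + 1), χ k * w k * tentWeight η u k := by
  rw [tentSum, tsum_eq_sum (s := Finset.range (M + 1))]
  · refine Finset.sum_congr rfl fun k _ => ?_
    rw [tentWeight]
    push_cast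
    ring
  · intro k hk
    have h0 : tentWeight η u k = 0 := by
      by_contra h
      have h1 := (exp_lt_of_tentWeight_ne_zero hη h).2
      have h2 : (k : ℝ) < M := by linarith
      exact hk (Finset.mem_range.mpr (by have := Nat.cast_lt.mp h2; omega))
    rw [tentWeight] at h0
    rw [mul_assoc, h0, mul_zero, Complex.ofReal_zero, mul_zero]

lemma exists_sum_norm_sq_tentSum_le : ∃ c : ℝ, 0 < c ∧ ∀ η u : ℝ, 0 < η → η ≤ 1 / 2 → 2 ≤ u →
    1 ≤ η * Real.exp u → ∀ (w : ℕ → ℝ) (s : Finset (Σ q : ℕ, DirichletCharacter ℂ q))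
      (v : (Σ q : ℕ, DirichletCharacter ℂ q) → ℝ), (∀ i ∈ s, 0 ≤ v i) →
      ∃ n : ℕ, Real.exp (u - 1) ≤ n ∧ (n : ℝ) ≤ Real.exp (u + 1) ∧
        c * n * ∑ i ∈ s, v i * ‖tentSum w i.2 η u‖ ^ 2 ≤
          ∑ i ∈ s, v i * ‖charSum w i.2 n‖ ^ 2 := by
  set K : ℝ := 10 * Real.exp (3 / 2) with hK
  have hK0 : 0 < K := by positivity
  refine ⟨(K ^ 2 * Real.exp 1)⁻¹, by positivity, fun η u hη hη2 hu hηu w s v hv => ?_⟩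
  obtain ⟨W, hW, hWf, hwin, hV⟩ := exists_tentWeight_window hη hη2 hu hηu
  set M := ⌈Real.exp (u + η)⌉₊ with hM
  have hM0 : tentWeight η u M = 0 := by
    by_contra h
    exact absurd (exp_lt_of_tentWeight_ne_zero hη h).2 (not_lt.mpr (Nat.le_ceil _))
  obtain ⟨n, hn, hle⟩ := exists_sum_norm_sq_le s v hv (fun i k => i.2 k * w k) (tentWeight η u) M
    hM0 W hW hWf hV
  refine ⟨n, (hwin n hn).1, (hwin n hn).2, ?_⟩
  have hS : ∀ i : (Σ q : ℕ, DirichletCharacter ℂ q), ∑ k ∈ Finset.range (M + 1),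
      i.2 k * w k * tentWeight η u k = tentSum w i.2 η u := fun i =>
    (tentSum_eq_sum w i.2 hη (Nat.le_ceil (Real.exp (u + η)))).symm
  simp only [hS] at hle
  rw [mul_pow, ← Real.exp_nat_mul] at hle
  have h1 := (hwin n hn).2
  have hX : 0 ≤ ∑ i ∈ s, v i * ‖tentSum w i.2 η u‖ ^ 2 :=
    Finset.sum_nonneg fun i hi => mul_nonneg (hv i hi) (by positivity)
  have e : Real.exp (u + 1) * Real.exp ((2 : ℕ) * (-u / 2)) = Real.exp 1 := by
    rw [← Real.exp_add]; congr 1; push_cast; ring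
  rw [mul_assoc, inv_mul_le_iff₀ (by positivity)]
  calc n * ∑ i ∈ s, v i * ‖tentSum w i.2 η u‖ ^ 2
      ≤ Real.exp (u + 1) * (K ^ 2 * Real.exp ((2 : ℕ) * (-u / 2)) *
          ∑ i ∈ s, v i * ‖charSum w i.2 n‖ ^ 2) :=
        mul_le_mul h1 hle hX (Real.exp_pos _).le
    _ = K ^ 2 * (Real.exp (u + 1) * Real.exp ((2 : ℕ) * (-u / 2))) *
          ∑ i ∈ s, v i * ‖charSum w i.2 n‖ ^ 2 := by ring
    _ = _ := by rw [e]

lemma primeLog_nonneg (n : ℕ) : 0 ≤ primeLog n := by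
  unfold primeLog
  split_ifs
  · exact Real.log_natCast_nonneg n
  · exact le_rfl

lemma primeLog_le_vonMangoldt (n : ℕ) : primeLog n ≤ ArithmeticFunction.vonMangoldt n := by
  unfold primeLog
  split_ifs with h
  · exact (ArithmeticFunction.vonMangoldt_apply_prime h).ge
  · exact ArithmeticFunction.vonMangoldt_nonneg

lemma exists_sum_vonMangoldt_sub_primeLog_le : ∃ C : ℝ, 0 < C ∧ ∀ M : ℕ,
    ∑ k ∈ Finset.range (M + 1), (ArithmeticFunction.vonMangoldt k - primeLog k) ≤
      C * Real.sqrt M := by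
  obtain ⟨C, hC⟩ := Chebyshev.psi_sub_theta_le_mul_sqrt
  refine ⟨max C 1, by positivity, fun M => ?_⟩
  have h := hC M
  rw [Chebyshev.psi_eq_sum_Icc, Chebyshev.theta_eq_sum_Icc, Nat.floor_natCast,
    Finset.sum_filter, ← Finset.sum_sub_distrib] at h
  have hI : Finset.range (M + 1) = Finset.Icc 0 M := by
    ext; simp
  rw [hI]
  exact h.trans (mul_le_mul_of_nonneg_right (le_max_left _ _) (Real.sqrt_nonneg _))

lemma norm_sum_dirichletCharacter_sub_le {q : ℕ} (χ : DirichletCharacter ℂ q) {K : ℝ}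
    {f w v : ℕ → ℝ} (hf : ∀ k, 0 ≤ f k) (hfK : ∀ k, f k ≤ K) (hw : ∀ k, primeLog k ≤ w k)
    (hwv : ∀ k, w k ≤ ArithmeticFunction.vonMangoldt k) (hv : ∀ k, primeLog k ≤ v k)
    (hvv : ∀ k, v k ≤ ArithmeticFunction.vonMangoldt k) (M : ℕ) :
    ‖∑ k ∈ Finset.range (M + 1), χ k * w k * f k - ∑ k ∈ Finset.range (M + 1), χ k * v k * f k‖ ≤
      K * ∑ k ∈ Finset.range (M + 1), (ArithmeticFunction.vonMangoldt k - primeLog k) := by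
  rw [← Finset.sum_sub_distrib, Finset.mul_sum]
  refine norm_sum_le_of_le _ fun k _ => ?_
  rw [← sub_mul, ← mul_sub, norm_mul, norm_mul, ← Complex.ofReal_sub, Complex.norm_real,
    Complex.norm_real, Real.norm_eq_abs, Real.norm_eq_abs, abs_of_nonneg (hf k), mul_comm K]
  have h1 : |w k - v k| ≤ ArithmeticFunction.vonMangoldt k - primeLog k := by
    rw [abs_le]
    constructor <;> linarith [hw k, hwv k, hv k, hvv k]
  refine mul_le_mul ?_ (hfK k) (hf k) ((abs_nonneg _).trans h1)
  calc ‖χ k‖ * |w k - v k| ≤ 1 * |w k - v k| :=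
        mul_le_mul_of_nonneg_right (χ.norm_le_one _) (abs_nonneg _)
    _ ≤ _ := by rwa [one_mul]

lemma sum_primeLog_dvd_le {q : ℕ} (hq : q ≠ 0) (M : ℕ) :
    ∑ k ∈ (Finset.range M).filter (fun k => k.Prime ∧ k ∣ q), primeLog k ≤ Real.log q := by
  have h1 : ∑ k ∈ (Finset.range M).filter (fun k => k.Prime ∧ k ∣ q), primeLog k ≤
      ∑ k ∈ q.primeFactors, primeLog k := by
    refine Finset.sum_le_sum_of_subset_of_nonneg (fun k hk => ?_) fun k _ _ => primeLog_nonneg k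
    have := (Finset.mem_filter.mp hk).2
    exact Nat.mem_primeFactors.mpr ⟨this.1, this.2, hq⟩
  refine h1.trans ?_
  have h2 : ∑ k ∈ q.primeFactors, primeLog k = ∑ k ∈ q.primeFactors, Real.log k :=
    Finset.sum_congr rfl fun k hk => if_pos (Nat.prime_of_mem_primeFactors hk)
  rw [h2, ← Real.log_prod fun k hk =>
    Nat.cast_ne_zero.mpr (Nat.prime_of_mem_primeFactors hk).ne_zero, ← Nat.cast_prod]
  refine Real.log_le_log ?_ (Nat.cast_le.mpr
    (Nat.le_of_dvd (Nat.pos_of_ne_zero hq) (Nat.prod_primeFactors_dvd q)))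
  exact Nat.cast_pos.mpr (Finset.prod_pos fun k hk => (Nat.prime_of_mem_primeFactors hk).pos)

lemma changeLevel_natCast {d q : ℕ} (h : d ∣ q) (ψ : DirichletCharacter ℂ d) {k : ℕ}
    (hk : Nat.Coprime k q) : DirichletCharacter.changeLevel h ψ k = ψ k := by
  have := DirichletCharacter.changeLevel_eq_cast_of_dvd' ψ h (a := k)
    (Nat.isCoprime_iff_coprime.mpr hk)
  simpa using this

lemma norm_sum_changeLevel_sub_le {d q : ℕ} (hq : q ≠ 0) (h : d ∣ q) (ψ : DirichletCharacter ℂ d)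
    {K : ℝ} {f : ℕ → ℝ} (hf : ∀ k, 0 ≤ f k) (hfK : ∀ k, f k ≤ K) (M : ℕ) :
    ‖∑ k ∈ Finset.range M, DirichletCharacter.changeLevel h ψ k * primeLog k * f k -
      ∑ k ∈ Finset.range M, ψ k * primeLog k * f k‖ ≤ K * Real.log q := by
  have hK : 0 ≤ K := (hf 0).trans (hfK 0)
  refine le_trans ?_ (mul_le_mul_of_nonneg_left (sum_primeLog_dvd_le hq M) hK)
  rw [← Finset.sum_sub_distrib, Finset.mul_sum, Finset.sum_filter]
  refine norm_sum_le_of_le _ fun k _ => ?_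
  rw [← sub_mul, ← sub_mul, norm_mul, norm_mul, Complex.norm_real, Complex.norm_real,
    Real.norm_eq_abs, Real.norm_eq_abs, abs_of_nonneg (hf k), abs_of_nonneg (primeLog_nonneg k)]
  split_ifs with hk
  · have h0 : DirichletCharacter.changeLevel h ψ k = 0 := by
      refine MulChar.map_nonunit _ fun hu => ?_
      rw [ZMod.isUnit_iff_coprime] at hu
      exact hk.1.one_lt.ne' (Nat.Coprime.eq_one_of_dvd hu hk.2)
    rw [h0, zero_sub, norm_neg, mul_comm K]
    refine mul_le_mul ?_ (hfK k) (hf k) (primeLog_nonneg k)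
    exact mul_le_of_le_one_left (primeLog_nonneg k) (ψ.norm_le_one _)
  · by_cases hp : k.Prime
    · rw [changeLevel_natCast h ψ ((Nat.Prime.coprime_iff_not_dvd hp).mpr fun hd => hk ⟨hp, hd⟩),
        sub_self, norm_zero, zero_mul, zero_mul]
    · rw [primeLog, if_neg hp, mul_zero, zero_mul]

lemma tentWeight_nonneg {η : ℝ} (u : ℝ) (n : ℕ) : 0 ≤ tentWeight η u n :=
  mul_nonneg (Real.rpow_nonneg (Nat.cast_nonneg n) _) (tent_nonneg _ _)

lemma tentWeight_le {η u : ℝ} (hη : 0 < η) (hη2 : η ≤ 1 / 2) (n : ℕ) :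
    tentWeight η u n ≤ Real.exp (-(u - 1) / 2) := by
  by_cases h0 : tentWeight η u n = 0
  · rw [h0]; positivity
  · have h1 := (exp_lt_of_tentWeight_ne_zero hη h0).1
    have h2 : Real.exp (u - 1) ≤ n :=
      (Real.exp_le_exp.mpr (by linarith)).trans h1.le
    have h3 := Real.rpow_le_rpow_of_nonpos (Real.exp_pos _) h2 (by norm_num : (-(1 / 2) : ℝ) ≤ 0)
    rw [← Real.exp_mul] at h3
    calc tentWeight η u n ≤ (n : ℝ) ^ (-(1 / 2) : ℝ) * 1 :=
          mul_le_mul_of_nonneg_left (tent_le_one hη _) (Real.rpow_nonneg (Nat.cast_nonneg n) _)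
      _ ≤ _ := by
        rw [mul_one]
        exact h3.trans (Real.exp_le_exp.mpr (by linarith))

/-- Passing from a character to one inducing it, and from prime powers to primes, changes
`tentSum` by a bounded amount. -/
lemma exists_norm_tentSum_sub_le : ∃ C : ℝ, 0 < C ∧ ∀ (d q : ℕ) (h : d ∣ q)
    (ψ : DirichletCharacter ℂ d) (w : ℕ → ℝ) (η u : ℝ), q ≠ 0 → 0 < η → η ≤ 1 / 2 → 0 ≤ u →
    Real.log q ≤ Real.exp ((u - 1) / 2) → (∀ k, primeLog k ≤ w k) →
    (∀ k, w k ≤ ArithmeticFunction.vonMangoldt k) →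
    ‖tentSum w (DirichletCharacter.changeLevel h ψ) η u -
      tentSum (fun n => ArithmeticFunction.vonMangoldt n) ψ η u‖ ≤ C := by
  obtain ⟨C, hC0, hC⟩ := exists_sum_vonMangoldt_sub_primeLog_le
  refine ⟨2 * (C * (2 * Real.exp 1)) + 1, by positivity,
    fun d q h ψ w η u hq hη hη2 hu hlog hw hwv => ?_⟩
  set M := ⌈Real.exp (u + η)⌉₊ with hM
  have hMle := Nat.le_ceil (Real.exp (u + η))
  rw [tentSum_eq_sum w _ hη hMle, tentSum_eq_sum _ ψ hη hMle]
  set K := Real.exp (-(u - 1) / 2) with hK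
  have hf := tentWeight_nonneg (η := η) u
  have hfK := fun n => tentWeight_le (u := u) hη hη2 n
  have hE : K * ∑ k ∈ Finset.range (M + 1), (ArithmeticFunction.vonMangoldt k - primeLog k) ≤
      C * (2 * Real.exp 1) := by
    have h1 : (M : ℝ) ≤ 4 * Real.exp (u + 1) := by
      have h2 := Nat.ceil_lt_add_one (Real.exp_pos (u + η)).le
      have h3 : Real.exp (u + η) ≤ Real.exp (u + 1) := Real.exp_le_exp.mpr (by linarith)
      have h4 : 1 ≤ Real.exp (u + 1) := Real.one_le_exp (by linarith)
      linarith
    have h2 : Real.sqrt M ≤ 2 * Real.exp ((u + 1) / 2) := by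
      refine Real.sqrt_le_iff.mpr ⟨by positivity, h1.trans (le_of_eq ?_)⟩
      rw [mul_pow, ← Real.exp_nat_mul]
      push_cast
      ring_nf
    have h3 : K * Real.exp ((u + 1) / 2) = Real.exp 1 := by
      rw [hK, ← Real.exp_add]; ring_nf
    calc _ ≤ K * (C * (2 * Real.exp ((u + 1) / 2))) :=
          mul_le_mul_of_nonneg_left ((hC M).trans (mul_le_mul_of_nonneg_left h2 hC0.le))
            (Real.exp_pos _).le
      _ = C * (2 * (K * Real.exp ((u + 1) / 2))) := by ring
      _ = _ := by rw [h3]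
  have hpp : ∀ k, primeLog k ≤ primeLog k := fun k => le_rfl
  have hvv : ∀ k : ℕ, ArithmeticFunction.vonMangoldt k ≤ ArithmeticFunction.vonMangoldt k :=
    fun k => le_rfl
  have e1 := (norm_sum_dirichletCharacter_sub_le (DirichletCharacter.changeLevel h ψ) hf hfK
    hw hwv hpp primeLog_le_vonMangoldt M).trans hE
  have e2 := norm_sum_changeLevel_sub_le hq h ψ hf hfK (M + 1)
  have e3 := (norm_sum_dirichletCharacter_sub_le ψ hf hfK hpp primeLog_le_vonMangoldt
    primeLog_le_vonMangoldt hvv M).trans hE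
  have e4 : K * Real.log q ≤ 1 := by
    calc K * Real.log q ≤ K * Real.exp ((u - 1) / 2) :=
          mul_le_mul_of_nonneg_left hlog (Real.exp_pos _).le
      _ = 1 := by rw [hK, ← Real.exp_add, ← Real.exp_zero]; ring_nf
  have e5 := (norm_sub_le_norm_sub_add_norm_sub _ _ _).trans (add_le_add e1 (e2.trans e4))
  have e6 := (norm_sub_le_norm_sub_add_norm_sub _ _ _).trans (add_le_add e5 e3)
  refine e6.trans (by linarith)

lemma cos_ge_half_of_floor_fract_eq {x y : ℝ}
    (h : ⌊8 * Int.fract x⌋₊ = ⌊8 * Int.fract y⌋₊) :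
    1 / 2 ≤ Real.cos (2 * Real.pi * (x - y)) := by
  have hx := Int.fract_nonneg x
  have hy := Int.fract_nonneg y
  have hd : |Int.fract x - Int.fract y| ≤ 1 / 8 := by
    have h1 := Nat.floor_le (by positivity : 0 ≤ 8 * Int.fract x)
    have h2 := Nat.lt_floor_add_one (8 * Int.fract x)
    have h3 := Nat.floor_le (by positivity : 0 ≤ 8 * Int.fract y)
    have h4 := Nat.lt_floor_add_one (8 * Int.fract y)
    rw [h] at h1 h2
    rw [abs_le]
    constructor <;> linarith
  have e : 2 * Real.pi * (x - y) =
      2 * Real.pi * (Int.fract x - Int.fract y) + (⌊x⌋ - ⌊y⌋ : ℤ) * (2 * Real.pi) := by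
    have h1 := Int.floor_add_fract x
    have h2 := Int.floor_add_fract y
    push_cast
    linear_combination 2 * Real.pi * (h2 - h1)
  rw [e, Real.cos_add_int_mul_two_pi, ← Real.cos_abs, ← Real.cos_pi_div_three]
  have hpi := Real.pi_pos
  refine Real.cos_le_cos_of_nonneg_of_le_pi (abs_nonneg _) (by linarith) ?_
  rw [abs_mul, abs_of_pos (by positivity : 0 < 2 * Real.pi)]
  nlinarith

lemma exists_finset_half_le_cos (Z : Finset ℝ) (S : ℝ) {K R : ℕ} (h : 8 ^ Z.card * K < R) :
    ∃ J : Finset ℕ, K ≤ J.card ∧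
      ∀ j ∈ J, 1 ≤ j ∧ j < R ∧ ∀ γ ∈ Z, 1 / 2 ≤ Real.cos (j * S * γ) := by
  have hlt : ∀ x : ℝ, ⌊8 * Int.fract x⌋₊ < 8 := fun x => by
    rw [Nat.floor_lt (by have := Int.fract_nonneg x; positivity)]
    have := Int.fract_lt_one x
    push_cast
    linarith
  set f : ℕ → (Z → Fin 8) := fun j γ => ⟨⌊8 * Int.fract (j * S * γ / (2 * Real.pi))⌋₊, hlt _⟩
    with hf
  obtain ⟨y, -, hy⟩ := Finset.exists_lt_card_fiber_of_mul_lt_card_of_maps_to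
    (s := Finset.range R) (t := (Finset.univ : Finset (Z → Fin 8))) (f := f) (n := K)
    (fun a _ => Finset.mem_univ _) (by simpa using h)
  set F := (Finset.range R).filter (fun j => f j = y) with hF
  have hne : F.Nonempty := Finset.card_pos.mp (by omega)
  set m := F.min' hne with hm
  have hmF : m ∈ F := F.min'_mem hne
  refine ⟨(F.erase m).image (fun j => j - m), ?_, ?_⟩
  · rw [Finset.card_image_of_injOn, Finset.card_erase_of_mem hmF]
    · omega
    · intro a ha b hb hab
      have h1 := F.min'_le a (Finset.mem_of_mem_erase ha)
      have h2 := F.min'_le b (Finset.mem_of_mem_erase hb)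
      simp only at hab
      omega
  · intro j hj
    obtain ⟨a, ha, rfl⟩ := Finset.mem_image.mp hj
    obtain ⟨hne', haF⟩ := Finset.mem_erase.mp ha
    have hle : m ≤ a := F.min'_le a haF
    obtain ⟨haR, hay⟩ := Finset.mem_filter.mp haF
    have haR := Finset.mem_range.mp haR
    refine ⟨by omega, by omega, fun γ hγ => ?_⟩
    have h1 : f a = f m := hay.trans (Finset.mem_filter.mp hmF).2.symm
    have h2 := congrArg Fin.val (congrFun h1 ⟨γ, hγ⟩)
    have h3 := cos_ge_half_of_floor_fract_eq h2
    have e : 2 * Real.pi * (a * S * γ / (2 * Real.pi) - m * S * γ / (2 * Real.pi)) =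
        ((a - m : ℕ) : ℝ) * S * γ := by
      rw [Nat.cast_sub hle]
      have := Real.pi_ne_zero
      field_simp
    rwa [← e]

/-- A monotone function with values in `ℕ` is constant on one of many separated intervals. -/
lemma exists_eq_of_monotone {Q : ℝ → ℕ} (hQ : Monotone Q) {S Y : ℝ} (hS : 2 ≤ S) (J : Finset ℕ)
    (hJY : ∀ j ∈ J, j * S + 1 ≤ Y) (hJ : Q (Real.exp Y) < J.card) :
    ∃ j ∈ J, Q (Real.exp (j * S - 1)) = Q (Real.exp (j * S + 1)) := by
  by_contra! hcon
  have hlt : ∀ j ∈ J, Q (Real.exp (j * S - 1)) < Q (Real.exp (j * S + 1)) := fun j hj =>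
    lt_of_le_of_ne (hQ (Real.exp_le_exp.mpr (by linarith))) (hcon j hj)
  have hstep : ∀ i ∈ J, ∀ j ∈ J, i < j →
      Q (Real.exp (i * S + 1)) < Q (Real.exp (j * S + 1)) := by
    intro i _ j hj hij
    refine lt_of_le_of_lt (hQ (Real.exp_le_exp.mpr ?_)) (hlt j hj)
    have : (i : ℝ) + 1 ≤ j := by exact_mod_cast hij
    nlinarith
  have hmaps : ∀ j ∈ J, Q (Real.exp (j * S + 1)) ∈ Finset.Ioc 0 (Q (Real.exp Y)) := fun j hj =>
    Finset.mem_Ioc.mpr ⟨lt_of_le_of_lt (Nat.zero_le _) (hlt j hj),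
      hQ (Real.exp_le_exp.mpr (hJY j hj))⟩
  obtain ⟨i, hi, j, hj, hij, he⟩ := Finset.exists_ne_map_eq_of_card_lt_of_maps_to
    (by simpa using hJ) hmaps
  rcases lt_or_gt_of_ne hij with h | h
  · exact (hstep i hi j hj h).ne he
  · exact (hstep j hj i hi h).ne' he

lemma exists_common_recurrence {Q : ℝ → ℕ} (hQ : Monotone Q) (Z : Finset ℝ) {S Y : ℝ} (hS : 2 ≤ S)
    {R : ℕ} (hR : 8 ^ Z.card * (Q (Real.exp Y) + 1) < R) (hRY : R * S ≤ Y) :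
    ∃ τ : ℝ, S ≤ τ ∧ τ + 1 ≤ Y ∧ Q (Real.exp (τ - 1)) = Q (Real.exp (τ + 1)) ∧
      ∀ γ ∈ Z, 1 / 2 ≤ Real.cos (τ * γ) := by
  obtain ⟨J, hJ, hJp⟩ := exists_finset_half_le_cos Z S hR
  have hJY : ∀ j ∈ J, j * S + 1 ≤ Y := fun j hj => by
    have : (j : ℝ) + 1 ≤ R := by exact_mod_cast (hJp j hj).2.1
    nlinarith
  obtain ⟨j, hj, he⟩ := exists_eq_of_monotone hQ hS J hJY (by omega)
  refine ⟨j * S, ?_, hJY j hj, he, (hJp j hj).2.2⟩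
  have : (1 : ℝ) ≤ j := by exact_mod_cast (hJp j hj).1
  nlinarith

lemma card_dirichletCharacter (q : ℕ) [NeZero q] :
    Fintype.card (DirichletCharacter ℂ q) = q.totient := by
  rw [← Nat.card_eq_fintype_card, DirichletCharacter.card_eq_totient_of_hasEnoughRootsOfUnity]

/-- There are few characters of small conductor. -/
lemma card_conductor_le (q D : ℕ) [NeZero q] :
    ((Finset.univ : Finset (DirichletCharacter ℂ q)).filter
      (fun χ => χ.conductor ≤ D)).card ≤ D ^ 2 := by
  have hsub : (Finset.univ : Finset (DirichletCharacter ℂ q)).filter (fun χ => χ.conductor ≤ D) ⊆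
      (Finset.range D).biUnion fun n => if h : n + 1 ∣ q then
        (Finset.univ : Finset (DirichletCharacter ℂ (n + 1))).image
          (DirichletCharacter.changeLevel h) else ∅ := by
    intro χ hχ
    have hD := (Finset.mem_filter.mp hχ).2
    have h0 : χ.conductor ≠ 0 := DirichletCharacter.conductor_ne_zero χ
    obtain ⟨h, ψ, hψ⟩ := DirichletCharacter.factorsThrough_conductor χ
    obtain ⟨n, hn⟩ := Nat.exists_eq_succ_of_ne_zero h0
    rw [Finset.mem_biUnion]
    refine ⟨n, Finset.mem_range.mpr (by omega), ?_⟩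
    generalize χ.conductor = d at *
    subst hn
    rw [dif_pos h]
    exact Finset.mem_image.mpr ⟨ψ, Finset.mem_univ _, hψ.symm⟩
  refine (Finset.card_le_card hsub).trans (Finset.card_biUnion_le.trans ?_)
  rw [sq]
  refine (Finset.sum_le_card_nsmul _ _ D fun n hn => ?_).trans (by simp)
  split_ifs with h
  · refine Finset.card_image_le.trans ?_
    rw [Finset.card_univ, card_dirichletCharacter]
    exact (Nat.totient_le _).trans (by have := Finset.mem_range.mp hn; omega)
  · simp

lemma le_totient_sq (q : ℕ) : q ≤ (if Even q then 2 else 1) * q.totient ^ 2 := by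
  induction q using Nat.recOnPosPrimePosCoprime with
  | prime_pow p n hp hn =>
    obtain ⟨m, rfl⟩ := Nat.exists_eq_succ_of_ne_zero hn.ne'
    rw [Nat.succ_eq_add_one, Nat.totient_prime_pow_succ hp]
    have h1 : 1 ≤ p ^ m := Nat.one_le_pow _ _ hp.pos
    rcases hp.eq_two_or_odd' with rfl | hodd
    · rw [if_pos (by simp [Nat.even_pow])]
      have : (2 : ℕ) ^ m ≤ 2 ^ m * 2 ^ m := Nat.le_mul_of_pos_left _ h1
      rw [pow_succ]
      nlinarith
    · rw [if_neg (Nat.not_even_iff_odd.mpr hodd.pow), one_mul, pow_succ, mul_pow]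
      have h3 : 3 ≤ p := by
        have := hp.two_le
        rcases hodd with ⟨k, hk⟩
        omega
      refine Nat.mul_le_mul (by rw [sq]; exact Nat.le_mul_of_pos_left _ h1) ?_
      obtain ⟨k, rfl⟩ := Nat.exists_eq_add_of_le h3
      have : 3 + k - 1 = 2 + k := by omega
      rw [this]
      nlinarith
  | zero => simp
  | one => simp
  | coprime a b ha hb hab iha ihb =>
    rw [Nat.totient_mul hab, mul_pow]
    by_cases hea : Even a
    · have heb : ¬ Even b := fun h => by
        have := Nat.dvd_gcd hea.two_dvd h.two_dvd
        rw [hab.gcd_eq_one] at this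
        omega
      rw [if_pos hea] at iha
      rw [if_neg heb] at ihb
      rw [if_pos (hea.mul_right b)]
      calc a * b ≤ _ := Nat.mul_le_mul iha ihb
        _ = _ := by ring
    · rw [if_neg hea] at iha
      by_cases heb : Even b
      · rw [if_pos heb] at ihb
        rw [if_pos (heb.mul_left a)]
        calc a * b ≤ _ := Nat.mul_le_mul iha ihb
          _ = _ := by ring
      · rw [if_neg heb] at ihb
        rw [if_neg (by rw [Nat.even_mul]; tauto)]
        calc a * b ≤ _ := Nat.mul_le_mul iha ihb
          _ = _ := by ring

lemma le_two_mul_totient_sq (q : ℕ) : q ≤ 2 * q.totient ^ 2 :=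
  (le_totient_sq q).trans (Nat.mul_le_mul_right _ (by split_ifs <;> omega))

lemma exists_conductor_threshold {m : ℕ} (hm : 8 ≤ m) : ∃ D : ℕ, 1 ≤ D ∧ m < 8 * (D + 1) ^ 4 ∧
    ∀ q : ℕ, m < q → ∀ [NeZero q], q.totient ≤ 2 * ((Finset.univ :
      Finset (DirichletCharacter ℂ q)).filter (fun χ => D < χ.conductor)).card := by
  set D := Nat.sqrt (Nat.sqrt (m / 8)) with hD
  have h1 : D ^ 2 ≤ Nat.sqrt (m / 8) := Nat.sqrt_le' _
  have h2 : Nat.sqrt (m / 8) ^ 2 ≤ m / 8 := Nat.sqrt_le' _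
  have h3 : Nat.sqrt (m / 8) < (D + 1) ^ 2 := Nat.lt_succ_sqrt' _
  have h4 : m / 8 < (Nat.sqrt (m / 8) + 1) ^ 2 := Nat.lt_succ_sqrt' _
  have h5 : D ^ 4 ≤ m / 8 := by
    calc D ^ 4 = (D ^ 2) ^ 2 := by ring
      _ ≤ _ := (Nat.pow_le_pow_left h1 2).trans h2
  have h6 : m / 8 < (D + 1) ^ 4 := by
    calc m / 8 < _ := h4
      _ ≤ ((D + 1) ^ 2) ^ 2 := Nat.pow_le_pow_left h3 2
      _ = _ := by ring
  refine ⟨D, ?_, by omega, fun q hq _ => ?_⟩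
  · have : 0 < m / 8 := by omega
    exact Nat.sqrt_pos.mpr (Nat.sqrt_pos.mpr this)
  · have hc := card_conductor_le q D
    have hs := Finset.card_filter_add_card_filter_not (s := (Finset.univ :
      Finset (DirichletCharacter ℂ q))) (fun χ => χ.conductor ≤ D)
    rw [Finset.card_univ, card_dirichletCharacter] at hs
    simp only [not_le] at hs
    have h7 := le_two_mul_totient_sq q
    have h8 : 2 * D ^ 2 ≤ q.totient := by
      refine Nat.pow_le_pow_iff_left (n := 2) (by norm_num) |>.mp ?_
      have : (2 * D ^ 2) ^ 2 = 4 * D ^ 4 := by ring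
      omega
    omega

/-- All low-lying zeros of primitive `L`-functions of bounded conductor. -/
lemma GRH.exists_finset_zeros (h : GRH) : ∃ C : ℝ, 0 < C ∧ ∀ (P : ℕ) (B : ℝ), 1 ≤ P → 1 ≤ B →
    ∃ Z : Finset ℝ, (∀ (d : ℕ) [NeZero d] (χ : DirichletCharacter ℂ d), d ≤ P → χ ≠ 1 →
      χ.IsPrimitive → ∀ γ, zeroMult χ γ ≠ 0 → |γ| ≤ B → γ ∈ Z) ∧
      (Z.card : ℝ) ≤ P ^ 2 * (B * (Real.log (P * B) + C)) := by
  obtain ⟨C, hC0, hC⟩ := h.exists_card_zeros_le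
  refine ⟨C, hC0, fun P B hP hB => ?_⟩
  have hP' : (1 : ℝ) ≤ P := by exact_mod_cast hP
  have hb : 0 ≤ B * (Real.log (P * B) + C) := by
    have : 0 ≤ Real.log (P * B) := Real.log_nonneg (one_le_mul_of_one_le_of_one_le hP' hB)
    positivity
  have hZ : ∀ (n : ℕ) (χ : DirichletCharacter ℂ (n + 1)), ∃ Z : Finset ℝ, n < P →
      (χ ≠ 1 → χ.IsPrimitive → ∀ γ, zeroMult χ γ ≠ 0 → |γ| ≤ B → γ ∈ Z) ∧
      (Z.card : ℝ) ≤ B * (Real.log (P * B) + C) := by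
    intro n χ
    by_cases hχ : χ ≠ 1 ∧ χ.IsPrimitive
    · obtain ⟨Z, hZ1, hZ2⟩ := hC (n + 1) χ hχ.1 hχ.2 B hB
      refine ⟨Z, fun hn => ⟨fun _ _ => hZ1, hZ2.trans ?_⟩⟩
      have hn' : ((n + 1 : ℕ) : ℝ) ≤ P := by exact_mod_cast hn
      have hn0 : (0 : ℝ) < ((n + 1 : ℕ) : ℝ) := by positivity
      gcongr
    · refine ⟨∅, fun _ => ⟨fun h1 h2 => absurd ⟨h1, h2⟩ hχ, ?_⟩⟩
      simpa using hb
  choose Z hZ using hZ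
  refine ⟨(Finset.range P).biUnion fun n => Finset.univ.biUnion fun χ => Z n χ, ?_, ?_⟩
  · intro d _ χ hd h1 hp γ hγ hγB
    obtain ⟨n, rfl⟩ := Nat.exists_eq_succ_of_ne_zero (NeZero.ne d)
    rw [Finset.mem_biUnion]
    refine ⟨n, Finset.mem_range.mpr hd, Finset.mem_biUnion.mpr ⟨χ, Finset.mem_univ _, ?_⟩⟩
    exact (hZ n χ hd).1 h1 hp γ hγ hγB
  · have hn : ∀ n ∈ Finset.range P, (((Finset.univ.biUnion fun χ => Z n χ).card : ℕ) : ℝ) ≤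
        P * (B * (Real.log (P * B) + C)) := by
      intro n hn
      have hn := Finset.mem_range.mp hn
      calc (((Finset.univ.biUnion fun χ => Z n χ).card : ℕ) : ℝ)
          ≤ ((∑ χ, (Z n χ).card : ℕ) : ℝ) := by exact_mod_cast Finset.card_biUnion_le
        _ = ∑ χ, ((Z n χ).card : ℝ) := by push_cast; rfl
        _ ≤ ∑ _χ : DirichletCharacter ℂ (n + 1), B * (Real.log (P * B) + C) :=
            Finset.sum_le_sum fun χ _ => (hZ n χ hn).2
        _ = (n + 1).totient * (B * (Real.log (P * B) + C)) := by
            rw [Finset.sum_const, Finset.card_univ, card_dirichletCharacter, nsmul_eq_mul]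
        _ ≤ _ := by
            refine mul_le_mul_of_nonneg_right ?_ hb
            exact_mod_cast (Nat.totient_le _).trans hn
    calc _ ≤ ((∑ n ∈ Finset.range P, (Finset.univ.biUnion fun χ => Z n χ).card : ℕ) : ℝ) := by
          exact_mod_cast Finset.card_biUnion_le
      _ = ∑ n ∈ Finset.range P, (((Finset.univ.biUnion fun χ => Z n χ).card : ℕ) : ℝ) := by
          push_cast; rfl
      _ ≤ _ := Finset.sum_le_card_nsmul _ _ _ hn
      _ = _ := by rw [Finset.card_range, nsmul_eq_mul]; ring

lemma GRH.exists_time (h : GRH) : ∃ C : ℝ, 0 < C ∧ ∀ (Q : ℝ → ℕ), Monotone Q → ∀ a L l H : ℝ,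
    10 ≤ a → L = 8 * Real.log a → l = Real.log L → 1 ≤ l → C ≤ l → 10 * L ≤ a →
    1 ≤ Q (Real.exp (a ^ 8)) → H = L / (65536 * (Q (Real.exp (a ^ 8)) : ℝ) ^ 2 * l) → 4 ≤ H →
    ∃ τ : ℝ, a ^ 4 ≤ τ ∧ τ + 1 ≤ a ^ 8 ∧ Q (Real.exp (τ - 1)) = Q (Real.exp (τ + 1)) ∧
      ∀ (d : ℕ) [NeZero d] (χ : DirichletCharacter ℂ d), d ≤ 2 * Q (Real.exp (a ^ 8)) → χ ≠ 1 →
        χ.IsPrimitive →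
        1 / 128 * Real.log (d * H) - C ≤
          -(tentSum (fun n => ArithmeticFunction.vonMangoldt n) χ (1 / H) τ).re := by
  obtain ⟨C₁, hC₁, h1⟩ := h.exists_finset_zeros
  obtain ⟨C₂, hC₂, h2⟩ := h.exists_le_neg_re_tentSum
  refine ⟨C₁ + C₂ + 7, by positivity, ?_⟩
  intro Q hQ a L l H ha hL hl hl1 hCl hLa hm1 hH hH4
  set m := Q (Real.exp (a ^ 8)) with hm
  have hm1' : (1 : ℝ) ≤ m := by exact_mod_cast hm1
  have hL1 : 1 ≤ L := by
    have : 1 ≤ Real.log L := hl ▸ hl1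
    by_contra! hcon
    have h0 : 0 ≤ L := by rw [hL]; have := Real.log_nonneg (by linarith : 1 ≤ a); linarith
    have := Real.log_nonpos h0 hcon.le
    linarith
  have hmH : (m : ℝ) ^ 2 * H * l = L / 65536 := by
    rw [hH]
    field_simp
  have hmHL : (m : ℝ) * H ≤ L := by
    have h3 : (m : ℝ) * H ≤ (m : ℝ) ^ 2 * H := by
      refine mul_le_mul_of_nonneg_right ?_ (by linarith)
      nlinarith
    have h4 : (m : ℝ) ^ 2 * H ≤ (m : ℝ) ^ 2 * H * l := le_mul_of_one_le_right (by positivity) hl1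
    linarith
  have hmL : (m : ℝ) ≤ L := by nlinarith
  obtain ⟨Z, hZ, hZc⟩ := h1 (2 * m) (512 * H) (by omega) (by linarith)
  have hlog : Real.log (((2 * m : ℕ) : ℝ) * (512 * H)) + C₁ ≤ 2 * l := by
    have h3 : Real.log (((2 * m : ℕ) : ℝ) * (512 * H)) ≤ Real.log (1024 * L) := by
      refine Real.log_le_log (by push_cast; positivity) ?_
      push_cast
      linarith
    rw [Real.log_mul (x := 1024) (by norm_num) (by linarith), ← hl] at h3
    have h4 : Real.log 1024 ≤ 7 := by
      rw [show (1024 : ℝ) = 2 ^ 10 by norm_num, Real.log_pow]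
      have := Real.log_two_lt_d9
      push_cast
      linarith
    linarith
  have hcard : (Z.card : ℝ) ≤ L / 16 := by
    refine hZc.trans ?_
    calc ((2 * m : ℕ) : ℝ) ^ 2 * (512 * H * (Real.log (((2 * m : ℕ) : ℝ) * (512 * H)) + C₁))
        ≤ ((2 * m : ℕ) : ℝ) ^ 2 * (512 * H * (2 * l)) := by gcongr
      _ = 4096 * ((m : ℝ) ^ 2 * H * l) := by push_cast; ring
      _ = L / 16 := by rw [hmH]; ring
  have hpow : ((8 ^ Z.card : ℕ) : ℝ) ≤ a ^ 2 := by
    have ha0 : 0 < a := by linarith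
    rw [← Real.log_le_log_iff (by positivity) (by positivity)]
    push_cast
    rw [Real.log_pow, Real.log_pow]
    have h8 : Real.log 8 ≤ 3 := by
      rw [show (8 : ℝ) = 2 ^ 3 by norm_num, Real.log_pow]
      have := Real.log_two_lt_d9
      push_cast
      linarith
    have h3 : (Z.card : ℝ) * Real.log 8 ≤ L / 16 * 3 := by gcongr
    push_cast
    linarith
  have hR : 8 ^ Z.card * (m + 1) < ⌊a ^ 4⌋₊ := by
    have h3 : ((8 ^ Z.card * (m + 1) : ℕ) : ℝ) < (⌊a ^ 4⌋₊ : ℝ) := by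
      have h4 := Nat.lt_floor_add_one (a ^ 4)
      have h5 : ((8 ^ Z.card * (m + 1) : ℕ) : ℝ) ≤ a ^ 2 * a := by
        rw [Nat.cast_mul]
        push_cast at hpow ⊢
        gcongr
        linarith
      have h6 : 10 * a ^ 3 ≤ a ^ 4 := by
        have := mul_le_mul_of_nonneg_right ha (by positivity : 0 ≤ a ^ 3)
        linarith
      have h7 : (1 : ℝ) ≤ a ^ 3 := one_le_pow₀ (by linarith)
      linarith
    exact_mod_cast h3
  have hS : (2 : ℝ) ≤ a ^ 4 := by
    have : (10 : ℝ) ^ 4 ≤ a ^ 4 := by gcongr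
    linarith
  have hRY : (⌊a ^ 4⌋₊ : ℝ) * a ^ 4 ≤ a ^ 8 := by
    calc (⌊a ^ 4⌋₊ : ℝ) * a ^ 4 ≤ a ^ 4 * a ^ 4 := by
          gcongr
          exact Nat.floor_le (by positivity)
      _ = a ^ 8 := by ring
  obtain ⟨τ, hτ1, hτ2, hτQ, hcos⟩ := exists_common_recurrence hQ Z hS hR hRY
  refine ⟨τ, hτ1, hτ2, hτQ, fun d _ χ hd h3 hp => ?_⟩
  have := h2 d χ h3 hp H τ hH4 (by linarith) fun γ hγ hγH => hcos γ (hZ d χ hd h3 hp γ hγ hγH)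
  refine le_trans ?_ this
  linarith

lemma le_log_conductor_mul {d m q₀ A L l H : ℝ} (hd : 0 < d) (hm : 0 < m) (hA : 0 < A) (hL : 0 < L)
    (hl0 : 0 < l) (hl : l = Real.log L) (hdq : q₀ ≤ 8 * d ^ 4) (hmq : m ≤ A * q₀)
    (hH : H = L / (65536 * m ^ 2 * l)) (hH1 : 1 ≤ H)
    (hlarge : Real.log l + Real.log (4194304 * A ^ 2) ≤ l / 2) :
    l / 16 ≤ Real.log (d * H) := by
  have h1 : m ^ 2 ≤ 64 * A ^ 2 * d ^ 8 := by
    have h2 : m ≤ A * (8 * d ^ 4) := hmq.trans (by gcongr)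
    calc m ^ 2 ≤ (A * (8 * d ^ 4)) ^ 2 := by gcongr
      _ = _ := by ring
  have h3 : L ≤ (d * H) ^ 8 * (4194304 * A ^ 2 * l) := by
    have e : L = H * (65536 * m ^ 2 * l) := by
      rw [hH]; field_simp
    have hH8 : H ≤ H ^ 8 := le_self_pow₀ hH1 (by norm_num)
    calc L = H * (65536 * m ^ 2 * l) := e
      _ ≤ H ^ 8 * (65536 * (64 * A ^ 2 * d ^ 8) * l) := by gcongr
      _ = _ := by ring
  have h4 := Real.log_le_log hL h3
  have hH0 : 0 < H := by linarith
  rw [Real.log_mul (by positivity) (by positivity), Real.log_pow,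
    Real.log_mul (x := 4194304 * A ^ 2) (by positivity) (by positivity), ← hl] at h4
  push_cast at h4
  linarith

lemma log_log_log_sq_le {a x : ℝ} (ha : 10 ≤ a) (hx : Real.exp (a ^ 4 - 1) ≤ x)
    (hx2 : x ≤ Real.exp (a ^ 8)) :
    Real.log (Real.log (Real.log x)) ^ 2 ≤ Real.log (8 * Real.log a) ^ 2 := by
  have h4 : (10 : ℝ) ^ 4 ≤ a ^ 4 := by gcongr
  have hx0 : 0 < x := (Real.exp_pos _).trans_le hx
  have h1 : a ^ 4 - 1 ≤ Real.log x := (Real.le_log_iff_exp_le hx0).mpr hx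
  have h2 : Real.log x ≤ a ^ 8 := (Real.log_le_iff_le_exp hx0).mpr hx2
  have h3 : 1 ≤ Real.log (Real.log x) := by
    rw [Real.le_log_iff_exp_le (by linarith)]
    have := Real.exp_one_lt_d9
    linarith
  have h5 : Real.log (Real.log x) ≤ 8 * Real.log a := by
    calc Real.log (Real.log x) ≤ Real.log (a ^ 8) := Real.log_le_log (by linarith) h2
      _ = _ := by rw [Real.log_pow]; norm_num
  have h6 : 0 ≤ Real.log (Real.log (Real.log x)) := Real.log_nonneg h3
  have h7 := Real.log_le_log (by linarith) h5
  gcongr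

/-- A weight `w` lying between `log p` on primes and `Λ`, together with a variance which dominates
the corresponding character sums. -/
def DominatesCharSums (w : ℕ → ℝ) (F : ℝ → ℕ → ℝ) : Prop :=
  (∀ k, primeLog k ≤ w k) ∧ (∀ k, w k ≤ ArithmeticFunction.vonMangoldt k) ∧
    ∀ (q : ℕ) [NeZero q] (n : ℕ) (T : Finset (DirichletCharacter ℂ q)), 1 ∉ T →
      1 / (q.totient : ℝ) * ∑ χ ∈ T, ‖charSum w χ n‖ ^ 2 ≤ F n q

lemma dominatesCharSums_Gvar : DominatesCharSums primeLog Gvar :=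
  ⟨fun _ => le_rfl, primeLog_le_vonMangoldt, fun _ _ n T hT => sum_norm_sq_charSum_le_Gvar n T hT⟩

lemma dominatesCharSums_Vvar :
    DominatesCharSums (fun n => ArithmeticFunction.vonMangoldt n) Vvar :=
  ⟨primeLog_le_vonMangoldt, fun _ => le_rfl, fun _ _ n T hT => sum_norm_sq_charSum_le_Vvar n T hT⟩

lemma GRH.exists_variance_ge (h : GRH) : ∃ C c : ℝ, 0 < C ∧ 0 < c ∧ ∀ (Q : ℝ → ℕ) (A : ℝ),
    Monotone Q → 0 < A → (∀ y : ℝ, 1 ≤ y → (Q (Real.exp (y ^ (3 : ℝ))) : ℝ) ≤ A * Q (Real.exp y)) →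
    ∀ (w : ℕ → ℝ) (F : ℝ → ℕ → ℝ), DominatesCharSums w F →
    ∀ a L l : ℝ, 10 ≤ a → L = 8 * Real.log a → l = Real.log L → 1 ≤ l → C ≤ l → 10 * L ≤ a →
    8 ≤ Q (Real.exp (a ^ 4 - 1)) → 262144 * (Q (Real.exp (a ^ 8)) : ℝ) ^ 2 * l ≤ L →
    Real.log l + Real.log (4194304 * A ^ 2) ≤ l / 2 →
    ∃ x : ℝ, Real.exp (a ^ 4 - 1) ≤ x ∧ c * (x * Real.log (Real.log (Real.log x)) ^ 2) ≤
      (1 / (Q x : ℝ)) * ∑ q ∈ Finset.Ioc (Q x) (2 * Q x), F x q := by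
  obtain ⟨C₁, hC₁, hT⟩ := h.exists_time
  obtain ⟨C₂, hC₂, hsub⟩ := exists_norm_tentSum_sub_le
  obtain ⟨c, hc, hwindow⟩ := exists_sum_norm_sq_tentSum_le
  refine ⟨4096 * (C₁ + C₂), c * (1 / 2 * (1 / 4096) ^ 2), by positivity, by positivity, ?_⟩
  intro Q A hQ hA hadm w F hF a L l ha hL hl hl1 hCl hLa hQ8 hQl hlarge
  set m := Q (Real.exp (a ^ 8)) with hm
  have ha4 : (10 : ℝ) ^ 4 ≤ a ^ 4 := by gcongr
  have ha48 : a ^ 4 ≤ a ^ 8 := pow_le_pow_right₀ (by linarith) (by norm_num)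
  have hm8 : 8 ≤ m := hQ8.trans (hQ (Real.exp_le_exp.mpr (by linarith)))
  have hm8' : (8 : ℝ) ≤ m := by exact_mod_cast hm8
  have hml : 0 < (m : ℝ) ^ 2 * l := by positivity
  have hL0 : 0 < L := by linarith
  set H := L / (65536 * (m : ℝ) ^ 2 * l) with hH
  have hH4 : 4 ≤ H := by
    rw [hH, le_div_iff₀ (by positivity)]
    linarith
  have hHL : H ≤ L := by
    rw [hH]
    refine div_le_self hL0.le ?_
    nlinarith
  have hmL : (m : ℝ) ≤ L := by nlinarith
  obtain ⟨τ, hτ1, hτ2, hτQ, hτ⟩ := hT Q hQ a L l H ha hL hl hl1 (by linarith) hLa (by omega) hH hH4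
  set q₀ := Q (Real.exp (τ + 1)) with hq₀
  have hq8 : 8 ≤ q₀ := hτQ ▸ hQ8.trans (hQ (Real.exp_le_exp.mpr (by linarith)))
  have hqm : q₀ ≤ m := hQ (Real.exp_le_exp.mpr hτ2)
  have hmA : (m : ℝ) ≤ A * q₀ := by
    have h1 : m ≤ Q (Real.exp (τ ^ (3 : ℝ))) := by
      refine hQ (Real.exp_le_exp.mpr ?_)
      have h2 : τ ^ (3 : ℝ) = τ ^ 3 := by exact_mod_cast Real.rpow_natCast τ 3
      rw [h2]
      calc a ^ 8 ≤ a ^ 12 := pow_le_pow_right₀ (by linarith) (by norm_num)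
        _ = (a ^ 4) ^ 3 := by ring
        _ ≤ τ ^ 3 := by gcongr
    have h3 : Q (Real.exp τ) ≤ q₀ := hQ (Real.exp_le_exp.mpr (by linarith))
    calc (m : ℝ) ≤ Q (Real.exp (τ ^ (3 : ℝ))) := by exact_mod_cast h1
      _ ≤ A * Q (Real.exp τ) := hadm τ (by linarith)
      _ ≤ A * q₀ := by gcongr
  obtain ⟨D, hD1, hDq, hDc⟩ := exists_conductor_threshold hq8
  have hTex : ∀ q : ℕ, ∃ T : Finset (DirichletCharacter ℂ q), q₀ < q →
      (∀ χ ∈ T, D < χ.conductor) ∧ (q.totient : ℝ) ≤ 2 * T.card := by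
    intro q
    by_cases hq : q₀ < q
    · have : NeZero q := ⟨by omega⟩
      exact ⟨_, fun _ => ⟨fun χ hχ => (Finset.mem_filter.mp hχ).2, by exact_mod_cast hDc q hq⟩⟩
    · exact ⟨∅, fun hq' => absurd hq' hq⟩
  choose T hTp using hTex
  have hone : ∀ q, q₀ < q → (1 : DirichletCharacter ℂ q) ∉ T q := fun q hq h1 => by
    have : NeZero q := ⟨by omega⟩
    have h2 := (hTp q hq).1 1 h1
    rw [DirichletCharacter.conductor_one] at h2
    omega
  have hτexp := Real.add_one_le_exp τ
  have hbig : ∀ q ∈ Finset.Ioc q₀ (2 * q₀), ∀ χ ∈ T q, l / 4096 ≤ ‖tentSum w χ (1 / H) τ‖ := by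
    intro q hq χ hχ
    obtain ⟨hq1, hq2⟩ := Finset.mem_Ioc.mp hq
    have hq0 : q ≠ 0 := by omega
    have : NeZero q := ⟨hq0⟩
    have hdq := χ.conductor_dvd_level
    have hd0 : χ.conductor ≠ 0 := DirichletCharacter.conductor_ne_zero χ
    have : NeZero χ.conductor := ⟨hd0⟩
    have hDd := (hTp q hq1).1 χ hχ
    have hp1 : χ.primitiveCharacter ≠ 1 := fun h1 => by
      have h2 := χ.changeLevel_primitiveCharacter
      rw [h1, map_one] at h2
      exact hone q hq1 (h2 ▸ hχ)
    have hdle := Nat.le_of_dvd (Nat.pos_of_ne_zero hq0) hdq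
    have h1 := hτ χ.conductor χ.primitiveCharacter (by omega) hp1 χ.primitiveCharacter_isPrimitive
    have h2 : l / 16 ≤ Real.log (χ.conductor * H) := by
      refine le_log_conductor_mul (m := m) (q₀ := q₀) (A := A) (by positivity) (by positivity) hA
        hL0 (by linarith) hl ?_ hmA hH (by linarith) hlarge
      have : q₀ ≤ 8 * χ.conductor ^ 4 :=
        hDq.le.trans (Nat.mul_le_mul_left _ (Nat.pow_le_pow_left hDd 4))
      exact_mod_cast this
    have hlogq : Real.log q ≤ Real.exp ((τ - 1) / 2) := by
      have h3 : (q : ℝ) ≤ 2 * m := by exact_mod_cast (hq2.trans (by omega))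
      have h4 := Real.log_le_sub_one_of_pos (by positivity : (0 : ℝ) < q)
      have h5 := Real.add_one_le_exp ((τ - 1) / 2)
      have h6 : a ≤ a ^ 4 := le_self_pow₀ (by linarith) (by norm_num)
      linarith
    have h3 := hsub χ.conductor q hdq χ.primitiveCharacter w (1 / H) τ hq0 (by positivity)
      (by rw [div_le_div_iff₀ (by linarith) (by norm_num)]; linarith) (by linarith) hlogq hF.1 hF.2.1
    rw [χ.changeLevel_primitiveCharacter] at h3
    have h4 := (neg_le_abs _).trans (Complex.abs_re_le_norm
      (tentSum (fun n => ArithmeticFunction.vonMangoldt n) χ.primitiveCharacter (1 / H) τ))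
    have h5 := norm_sub_norm_le (tentSum (fun n => ArithmeticFunction.vonMangoldt n)
      χ.primitiveCharacter (1 / H) τ) (tentSum w χ (1 / H) τ)
    rw [norm_sub_rev] at h5
    linarith
  obtain ⟨n, hn1, hn2, hn⟩ := hwindow (1 / H) τ (by positivity)
    (by rw [div_le_div_iff₀ (by linarith) (by norm_num)]; linarith) (by linarith)
    (by
      rw [one_div, inv_mul_eq_div, le_div_iff₀ (by linarith), one_mul]
      have h6 : a ≤ a ^ 4 := le_self_pow₀ (by linarith) (by norm_num)
      linarith) w ((Finset.Ioc q₀ (2 * q₀)).sigma T) (fun i => 1 / (i.1.totient : ℝ))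
    (fun i _ => by positivity)
  rw [Finset.sum_sigma, Finset.sum_sigma] at hn
  have hQn : Q n = q₀ := le_antisymm (hQ hn2) (hτQ ▸ hQ hn1)
  have hlow : (q₀ : ℝ) * (1 / 2 * (l / 4096) ^ 2) ≤ ∑ q ∈ Finset.Ioc q₀ (2 * q₀), ∑ χ ∈ T q,
      1 / (q.totient : ℝ) * ‖tentSum w χ (1 / H) τ‖ ^ 2 := by
    have hcard : (q₀ : ℝ) = (Finset.Ioc q₀ (2 * q₀)).card := by
      rw [Nat.card_Ioc]; congr 1; omega
    rw [hcard, ← nsmul_eq_mul]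
    refine Finset.card_nsmul_le_sum _ _ _ fun q hq => ?_
    have hq1 := (Finset.mem_Ioc.mp hq).1
    have hφ : (0 : ℝ) < q.totient := by
      exact_mod_cast Nat.totient_pos.mpr (by omega)
    calc 1 / 2 * (l / 4096) ^ 2 ≤ (T q).card * (1 / (q.totient : ℝ) * (l / 4096) ^ 2) := by
          rw [← mul_assoc]
          refine mul_le_mul_of_nonneg_right ?_ (by positivity)
          rw [mul_one_div, div_le_div_iff₀ (by norm_num) hφ]
          have := (hTp q hq1).2
          linarith
      _ ≤ _ := by
          rw [← nsmul_eq_mul]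
          refine Finset.card_nsmul_le_sum _ _ _ fun χ hχ => ?_
          have := hbig q hq χ hχ
          gcongr
  have hup : ∑ q ∈ Finset.Ioc q₀ (2 * q₀), ∑ χ ∈ T q,
      1 / (q.totient : ℝ) * ‖charSum w χ n‖ ^ 2 ≤ ∑ q ∈ Finset.Ioc q₀ (2 * q₀), F n q := by
    refine Finset.sum_le_sum fun q hq => ?_
    have hq1 := (Finset.mem_Ioc.mp hq).1
    have : NeZero q := ⟨by omega⟩
    rw [← Finset.mul_sum]
    exact hF.2.2 q n (T q) (hone q hq1)
  have hxlow : Real.exp (a ^ 4 - 1) ≤ n := (Real.exp_le_exp.mpr (by linarith)).trans hn1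
  refine ⟨n, hxlow, ?_⟩
  have hlog := log_log_log_sq_le ha hxlow (hn2.trans (Real.exp_le_exp.mpr hτ2))
  rw [← hL, ← hl] at hlog
  have hq0 : (0 : ℝ) < q₀ := by exact_mod_cast (by omega : 0 < q₀)
  rw [hQn, one_div (q₀ : ℝ), inv_mul_eq_div, le_div_iff₀ hq0]
  calc c * (1 / 2 * (1 / 4096) ^ 2) * (n * Real.log (Real.log (Real.log n)) ^ 2) * q₀
      ≤ c * (1 / 2 * (1 / 4096) ^ 2) * (n * l ^ 2) * q₀ := by gcongr
    _ = c * n * (q₀ * (1 / 2 * (l / 4096) ^ 2)) := by ring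
    _ ≤ c * n * ∑ q ∈ Finset.Ioc q₀ (2 * q₀), ∑ χ ∈ T q,
          1 / (q.totient : ℝ) * ‖tentSum w χ (1 / H) τ‖ ^ 2 := by gcongr
    _ ≤ _ := hn.trans hup

lemma eventually_log_add_le (K : ℝ) {c : ℝ} (hc : 0 < c) :
    ∀ᶠ t : ℝ in atTop, Real.log t + K ≤ c * t := by
  have h1 := (Real.isLittleO_log_id_atTop).bound (by positivity : 0 < c / 2)
  filter_upwards [h1, eventually_ge_atTop (2 / c * K), eventually_ge_atTop 0] with t h2 h3 h4
  have h5 := (le_abs_self _).trans h2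
  rw [id_eq, Real.norm_eq_abs, abs_of_nonneg h4] at h5
  have h6 : K ≤ c / 2 * t := by
    calc K = c / 2 * (2 / c * K) := by field_simp
      _ ≤ _ := by gcongr
  linarith

lemma GRH.exists_variance_ge_of_le (h : GRH) : ∃ c : ℝ, 0 < c ∧ ∀ (Q : ℝ → ℕ) (A ε : ℝ),
    Monotone Q → Tendsto Q atTop atTop → 0 < A →
    (∀ y : ℝ, 1 ≤ y → (Q (Real.exp (y ^ (3 : ℝ))) : ℝ) ≤ A * Q (Real.exp y)) →
    0 < ε → ε ≤ 1 / 512 → (∀ᶠ x : ℝ in atTop, (Q x : ℝ) ≤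
      ε * Real.sqrt (Real.log (Real.log x)) / Real.sqrt (Real.log (Real.log (Real.log x)))) →
    ∀ (w : ℕ → ℝ) (F : ℝ → ℕ → ℝ), DominatesCharSums w F → ∀ X : ℝ, ∃ x : ℝ, X ≤ x ∧
      c * (x * Real.log (Real.log (Real.log x)) ^ 2) ≤
        (1 / (Q x : ℝ)) * ∑ q ∈ Finset.Ioc (Q x) (2 * Q x), F x q := by
  obtain ⟨C, c, -, hc, hmain⟩ := h.exists_variance_ge
  refine ⟨c, hc, fun Q A ε hQ hQt hA hadm hε hε2 hQε w F hF X => ?_⟩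
  have hL : Tendsto (fun a : ℝ => 8 * Real.log a) atTop atTop :=
    Tendsto.const_mul_atTop (by norm_num) Real.tendsto_log_atTop
  have hl := Real.tendsto_log_atTop.comp hL
  have hlow : Tendsto (fun a : ℝ => Real.exp (a ^ 4 - 1)) atTop atTop :=
    Real.tendsto_exp_atTop.comp (tendsto_atTop_add_const_right _ _ (tendsto_pow_atTop (by norm_num)))
  have hhigh : Tendsto (fun a : ℝ => Real.exp (a ^ 8)) atTop atTop :=
    Real.tendsto_exp_atTop.comp (tendsto_pow_atTop (by norm_num))
  have hev := (eventually_ge_atTop (10 : ℝ)).and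
    ((hl.eventually_ge_atTop 1).and ((hl.eventually_ge_atTop C).and
    ((eventually_log_add_le 0 (by norm_num : (0 : ℝ) < 1 / 80)).and
    (((hQt.comp hlow).eventually_ge_atTop 8).and ((hhigh.eventually hQε).and
    ((hl.eventually (eventually_log_add_le (Real.log (4194304 * A ^ 2))
      (by norm_num : (0 : ℝ) < 1 / 2))).and (hlow.eventually_ge_atTop X)))))))
  obtain ⟨a, ha, hl1, hCl, hLa, hQ8, hQl, hK, hX⟩ := hev.exists
  simp only [Function.comp_apply] at hl1 hCl hQ8 hK
  have e : Real.log (Real.log (Real.exp (a ^ 8))) = 8 * Real.log a := by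
    rw [Real.log_exp, Real.log_pow]
    norm_num
  rw [e] at hQl
  have hm : 262144 * (Q (Real.exp (a ^ 8)) : ℝ) ^ 2 * Real.log (8 * Real.log a) ≤
      8 * Real.log a := by
    have h0 := Real.log_nonneg (by linarith : 1 ≤ a)
    have hL0 : 0 ≤ 8 * Real.log a := by linarith
    have h1 : (Q (Real.exp (a ^ 8)) : ℝ) ^ 2 ≤
        (1 / 512 * Real.sqrt (8 * Real.log a) / Real.sqrt (Real.log (8 * Real.log a))) ^ 2 := by
      refine pow_le_pow_left₀ (Nat.cast_nonneg _) (hQl.trans ?_) 2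
      gcongr
    rw [div_pow, mul_pow, Real.sq_sqrt hL0, Real.sq_sqrt (by linarith),
      le_div_iff₀ (by linarith)] at h1
    linarith
  obtain ⟨x, hx, hx2⟩ := hmain Q A hQ hA hadm w F hF a _ _ ha rfl rfl hl1 hCl (by linarith) hQ8 hm
    (by linarith)
  exact ⟨x, hX.trans hx, hx2⟩

lemma eq_zero_of_deriv_eq_mul {f g : ℂ → ℂ} (hf : Differentiable ℂ f) {z : ℂ}
    (hg : AnalyticAt ℂ g z) (hfg : deriv f =ᶠ[nhds z] fun s => g s * f s) (hz : f z = 0) (s : ℂ) :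
    f s = 0 := by
  have hfa : AnalyticAt ℂ f z := hf.analyticAt z
  have h1 := hfa.analyticOrderAt_deriv_add_one
  simp only [hz, sub_zero] at h1
  rw [analyticOrderAt_congr hfg] at h1
  have h2 : analyticOrderAt (fun s => g s * f s) z = analyticOrderAt g z + analyticOrderAt f z :=
    analyticOrderAt_mul hg hfa
  rw [h2] at h1
  have htop : analyticOrderAt f z = ⊤ := by
    by_contra hne
    obtain ⟨m, hm⟩ := ENat.ne_top_iff_exists.mp hne
    rw [← hm] at h1
    have h3 : (m : ℕ∞) + 1 ≤ m := by
      calc (m : ℕ∞) + 1 ≤ analyticOrderAt g z + m + 1 := by gcongr; exact le_add_self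
        _ = m := h1
    have h4 : m + 1 ≤ m := by exact_mod_cast h3
    omega
  rw [analyticOrderAt_eq_top] at htop
  exact AnalyticOnNhd.eqOn_zero_of_preconnected_of_eventuallyEq_zero
    (fun w _ => hf.analyticAt w) isPreconnected_univ (Set.mem_univ z) htop (Set.mem_univ s)

lemma LFunction_ne_zero_of_charSum_le {N : ℕ} [NeZero N] {χ : DirichletCharacter ℂ N} (hχ : χ ≠ 1)
    {C r : ℝ} (hr : 0 ≤ r)
    (hb : ∀ n, ‖charSum (fun k => ArithmeticFunction.vonMangoldt k) χ n‖ ≤ C * (n : ℝ) ^ r) {s : ℂ}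
    (hs : r < s.re) : χ.LFunction s ≠ 0 := by
  set a : ℕ → ℂ := (fun n : ℕ => χ n) * fun n => (ArithmeticFunction.vonMangoldt n : ℂ) with ha
  have hsum : ∀ n : ℕ, ∑ k ∈ Finset.Icc 1 n, a k =
      charSum (fun k => ArithmeticFunction.vonMangoldt k) χ n := by
    intro n
    rw [charSum, Finset.range_eq_Ico, Finset.sum_eq_sum_Ico_succ_bot (Nat.succ_pos n), Nat.succ_eq_add_one,
      Finset.Ico_add_one_right_eq_Icc]
    simp [ha]
  have hb' : ∀ n : ℕ, ‖∑ k ∈ Finset.Icc 1 n, a k‖ ≤ C * (n : ℝ) ^ r := fun n => by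
    rw [hsum]; exact hb n
  set G : ℂ → ℂ := fun s => -(s * ∫ t in Set.Ioi (1 : ℝ),
      (∑ k ∈ Finset.Icc 1 ⌊t⌋₊, a k) * (t : ℂ) ^ (-(s + 1))) with hG
  have hop : ∀ b : ℝ, IsOpen {s : ℂ | b < s.re} := fun b =>
    isOpen_lt continuous_const Complex.continuous_re
  have hGd : DifferentiableOn ℂ G {s : ℂ | r < s.re} := fun s hs =>
    (differentiableAt_id.mul
      (differentiableAt_integral_partialSum a hr hb' hs)).neg.differentiableWithinAt
  have hGa := hGd.analyticOnNhd (hop r)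
  have hLd := DirichletCharacter.differentiable_LFunction hχ
  have heq : Set.EqOn (deriv χ.LFunction) (fun s => G s * χ.LFunction s) {s : ℂ | r < s.re} := by
    refine AnalyticOnNhd.eqOn_of_preconnected_of_eventuallyEq (z₀ := ((r + 2 : ℝ) : ℂ))
      (fun z _ => (hLd.analyticAt z).deriv)
      (fun z hz => (hGa z hz).mul (hLd.analyticAt z)) (isPreconnected_re_gt r)
      (show r < ((r + 2 : ℝ) : ℂ).re by rw [Complex.ofReal_re]; linarith) ?_
    have : {s : ℂ | r + 1 < s.re} ∈ nhds ((r + 2 : ℝ) : ℂ) :=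
      (hop (r + 1)).mem_nhds (show r + 1 < ((r + 2 : ℝ) : ℂ).re by rw [Complex.ofReal_re]; linarith)
    filter_upwards [this] with z hz
    have hz' : r + 1 < z.re := hz
    have h1 : 1 < z.re := by linarith
    have h2 := logDeriv_LFunction_eq χ h1
    rw [logDeriv_apply, div_eq_iff
      (DirichletCharacter.LFunction_ne_zero_of_one_le_re χ (Or.inl hχ) h1.le)] at h2
    rw [h2, hG]
    congr 2
    refine LSeries_eq_mul_integral a hr (by linarith)
      (DirichletCharacter.LSeriesSummable_twist_vonMangoldt χ h1) ?_
    refine Asymptotics.IsBigO.of_bound C (Eventually.of_forall fun n => (hb' n).trans ?_)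
    rw [Real.norm_of_nonneg (Real.rpow_nonneg (Nat.cast_nonneg n) r)]
  intro h0
  refine DirichletCharacter.LFunction_ne_zero_of_one_le_re χ (s := 2) (Or.inl hχ) (by simp) ?_
  exact eq_zero_of_deriv_eq_mul hLd (hGa s hs) (heq.eventuallyEq_of_mem ((hop r).mem_nhds hs)) h0 2

lemma exists_lt_norm_charSum {N : ℕ} [NeZero N] {χ : DirichletCharacter ℂ N} (hχ : χ ≠ 1)
    {r : ℝ} (hr : 0 ≤ r) {s : ℂ} (hs : r < s.re) (h0 : χ.LFunction s = 0) (M : ℕ) :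
    ∃ n, M ≤ n ∧
      (n : ℝ) ^ r < ‖charSum (fun k => ArithmeticFunction.vonMangoldt k) χ n‖ := by
  by_contra! hcon
  refine LFunction_ne_zero_of_charSum_le hχ hr (C := 1 + ∑ m ∈ Finset.range M,
    ‖charSum (fun k => ArithmeticFunction.vonMangoldt k) χ m‖) (fun n => ?_) hs h0
  have hS : 0 ≤ ∑ m ∈ Finset.range M,
    ‖charSum (fun k => ArithmeticFunction.vonMangoldt k) χ m‖ :=
    Finset.sum_nonneg fun _ _ => norm_nonneg _
  have hp : 0 ≤ (n : ℝ) ^ r := Real.rpow_nonneg (Nat.cast_nonneg n) r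
  rcases le_or_gt M n with hn | hn
  · exact (hcon n hn).trans (le_mul_of_one_le_left hp (by linarith))
  · rcases Nat.eq_zero_or_pos n with rfl | hpos
    · refine le_trans (le_of_eq ?_) (mul_nonneg (by linarith) hp)
      simp [charSum]
    · have h1 : (1 : ℝ) ≤ (n : ℝ) ^ r := Real.one_le_rpow (by exact_mod_cast hpos) hr
      have h2 := Finset.single_le_sum (f := fun m =>
        ‖charSum (fun k => ArithmeticFunction.vonMangoldt k) χ m‖) (fun _ _ => norm_nonneg _)
        (Finset.mem_range.mpr hn)
      calc _ ≤ 1 + ∑ m ∈ Finset.range M,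
            ‖charSum (fun k => ArithmeticFunction.vonMangoldt k) χ m‖ := by linarith
        _ ≤ _ := le_mul_of_one_le_right (by linarith) h1

lemma exists_norm_charSum_changeLevel_sub_le : ∃ C : ℝ, 0 < C ∧ ∀ (d q : ℕ) (h : d ∣ q)
    (ψ : DirichletCharacter ℂ d) (w : ℕ → ℝ) (n : ℕ), q ≠ 0 → (∀ k, primeLog k ≤ w k) →
    (∀ k, w k ≤ ArithmeticFunction.vonMangoldt k) →
    ‖charSum w (DirichletCharacter.changeLevel h ψ) n -
      charSum (fun k => ArithmeticFunction.vonMangoldt k) ψ n‖ ≤ C * √n + Real.log q := by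
  obtain ⟨C, hC, hCb⟩ := exists_sum_vonMangoldt_sub_primeLog_le
  refine ⟨2 * C, by positivity, fun d q h ψ w n hq hw hwv => ?_⟩
  have h1 := norm_sum_dirichletCharacter_sub_le (DirichletCharacter.changeLevel h ψ)
    (f := fun _ => 1) (K := 1) (fun _ => zero_le_one) (fun _ => le_rfl) hw hwv
    (fun _ => le_rfl) primeLog_le_vonMangoldt n
  have h2 := norm_sum_changeLevel_sub_le hq h ψ
    (f := fun _ => 1) (K := 1) (fun _ => zero_le_one) (fun _ => le_rfl) (n + 1)
  have h3 := norm_sum_dirichletCharacter_sub_le ψ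
    (f := fun _ => 1) (K := 1) (fun _ => zero_le_one) (fun _ => le_rfl) (fun _ => le_rfl)
    primeLog_le_vonMangoldt primeLog_le_vonMangoldt (fun _ => le_rfl) n
  simp only [Complex.ofReal_one, mul_one, one_mul] at h1 h2 h3
  have h4 := hCb n
  refine (norm_sub_le_norm_sub_add_norm_sub _ (charSum primeLog
    (DirichletCharacter.changeLevel h ψ) n) _).trans ?_
  have h5 := norm_sub_le_norm_sub_add_norm_sub (charSum primeLog
    (DirichletCharacter.changeLevel h ψ) n) (charSum primeLog ψ n)
    (charSum (fun k => ArithmeticFunction.vonMangoldt k) ψ n)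
  simp only [charSum] at h5 ⊢
  linarith

lemma eventually_growth_le (C : ℝ) {δ : ℝ} (hδ : 0 < δ) :
    ∀ᶠ t : ℝ in atTop, C + 2 * Real.log t + 2 * Real.log t ^ 2 ≤ Real.exp (δ * t) := by
  have h1 := (isLittleO_pow_exp_pos_mul_atTop 2 hδ).bound (by norm_num : (0 : ℝ) < 1 / 4)
  filter_upwards [h1, eventually_ge_atTop C, eventually_ge_atTop 2] with t h2 h3 h4
  rw [Real.norm_of_nonneg (by positivity), Real.norm_of_nonneg (Real.exp_pos _).le] at h2
  have h5 : Real.log t ≤ t := Real.log_le_self (by linarith)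
  have h6 : 0 ≤ Real.log t := Real.log_nonneg (by linarith)
  nlinarith

lemma exists_variance_ge_of_not_GRH (h : ¬ GRH) (Q : ℝ → ℕ) {ε : ℝ} (hQt : Tendsto Q atTop atTop)
    (hε : 0 < ε) (hε2 : ε ≤ 1 / 512) (hQε : ∀ᶠ x : ℝ in atTop, (Q x : ℝ) ≤
      ε * Real.sqrt (Real.log (Real.log x)) / Real.sqrt (Real.log (Real.log (Real.log x))))
    (w : ℕ → ℝ) (F : ℝ → ℕ → ℝ) (hF : DominatesCharSums w F) (X : ℝ) : ∃ x : ℝ, X ≤ x ∧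
      x * Real.log (Real.log (Real.log x)) ^ 2 ≤
        (1 / (Q x : ℝ)) * ∑ q ∈ Finset.Ioc (Q x) (2 * Q x), F x q := by
  obtain ⟨C, hC, hCb⟩ := exists_norm_charSum_changeLevel_sub_le
  simp only [GRH, not_forall, not_not] at h
  obtain ⟨d, hd, χ, hχ, s, hs, h0⟩ := h
  set δ := (s.re - 1 / 2) / 2 with hδ
  have hδ0 : 0 < δ := by rw [hδ]; linarith
  have hL := Real.tendsto_log_atTop
  have hLL := hL.comp hL
  have hLLL := hL.comp hLL
  have hev := hQε.and ((hL.eventually (eventually_growth_le C hδ0)).and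
    ((hQt.eventually_ge_atTop d).and ((hLLL.eventually_ge_atTop 1).and
    ((hLL.eventually_ge_atTop 1).and ((eventually_ge_atTop X).and (eventually_ge_atTop 1))))))
  obtain ⟨N₀, hN₀⟩ := eventually_atTop.mp hev
  obtain ⟨n, hnN, hn⟩ := exists_lt_norm_charSum hχ (r := 1 / 2 + δ) (by linarith)
    (by rw [hδ]; linarith) h0 ⌈N₀⌉₊
  obtain ⟨hQn, hgr, hdQ, hl1, hL1, hXn, hn1⟩ := hN₀ n (Nat.ceil_le.mp hnN)
  simp only [Function.comp_apply] at hl1 hL1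
  refine ⟨n, hXn, ?_⟩
  set L := Real.log (Real.log (n : ℝ)) with hLdef
  set l := Real.log L with hldef
  have hlL : l ≤ L := Real.log_le_self (by linarith)
  have hd0 : 0 < d := Nat.pos_of_ne_zero hd.ne
  set m := Q n with hm
  have hm0 : 0 < m := hd0.trans_le hdQ
  have hmL : (m : ℝ) ≤ L := by
    refine hQn.trans ?_
    have h1 : 1 ≤ √l := Real.one_le_sqrt.mpr hl1
    have h2 : √L ≤ L := Real.sqrt_le_iff.mpr ⟨by linarith, by nlinarith⟩
    rw [div_le_iff₀ (by linarith)]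
    calc ε * √L ≤ 1 * L := by gcongr; linarith
      _ ≤ L * √l := by rw [one_mul]; exact le_mul_of_one_le_right (by linarith) h1
  set q := d * (m / d + 1) with hq
  have hq1 : m < q := Nat.lt_mul_div_succ m hd0
  have hq2 : q ≤ 2 * m := by
    have := Nat.mul_div_le m d
    rw [hq, mul_add, mul_one]; omega
  have hdq : d ∣ q := dvd_mul_right d _
  have hqz : NeZero q := ⟨by omega⟩
  have hψ : DirichletCharacter.changeLevel hdq χ ≠ 1 :=
    fun h => hχ ((DirichletCharacter.changeLevel_eq_one_iff hdq).mp h)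
  have hq2' : (q : ℝ) ≤ 2 * L := by
    have : (q : ℝ) ≤ 2 * m := by exact_mod_cast hq2
    linarith
  have hn0 : (0 : ℝ) < n := by linarith
  have hsn : 1 ≤ √(n : ℝ) := Real.one_le_sqrt.mpr hn1
  have hnr : (n : ℝ) ^ (1 / 2 + δ) = √n * Real.exp (δ * Real.log n) := by
    rw [Real.rpow_add hn0, ← Real.sqrt_eq_rpow, Real.rpow_def_of_pos hn0 δ, mul_comm δ]
  have hlogq : Real.log q ≤ √n * (2 * L) := by
    refine (Real.log_le_self (Nat.cast_nonneg q)).trans (hq2'.trans ?_)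
    exact le_mul_of_one_le_left (by linarith) hsn
  have hbig : √n * (2 * L ^ 2) ≤ ‖charSum w (DirichletCharacter.changeLevel hdq χ) n‖ := by
    have h1 := hCb d q hdq χ w n hqz.ne hF.1 hF.2.1
    have h2 := norm_sub_norm_le (charSum (fun k => ArithmeticFunction.vonMangoldt k) χ n)
      (charSum w (DirichletCharacter.changeLevel hdq χ) n)
    rw [norm_sub_rev] at h2
    have h3 := mul_le_mul_of_nonneg_left hgr (Real.sqrt_nonneg n)
    rw [← hnr] at h3
    linarith
  have hFnn : ∀ k ∈ Finset.Ioc m (2 * m), 0 ≤ F n k := by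
    intro k hk
    have : NeZero k := ⟨by have := (Finset.mem_Ioc.mp hk).1; omega⟩
    simpa using hF.2.2 k n ∅ (Finset.notMem_empty _)
  have hFq := hF.2.2 q n {DirichletCharacter.changeLevel hdq χ}
    (by simpa using fun h => hψ h.symm)
  rw [Finset.sum_singleton] at hFq
  have hsum := Finset.single_le_sum hFnn (Finset.mem_Ioc.mpr ⟨hq1, hq2⟩)
  have hφ0 : (0 : ℝ) < q.totient := by exact_mod_cast Nat.totient_pos.mpr (by omega)
  have hφ : (q.totient : ℝ) ≤ 2 * L := le_trans (by exact_mod_cast Nat.totient_le q) hq2'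
  have hm0' : (0 : ℝ) < m := by exact_mod_cast hm0
  calc (n : ℝ) * l ^ 2 ≤ n * L ^ 2 * 2 := by nlinarith [pow_le_pow_left₀ (by linarith) hlL 2]
    _ = 1 / L * (1 / (2 * L) * (√n * (2 * L ^ 2)) ^ 2) := by
        rw [mul_pow, Real.sq_sqrt hn0.le]; field_simp
    _ ≤ 1 / m * (1 / q.totient *
          ‖charSum w (DirichletCharacter.changeLevel hdq χ) n‖ ^ 2) := by gcongr
    _ ≤ _ := by gcongr; exact hFq.trans hsum

lemma exists_seq_variance_ge {c : ℝ} {Q : ℝ → ℕ} {F : ℝ → ℕ → ℝ}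
    (h : ∀ X : ℝ, ∃ x : ℝ, X ≤ x ∧ c * (x * Real.log (Real.log (Real.log x)) ^ 2) ≤
        (1 / (Q x : ℝ)) * ∑ q ∈ Finset.Ioc (Q x) (2 * Q x), F x q) :
    ∃ x : ℕ → ℝ, Tendsto x atTop atTop ∧ ∀ i,
      c * (x i * Real.log (Real.log (Real.log (x i))) ^ 2) ≤
        (1 / (Q (x i) : ℝ)) * ∑ q ∈ Finset.Ioc (Q (x i)) (2 * Q (x i)), F (x i) q := by
  choose x hx using fun i : ℕ => h i
  exact ⟨x, tendsto_atTop_mono (fun i => (hx i).1) tendsto_natCast_atTop_atTop, fun i => (hx i).2⟩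

lemma exists_variance_ge : ∃ c : ℝ, 0 < c ∧ ∀ (Q : ℝ → ℕ) (A ε : ℝ),
    Monotone Q → Tendsto Q atTop atTop → 0 < A →
    (∀ y : ℝ, 1 ≤ y → (Q (Real.exp (y ^ (3 : ℝ))) : ℝ) ≤ A * Q (Real.exp y)) →
    0 < ε → ε ≤ 1 / 512 → (∀ᶠ x : ℝ in atTop, (Q x : ℝ) ≤
      ε * Real.sqrt (Real.log (Real.log x)) / Real.sqrt (Real.log (Real.log (Real.log x)))) →
    ∀ (w : ℕ → ℝ) (F : ℝ → ℕ → ℝ), DominatesCharSums w F → ∀ X : ℝ, ∃ x : ℝ, X ≤ x ∧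
      c * (x * Real.log (Real.log (Real.log x)) ^ 2) ≤
        (1 / (Q x : ℝ)) * ∑ q ∈ Finset.Ioc (Q x) (2 * Q x), F x q := by
  by_cases h : GRH
  · exact h.exists_variance_ge_of_le
  · refine ⟨1, one_pos, fun Q A ε _ hQt _ _ hε hε2 hQε w F hF X => ?_⟩
    simpa only [one_mul] using exists_variance_ge_of_not_GRH h Q hQt hε hε2 hQε w F hF X

theorem average_over_q_oscillation :
    ∃ ε₀ : ℝ, 0 < ε₀ ∧ ∀ ε : ℝ, 0 < ε → ε ≤ ε₀ →
    ∀ Q : ℝ → ℕ, Monotone Q → Tendsto Q atTop atTop →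
    (∀ A : ℝ, 1 < A → ∃ C : ℝ, 0 < C ∧ ∀ y : ℝ, 1 ≤ y →
      (Q (Real.exp (y ^ A)) : ℝ) ≤ C * Q (Real.exp y)) →
    (∀ᶠ x : ℝ in atTop, (Q x : ℝ) ≤
      ε * Real.sqrt (Real.log (Real.log x)) / Real.sqrt (Real.log (Real.log (Real.log x)))) →
    (∃ c : ℝ, 0 < c ∧ ∃ x : ℕ → ℝ, Tendsto x atTop atTop ∧ ∀ i,
      c * (x i * Real.log (Real.log (Real.log (x i))) ^ 2) ≤
        (1 / (Q (x i) : ℝ)) * ∑ q ∈ Finset.Ioc (Q (x i)) (2 * Q (x i)), Gvar (x i) q) ∧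
    (∃ c : ℝ, 0 < c ∧ ∃ x : ℕ → ℝ, Tendsto x atTop atTop ∧ ∀ i,
      c * (x i * Real.log (Real.log (Real.log (x i))) ^ 2) ≤
        (1 / (Q (x i) : ℝ)) * ∑ q ∈ Finset.Ioc (Q (x i)) (2 * Q (x i)), Vvar (x i) q) := by
  obtain ⟨c, hc, h⟩ := exists_variance_ge
  refine ⟨1 / 512, by norm_num, fun ε hε hε2 Q hQ hQt hadm hQε => ?_⟩
  obtain ⟨A, hA, hA3⟩ := hadm 3 (by norm_num)
  have key := h Q A ε hQ hQt hA hA3 hε hε2 hQε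
  exact ⟨⟨c, hc, exists_seq_variance_ge (key _ _ dominatesCharSums_Gvar)⟩,
    ⟨c, hc, exists_seq_variance_ge (key _ _ dominatesCharSums_Vvar)⟩⟩
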